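/- The map M ↦ M(0) induces a bijection from the set of equivalence classes of irreducible admissible V-modules (normalized so M(0) ≠ 0) to the set of equivalence classes of simple A(V)-modules. -/

import Mathlib

/-- Generalized binomial coefficient `C(n, k)` for `n : ℤ`, valued in `ℂ`. -/
noncomputable def cbinom (n : ℤ) (k : ℕ) : ℂ :=
  (∏ i ∈ Finset.range k, ((n : ℂ) - (i : ℂ))) / (Nat.factorial k : ℂ)

/-- A vertex operator algebra structure on a complex vector space `V`. -/
structure VOA (V : Type) [AddCommGroup V] [Module ℂ V] where
  mode : V → ℤ → Module.End ℂ V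
  vacuum : V
  conformal : V
  grading : ℤ → Submodule ℂ V
  internal : Function.Bijective (DirectSum.coeLinearMap grading)
  mode_add : ∀ (u v : V) (n : ℤ), mode (u + v) n = mode u n + mode v n
  mode_smul : ∀ (c : ℂ) (u : V) (n : ℤ), mode (c • u) n = c • mode u n
  truncation : ∀ u v : V, ∃ N : ℤ, ∀ n : ℤ, N ≤ n → mode u n v = 0
  vacuum_mem : vacuum ∈ grading 0
  conformal_mem : conformal ∈ grading 2
  vacuum_mode : ∀ (v : V) (n : ℤ), mode vacuum n v = if n = -1 then v else 0
  creation : ∀ (u : V) (n : ℤ), 0 ≤ n → mode u n vacuum = 0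
  creation_neg_one : ∀ u : V, mode u (-1) vacuum = u
  L0_eigen : ∀ (n : ℤ) (u : V), u ∈ grading n → mode conformal 1 u = (n : ℂ) • u
  Lneg1_deriv : ∀ (u : V) (n : ℤ), mode (mode conformal 0 u) n = (-n : ℂ) • mode u (n - 1)
  grading_mode : ∀ (r s m : ℤ) (u v : V), u ∈ grading r → v ∈ grading s →
    mode u m v ∈ grading (r + s - m - 1)
  bounded_below : ∃ N : ℤ, ∀ n : ℤ, n < N → grading n = ⊥
  fin_dim : ∀ n : ℤ, FiniteDimensional ℂ (grading n)
  borcherds : ∀ (p q r : ℤ) (u v w : V),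
    (∑ᶠ i : ℕ, cbinom p i • mode (mode u (r + i) v) (p + q - i) w) =
    ∑ᶠ i : ℕ, ((-1 : ℂ) ^ i * cbinom r i) •
      (mode u (p + r - i) (mode v (q + i) w)
        - (-1 : ℂ) ^ r • mode v (q + r - i) (mode u (p + i) w))

variable {V : Type} [AddCommGroup V] [Module ℂ V]

/-- Projection onto the weight-`n` subspace. -/
noncomputable def VOA.proj (d : VOA V) (n : ℤ) : V →ₗ[ℂ] V :=
  (d.grading n).subtype ∘ₗ (DirectSum.component ℂ ℤ (fun m => d.grading m) n) ∘ₗ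
    (LinearEquiv.ofBijective (DirectSum.coeLinearMap d.grading) d.internal).symm.toLinearMap

/-- `Res_z (1+z)^N z^{-k} Y(u,z)v` for a vector `u` regarded as having weight contribution `N`. -/
noncomputable def VOA.hres (d : VOA V) (N k : ℤ) (u v : V) : V :=
  ∑ᶠ i : ℕ, cbinom N i • d.mode u ((i : ℤ) - k) v

/-- `Res_z (1+z)^{wt u + m} z^{-k} Y(u,z)v`, extended bilinearly from homogeneous `u`. -/
noncomputable def VOA.bres (d : VOA V) (m k : ℤ) (u v : V) : V :=
  ∑ᶠ n : ℤ, d.hres (n + m) k (d.proj n u) v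

/-- The Zhu product `u * v`. -/
noncomputable def VOA.star (d : VOA V) (u v : V) : V := d.bres 0 1 u v

/-- The Zhu circle product `u ∘ v`. -/
noncomputable def VOA.circ (d : VOA V) (u v : V) : V := d.bres 0 2 u v

/-- The subspace `O(V)` spanned by all `u ∘ v`. -/
def VOA.Ozhu (d : VOA V) : Submodule ℂ V := Submodule.span ℂ {w : V | ∃ u v : V, w = d.circ u v}

/-- The product `u ∘_n v`. -/
noncomputable def VOA.circn (d : VOA V) (n : ℕ) (u v : V) : V := d.bres n (2 * n + 2) u v

/-- The product `u *_n v` of Dong–Li–Mason. -/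
noncomputable def VOA.starn (d : VOA V) (n : ℕ) (u v : V) : V :=
  ∑ m ∈ Finset.range (n + 1),
    ((-1 : ℂ) ^ m * cbinom ((m : ℤ) + (n : ℤ)) n) • d.bres n ((n : ℤ) + (m : ℤ) + 1) u v

/-- The subspace `O_n(V)`. -/
def VOA.On (d : VOA V) (n : ℕ) : Submodule ℂ V :=
  Submodule.span ℂ ({w : V | ∃ u v : V, w = d.circn n u v} ∪
    {w : V | ∃ u : V, w = d.mode d.conformal 0 u + d.mode d.conformal 1 u})

/-- The Dong–Jiang product `u *_{m,p}^n v`. -/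
noncomputable def VOA.starmpn (d : VOA V) (m p n : ℕ) (u v : V) : V :=
  ∑ i ∈ Finset.range (p + 1),
    ((-1 : ℂ) ^ i * cbinom ((m : ℤ) + (n : ℤ) - (p : ℤ) + (i : ℤ)) i) •
      d.bres m ((m : ℤ) + (n : ℤ) - (p : ℤ) + (i : ℤ) + 1) u v

/-- The Dong–Jiang product `u ∘_m^n v`. -/
noncomputable def VOA.circmn (d : VOA V) (n m : ℕ) (u v : V) : V :=
  d.bres m ((n : ℤ) + (m : ℤ) + 2) u v

/-- The subspace `O_{n,m}(V) = O'_{n,m}(V) + O''_{n,m}(V) + O'''_{n,m}(V)` of Dong–Jiang. -/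
def VOA.Onm (d : VOA V) (n m : ℕ) : Submodule ℂ V :=
  Submodule.span ℂ (
    {w : V | ∃ u v : V, w = d.circmn n m u v} ∪
    {w : V | ∃ u : V, w = d.mode d.conformal 0 u + d.mode d.conformal 1 u
        + (((m : ℂ) - (n : ℂ)) • u)} ∪
    {w : V | ∃ (u a b c : V) (p₁ p₂ p₃ : ℕ), w = d.starmpn m p₃ n u
        (d.starmpn m p₁ p₃ (d.starmpn p₁ p₂ p₃ a b) c
          - d.starmpn m p₂ p₃ a (d.starmpn m p₁ p₂ b c))} ∪
    {w : V | ∃ (p : ℕ) (u x v : V), x ∈ d.On p ∧ w = d.starmpn m p n (d.starmpn p p n u x) v})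

/-- The subspace `C_2(V)` spanned by the `u_{-2} v`. -/
def VOA.C2 (d : VOA V) : Submodule ℂ V := Submodule.span ℂ {w : V | ∃ u v : V, w = d.mode u (-2) v}

/-- `V` is a simple vertex operator algebra: its only ideals are `0` and `V`. -/
def VOA.IsSimpleVOA (d : VOA V) : Prop :=
  (∃ v : V, v ≠ 0) ∧ ∀ P : Submodule ℂ V,
    (∀ (u : V) (n : ℤ), ∀ w ∈ P, d.mode u n w ∈ P) → P = ⊥ ∨ P = ⊤

/-- A weak module for the vertex operator algebra `d`. -/
structure WeakMod (d : VOA V) (M : Type) [AddCommGroup M] [Module ℂ M] where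
  act : V → ℤ → Module.End ℂ M
  act_add : ∀ (u v : V) (n : ℤ), act (u + v) n = act u n + act v n
  act_smul : ∀ (c : ℂ) (u : V) (n : ℤ), act (c • u) n = c • act u n
  truncation : ∀ (u : V) (w : M), ∃ N : ℤ, ∀ n : ℤ, N ≤ n → act u n w = 0
  vacuum_act : ∀ (w : M) (n : ℤ), act d.vacuum n w = if n = -1 then w else 0
  borcherds : ∀ (p q r : ℤ) (u v : V) (w : M),
    (∑ᶠ i : ℕ, cbinom p i • act (d.mode u (r + i) v) (p + q - i) w) =
    ∑ᶠ i : ℕ, ((-1 : ℂ) ^ i * cbinom r i) •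
      (act u (p + r - i) (act v (q + i) w)
        - (-1 : ℂ) ^ r • act v (q + r - i) (act u (p + i) w))

/-- An admissible (ℤ₊-graded) module for the vertex operator algebra `d`. -/
structure AdmMod (d : VOA V) (M : Type) [AddCommGroup M] [Module ℂ M]
    extends WeakMod d M where
  gr : ℤ → Submodule ℂ M
  gr_internal : Function.Bijective (DirectSum.coeLinearMap gr)
  gr_neg : ∀ n : ℤ, n < 0 → gr n = ⊥
  gr_act : ∀ (r : ℤ) (u : V), u ∈ d.grading r → ∀ (m n : ℤ) (w : M), w ∈ gr n →
    act u m w ∈ gr (r + n - m - 1)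

variable {M : Type} [AddCommGroup M] [Module ℂ M]

/-- The zero-mode `o(v) = v_{wt v - 1}`, extended linearly from homogeneous `v`. -/
noncomputable def WeakMod.o {d : VOA V} (W : WeakMod d M) (v : V) (w : M) : M :=
  ∑ᶠ r : ℤ, W.act (d.proj r v) (r - 1) w

/-- The mode `o_t(v) = v_{wt v - 1 - t}`, extended linearly from homogeneous `v`. -/
noncomputable def WeakMod.ot {d : VOA V} (W : WeakMod d M) (t : ℤ) (v : V) (w : M) : M :=
  ∑ᶠ r : ℤ, W.act (d.proj r v) (r - 1 - t) w

/-- The subspace `Ω_n(M)` of a weak module. -/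
def WeakMod.OmegaSet {d : VOA V} (W : WeakMod d M) (n : ℕ) : Set M :=
  {w : M | ∀ (r : ℤ) (u : V), u ∈ d.grading r → ∀ m : ℤ, m > r - 1 + (n : ℤ) → W.act u m w = 0}

/-- A subspace stable under all modes. -/
def WeakMod.IsStable {d : VOA V} (W : WeakMod d M) (P : Submodule ℂ M) : Prop :=
  ∀ (u : V) (n : ℤ), ∀ w ∈ P, W.act u n w ∈ P

/-- A subspace compatible with the grading of an admissible module. -/
def AdmMod.IsGraded {d : VOA V} (A : AdmMod d M) (P : Submodule ℂ M) : Prop :=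
  P = ⨆ n : ℤ, (P ⊓ A.gr n)

/-- `P` is an irreducible admissible submodule. -/
def AdmMod.IrredSub {d : VOA V} (A : AdmMod d M) (P : Submodule ℂ M) : Prop :=
  P ≠ ⊥ ∧ A.toWeakMod.IsStable P ∧ A.IsGraded P ∧
    ∀ Q : Submodule ℂ M, Q ≤ P → A.toWeakMod.IsStable Q → A.IsGraded Q → Q = ⊥ ∨ Q = P

/-- The admissible module is irreducible. -/
def AdmMod.IsIrreducible {d : VOA V} (A : AdmMod d M) : Prop :=
  (∃ w : M, w ≠ 0) ∧
    ∀ P : Submodule ℂ M, A.toWeakMod.IsStable P → A.IsGraded P → P = ⊥ ∨ P = ⊤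

/-- Rationality: every admissible module is a direct sum of irreducible admissible submodules. -/
def Rational (d : VOA V) : Prop :=
  ∀ (M : Type) [AddCommGroup M] [Module ℂ M] (A : AdmMod d M),
    ∃ (ι : Type) (f : ι → Submodule ℂ M),
      (∀ i, A.IrredSub (f i)) ∧ iSupIndep f ∧ (⨆ i, f i) = ⊤

/-- Equivalence of admissible modules. -/
def AdmEquiv {d : VOA V} {M₁ M₂ : Type} [AddCommGroup M₁] [Module ℂ M₁]
    [AddCommGroup M₂] [Module ℂ M₂] (A₁ : AdmMod d M₁) (A₂ : AdmMod d M₂) : Prop :=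
  ∃ e : M₁ ≃ₗ[ℂ] M₂, ∀ (u : V) (n : ℤ) (w : M₁), e (A₁.act u n w) = A₂.act u n (e w)

/-- An ordinary-module structure on a weak module: a `ℂ`-grading by finite dimensional
`L(0)`-eigenspaces, bounded below in each coset of `ℤ`. -/
structure OrdinaryStruct {d : VOA V} (W : WeakMod d M) where
  grc : ℂ → Submodule ℂ M
  internal : Function.Bijective (DirectSum.coeLinearMap grc)
  eigen : ∀ (lam : ℂ) (w : M), w ∈ grc lam → W.act d.conformal 1 w = lam • w
  findim : ∀ lam : ℂ, FiniteDimensional ℂ (grc lam)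
  bounded : ∀ lam : ℂ, ∃ N : ℤ, ∀ n : ℤ, n < N → grc (lam + (n : ℂ)) = ⊥

/-- An admissible module is ordinary. -/
def AdmMod.IsOrdinary {d : VOA V} (A : AdmMod d M) : Prop :=
  Nonempty (OrdinaryStruct A.toWeakMod)

/-- A realization of the quotient associative algebra `V/Osub` with product induced by `mu`. -/
structure Realization (Osub : Submodule ℂ V) (mu : V → V → V) (one : V) where
  carrier : Type
  [ring : Ring carrier]
  [alg : Algebra ℂ carrier]
  emb : V →ₗ[ℂ] carrier
  surj : Function.Surjective emb
  ker_eq : LinearMap.ker emb = Osub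
  mul_compat : ∀ u v : V, emb (mu u v) = emb u * emb v
  one_compat : emb one = 1

/-- The realized algebra is semisimple. -/
def Realization.Semisimple {Osub : Submodule ℂ V} {mu : V → V → V} {one : V}
    (R : Realization Osub mu one) : Prop :=
  letI := R.ring; IsSemisimpleRing R.carrier

/-- The realized algebra is finite dimensional over `ℂ`. -/
def Realization.FinDim {Osub : Submodule ℂ V} {mu : V → V → V} {one : V}
    (R : Realization Osub mu one) : Prop :=
  letI := R.ring; letI := R.alg; FiniteDimensional ℂ R.carrier

/-- A module over the quotient algebra `V/Osub`, given as a representation of `V`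
killing `Osub` and multiplicative for `mu`. -/
structure RepOf (Osub : Submodule ℂ V) (mu : V → V → V) (one : V)
    (U : Type) [AddCommGroup U] [Module ℂ U] where
  rep : V →ₗ[ℂ] Module.End ℂ U
  kills : ∀ v ∈ Osub, rep v = 0
  mul_compat : ∀ u v : V, rep (mu u v) = rep u * rep v
  one_compat : rep one = 1

/-- Simplicity of such a representation. -/
def RepOf.IsSimple {Osub : Submodule ℂ V} {mu : V → V → V} {one : V}
    {U : Type} [AddCommGroup U] [Module ℂ U] (Z : RepOf Osub mu one U) : Prop :=
  (∃ u : U, u ≠ 0) ∧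
    ∀ P : Submodule ℂ U, (∀ v : V, ∀ x ∈ P, Z.rep v x ∈ P) → P = ⊥ ∨ P = ⊤

/-- Equivalence of two such representations. -/
def RepEquiv {Osub : Submodule ℂ V} {mu : V → V → V} {one : V}
    {U₁ U₂ : Type} [AddCommGroup U₁] [Module ℂ U₁] [AddCommGroup U₂] [Module ℂ U₂]
    (Z₁ : RepOf Osub mu one U₁) (Z₂ : RepOf Osub mu one U₂) : Prop :=
  ∃ e : U₁ ≃ₗ[ℂ] U₂, ∀ (v : V) (x : U₁), e (Z₁.rep v x) = Z₂.rep v (e x)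

theorem cbinom_eq_choose (n : ℤ) (k : ℕ) : cbinom n k = ((Ring.choose n k : ℤ) : ℂ) := by
  have h := Ring.descPochhammer_eq_factorial_smul_choose n k
  have h2 : ∀ k : ℕ, (((descPochhammer ℤ k).smeval n : ℤ) : ℂ)
      = ∏ i ∈ Finset.range k, ((n : ℂ) - (i : ℂ)) := by
    intro k
    induction k with
    | zero => simp
    | succ k ih =>
      rw [Finset.prod_range_succ, ← ih, descPochhammer_succ_right, Polynomial.smeval_mul]
      simp [Polynomial.smeval_sub, Polynomial.smeval_natCast]
  unfold cbinom
  have : (Nat.factorial k : ℂ) ≠ 0 := by exact_mod_cast Nat.factorial_ne_zero k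
  rw [← h2, h, div_eq_iff this, nsmul_eq_mul]
  push_cast
  ring

theorem cbinom_zero_right (n : ℤ) : cbinom n 0 = 1 := by
  simp [cbinom]

theorem cbinom_zero_left (k : ℕ) : cbinom 0 k = if k = 0 then 1 else 0 := by
  rw [cbinom_eq_choose, Ring.choose_zero_ite]
  split_ifs <;> simp

theorem cbinom_add (m n : ℤ) (k : ℕ) :
    cbinom (m + n) k = ∑ ij ∈ Finset.HasAntidiagonal.antidiagonal k, cbinom m ij.1 * cbinom n ij.2 := by
  simp only [cbinom_eq_choose]
  rw [Ring.add_choose_eq k (Commute.all m n)]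
  push_cast
  rfl

theorem cbinom_succ_succ (n : ℤ) (k : ℕ) :
    cbinom (n + 1) (k + 1) = cbinom n k + cbinom n (k + 1) := by
  simp only [cbinom_eq_choose]
  rw [Ring.choose_succ_succ]
  push_cast
  rfl

theorem cbinom_succ_mul (n : ℤ) (k : ℕ) :
    cbinom n (k + 1) * ((k : ℂ) + 1) = cbinom n k * ((n : ℂ) - k) := by
  unfold cbinom
  rw [Finset.prod_range_succ, Nat.factorial_succ]
  have : (Nat.factorial k : ℂ) ≠ 0 := by exact_mod_cast Nat.factorial_ne_zero k
  have : (k : ℂ) + 1 ≠ 0 := by exact_mod_cast Nat.succ_ne_zero k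
  push_cast
  field_simp

theorem mul_cbinom_pred (n : ℤ) (k : ℕ) :
    (n : ℂ) * cbinom (n - 1) k = cbinom n (k + 1) * ((k : ℂ) + 1) := by
  unfold cbinom
  rw [Finset.prod_range_succ', Nat.factorial_succ]
  have : (Nat.factorial k : ℂ) ≠ 0 := by exact_mod_cast Nat.factorial_ne_zero k
  have : (k : ℂ) + 1 ≠ 0 := by exact_mod_cast Nat.succ_ne_zero k
  have h : ∀ i : ℕ, ((n - 1 : ℤ) : ℂ) - (i : ℂ) = (n : ℂ) - ((i + 1 : ℕ) : ℂ) := by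
    intro i; push_cast; ring
  simp only [h]
  push_cast
  field_simp
  simp [mul_comm]

theorem cbinom_neg_one (k : ℕ) : cbinom (-1) k = (-1) ^ k := by
  induction k with
  | zero => simp [cbinom_zero_right]
  | succ k ih =>
    have h := cbinom_succ_mul (-1) k
    have h1 : (k : ℂ) + 1 ≠ 0 := by exact_mod_cast Nat.succ_ne_zero k
    rw [ih] at h
    apply mul_right_cancel₀ h1
    rw [h]; push_cast; ring

theorem cbinom_neg (n : ℤ) (k : ℕ) : cbinom (-n) k = (-1) ^ k * cbinom (n + k - 1) k := by
  unfold cbinom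
  rw [← mul_div_assoc, ← Finset.prod_range_reflect (fun i : ℕ => ((n + k - 1 : ℤ) : ℂ) - (i : ℂ))]
  congr 1
  have : ((-1 : ℂ)) ^ k = ∏ i ∈ Finset.range k, (-1 : ℂ) := by simp
  rw [this, ← Finset.prod_mul_distrib]
  refine Finset.prod_congr rfl fun i hi => ?_
  have hi := Finset.mem_range.1 hi
  rw [Nat.sub_sub, Nat.cast_sub (by omega)]
  push_cast; ring

theorem cbinom_eq_zero_of_lt {n : ℤ} {k : ℕ} (h0 : 0 ≤ n) (h : n < k) : cbinom n k = 0 := by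
  lift n to ℕ using h0
  rw [cbinom_eq_choose]
  rw [Ring.choose_natCast, Nat.choose_eq_zero_of_lt (by omega)]
  simp

/-- A sequence which vanishes from some index on. -/
def EvZero {M : Type*} [Zero M] (X : ℕ → M) : Prop := ∃ N : ℕ, ∀ i, N ≤ i → X i = 0

section EvZero

variable {M N : Type*} [AddCommGroup M] [AddCommGroup N]

theorem finsum_eq_sum_range {X : ℕ → M} {n : ℕ} (h : ∀ i, n ≤ i → X i = 0) :
    ∑ᶠ i, X i = ∑ i ∈ Finset.range n, X i := by
  apply finsum_eq_sum_of_support_subset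
  intro i hi
  by_contra hc
  exact hi (h i (by simpa using hc))

theorem EvZero.finite {X : ℕ → M} (h : EvZero X) : X.support.Finite := by
  obtain ⟨n, hn⟩ := h
  refine (Finset.range n).finite_toSet.subset fun i hi => ?_
  by_contra hc
  exact hi (hn i (by simpa using hc))

theorem EvZero.shift {X : ℕ → M} (h : EvZero X) : EvZero fun i => X (i + 1) := by
  obtain ⟨n, hn⟩ := h
  exact ⟨n, fun i hi => hn _ (by omega)⟩

theorem EvZero.finsum_succ {X : ℕ → M} (h : EvZero X) :
    ∑ᶠ i, X i = X 0 + ∑ᶠ i, X (i + 1) := by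
  obtain ⟨n, hn⟩ := h
  rw [finsum_eq_sum_range (n := n + 1) fun i hi => hn i (by omega),
    finsum_eq_sum_range (n := n) fun i hi => hn (i + 1) (by omega), Finset.sum_range_succ',
    add_comm]

variable [Module ℂ M] [Module ℂ N]

theorem EvZero.smul {X : ℕ → M} (h : EvZero X) (c : ℕ → ℂ) : EvZero fun i => c i • X i := by
  obtain ⟨n, hn⟩ := h
  exact ⟨n, fun i hi => by simp [hn i hi]⟩

theorem EvZero.map_finsum {X : ℕ → M} (h : EvZero X) (f : M →ₗ[ℂ] N) :
    f (∑ᶠ i, X i) = ∑ᶠ i, f (X i) :=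
  f.toAddMonoidHom.map_finsum h.finite

/-- The binomial transform `∑ᵢ C(p, i) Xᵢ`. -/
noncomputable def binomSum (p : ℤ) (X : ℕ → M) : M := ∑ᶠ i, cbinom p i • X i

theorem binomSum_eq_sum_range (p : ℤ) {X : ℕ → M} {n : ℕ} (h : ∀ i, n ≤ i → X i = 0) :
    binomSum p X = ∑ i ∈ Finset.range n, cbinom p i • X i :=
  finsum_eq_sum_range fun i hi => by simp [h i hi]

theorem binomSum_add (p : ℤ) {X Y : ℕ → M} (hX : EvZero X) (hY : EvZero Y) :
    binomSum p (fun i => X i + Y i) = binomSum p X + binomSum p Y := by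
  unfold binomSum
  simp only [smul_add]
  exact finsum_add_distrib (hX.smul _).finite (hY.smul _).finite

theorem binomSum_smul (p : ℤ) (c : ℂ) (X : ℕ → M) :
    binomSum p (fun i => c • X i) = c • binomSum p X := by
  unfold binomSum
  simp only [smul_comm _ c]
  exact (smul_finsum c _).symm

theorem binomSum_neg (p : ℤ) (X : ℕ → M) :
    binomSum p (fun i => - X i) = - binomSum p X := by
  simpa using binomSum_smul p (-1) X

theorem map_binomSum (p : ℤ) {X : ℕ → M} (hX : EvZero X) (f : M →ₗ[ℂ] N) :
    f (binomSum p X) = binomSum p fun i => f (X i) := by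
  unfold binomSum
  rw [(hX.smul _).map_finsum]
  simp

theorem binomSum_succ (p : ℤ) {X : ℕ → M} (hX : EvZero X) :
    binomSum (p + 1) X = binomSum p X + binomSum p fun i => X (i + 1) := by
  unfold binomSum
  rw [(hX.smul (cbinom (p + 1))).finsum_succ, (hX.smul (cbinom p)).finsum_succ, add_assoc]
  congr 1
  rw [← finsum_add_distrib (hX.shift.smul fun i => cbinom p (i + 1)).finite
    (hX.shift.smul _).finite]
  refine finsum_congr fun i => ?_
  rw [← add_smul, cbinom_succ_succ, add_comm]

theorem binomSum_index_mul (p : ℤ) {X : ℕ → M} (hX : EvZero X) :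
    binomSum p (fun i => (i : ℂ) • X i) = (p : ℂ) • binomSum (p - 1) fun i => X (i + 1) := by
  unfold binomSum
  rw [((hX.smul fun i => (i : ℂ)).smul (cbinom p)).finsum_succ, smul_finsum]
  simp only [Nat.cast_zero, zero_smul, smul_zero, zero_add]
  refine finsum_congr fun i => ?_
  rw [smul_smul, smul_smul, mul_cbinom_pred]
  push_cast; rfl

theorem binomSum_index_compl_mul (p : ℤ) (X : ℕ → M) :
    binomSum p (fun i => ((p : ℂ) - i) • X i) = (p : ℂ) • binomSum (p - 1) X := by
  unfold binomSum
  rw [smul_finsum]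
  refine finsum_congr fun i => ?_
  rw [smul_smul, smul_smul, mul_cbinom_pred, cbinom_succ_mul]

theorem binomSum_of_tail_eq_zero (p : ℤ) {X : ℕ → M} (h : ∀ i, X (i + 1) = 0) :
    binomSum p X = X 0 := by
  rw [binomSum_eq_sum_range (n := 1) p fun i hi => by
    obtain ⟨j, rfl⟩ := Nat.exists_eq_add_of_le' hi
    exact h j]
  simp [cbinom_zero_right]

end EvZero

theorem VOA.exists_nat_truncation (d : VOA V) (u v : V) (r : ℤ) :
    EvZero fun i : ℕ => d.mode u (r + i) v := by
  obtain ⟨N, hN⟩ := d.truncation u v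
  exact ⟨(N - r).toNat, fun i hi => hN _ (by omega)⟩

/-- A linear truncated assignment of modes on `M` to the vectors of `V`. -/
structure ModeMap (d : VOA V) (M : Type) [AddCommGroup M] [Module ℂ M] where
  act : V → ℤ → Module.End ℂ M
  act_add : ∀ (u v : V) (n : ℤ), act (u + v) n = act u n + act v n
  act_smul : ∀ (c : ℂ) (u : V) (n : ℤ), act (c • u) n = c • act u n
  truncation : ∀ (u : V) (w : M), ∃ N : ℤ, ∀ n : ℤ, N ≤ n → act u n w = 0

namespace ModeMap

variable {d : VOA V} (T : ModeMap d M)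

/-- The modes of index `n`, as a linear map in the vector of `V`. -/
def actL (n : ℤ) : V →ₗ[ℂ] Module.End ℂ M where
  toFun u := T.act u n
  map_add' u v := T.act_add u v n
  map_smul' c u := T.act_smul c u n

theorem act_zero (n : ℤ) : T.act 0 n = 0 := map_zero (T.actL n)

theorem evZero_act (u : V) (w : M) (q : ℤ) : EvZero fun i : ℕ => T.act u (q + i) w := by
  obtain ⟨N, hN⟩ := T.truncation u w
  exact ⟨(N - q).toNat, fun i hi => hN _ (by omega)⟩

/-- The left side summands of the Borcherds identity. -/
def iterTerm (u v : V) (w : M) (r s : ℤ) (i : ℕ) : M := T.act (d.mode u (r + i) v) (s - i) w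

/-- The summands `(-1)ⁱ u_{m-i} v_{q+i} w` of the Borcherds identity. -/
def prodTerm (u v : V) (w : M) (m q : ℤ) (i : ℕ) : M :=
  (-1 : ℂ) ^ i • T.act u (m - i) (T.act v (q + i) w)

theorem evZero_iterTerm (u v : V) (w : M) (r s : ℤ) : EvZero (T.iterTerm u v w r s) := by
  obtain ⟨N, hN⟩ := d.exists_nat_truncation u v r
  exact ⟨N, fun i hi => by simp [iterTerm, hN i hi, act_zero]⟩

theorem evZero_prodTerm (u v : V) (w : M) (m q : ℤ) : EvZero (T.prodTerm u v w m q) := by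
  obtain ⟨N, hN⟩ := T.evZero_act v w q
  exact ⟨N, fun i hi => by simp [prodTerm, hN i hi]⟩

/-- The Borcherds identity for given indices and vectors. -/
def BorcherdsAt (p q r : ℤ) (u v : V) (w : M) : Prop :=
  binomSum p (T.iterTerm u v w r (p + q)) =
    binomSum r (T.prodTerm u v w (p + r) q)
      - (-1 : ℂ) ^ r • binomSum r (T.prodTerm v u w (q + r) p)

theorem borcherdsAt_iff (p q r : ℤ) (u v : V) (w : M) :
    T.BorcherdsAt p q r u v w ↔
    (∑ᶠ i : ℕ, cbinom p i • T.act (d.mode u (r + i) v) (p + q - i) w) =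
    ∑ᶠ i : ℕ, ((-1 : ℂ) ^ i * cbinom r i) •
      (T.act u (p + r - i) (T.act v (q + i) w)
        - (-1 : ℂ) ^ r • T.act v (q + r - i) (T.act u (p + i) w)) := by
  have : binomSum r (T.prodTerm u v w (p + r) q)
      - (-1 : ℂ) ^ r • binomSum r (T.prodTerm v u w (q + r) p) =
      ∑ᶠ i : ℕ, ((-1 : ℂ) ^ i * cbinom r i) •
      (T.act u (p + r - i) (T.act v (q + i) w)
        - (-1 : ℂ) ^ r • T.act v (q + r - i) (T.act u (p + i) w)) := by
    rw [← binomSum_smul, sub_eq_add_neg, ← binomSum_neg, ← binomSum_add]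
    · refine finsum_congr fun i => ?_
      simp only [prodTerm]
      module
    · exact T.evZero_prodTerm _ _ _ _ _
    · simpa using (((T.evZero_prodTerm v u w (q + r) p).smul fun _ => -(-1 : ℂ) ^ r))
  unfold BorcherdsAt
  rw [this]
  rfl

theorem iterTerm_succ (u v : V) (w : M) (r s : ℤ) (i : ℕ) :
    T.iterTerm u v w r s (i + 1) = T.iterTerm u v w (r + 1) (s - 1) i := by
  unfold iterTerm
  have h1 : r + ((i + 1 : ℕ) : ℤ) = r + 1 + i := by push_cast; ring
  have h2 : s - ((i + 1 : ℕ) : ℤ) = s - 1 - i := by push_cast; ring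
  rw [h1, h2]

theorem prodTerm_succ (u v : V) (w : M) (m q : ℤ) (i : ℕ) :
    T.prodTerm u v w m q (i + 1) = - T.prodTerm u v w (m - 1) (q + 1) i := by
  unfold prodTerm
  have h1 : m - ((i + 1 : ℕ) : ℤ) = m - 1 - i := by push_cast; ring
  have h2 : q + ((i + 1 : ℕ) : ℤ) = q + 1 + i := by push_cast; ring
  rw [h1, h2, pow_succ]
  module

theorem binomSum_iterTerm (p s r : ℤ) (u v : V) (w : M) :
    binomSum (p + 1) (T.iterTerm u v w r s) =
      binomSum p (T.iterTerm u v w r s) + binomSum p (T.iterTerm u v w (r + 1) (s - 1)) := by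
  rw [binomSum_succ p (T.evZero_iterTerm u v w r s)]
  simp only [iterTerm_succ]

theorem binomSum_prodTerm (p m q : ℤ) (u v : V) (w : M) :
    binomSum (p + 1) (T.prodTerm u v w m q) =
      binomSum p (T.prodTerm u v w m q) - binomSum p (T.prodTerm u v w (m - 1) (q + 1)) := by
  rw [binomSum_succ p (T.evZero_prodTerm u v w m q)]
  simp only [prodTerm_succ]
  rw [binomSum_neg, ← sub_eq_add_neg]

/-- The difference of the two sides of the Borcherds identity. -/
noncomputable def defect (p q r : ℤ) (u v : V) (w : M) : M :=
  binomSum p (T.iterTerm u v w r (p + q)) -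
    (binomSum r (T.prodTerm u v w (p + r) q)
      - (-1 : ℂ) ^ r • binomSum r (T.prodTerm v u w (q + r) p))

theorem borcherdsAt_iff_defect (p q r : ℤ) (u v : V) (w : M) :
    T.BorcherdsAt p q r u v w ↔ T.defect p q r u v w = 0 := by
  unfold BorcherdsAt defect
  rw [sub_eq_zero]

theorem defect_succ (p q r : ℤ) (u v : V) (w : M) :
    T.defect p q (r + 1) u v w = T.defect (p + 1) q r u v w - T.defect p (q + 1) r u v w := by
  unfold defect
  rw [T.binomSum_iterTerm, T.binomSum_prodTerm, T.binomSum_prodTerm,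
    zpow_add_one₀ (by norm_num : (-1 : ℂ) ≠ 0)]
  rw [show p + 1 + q = p + q + 1 by ring, show p + (q + 1) = p + q + 1 by ring,
    show p + q + 1 - 1 = p + q by ring, show p + (r + 1) - 1 = p + r by ring,
    show q + (r + 1) - 1 = q + r by ring, show p + 1 + r = p + (r + 1) by ring,
    show q + 1 + r = q + (r + 1) by ring]
  module

theorem binomSum_iterTerm_deriv (p s r : ℤ) (u v : V) (w : M) :
    binomSum p (T.iterTerm (d.mode d.conformal 0 u) v w r s) =
      -(r : ℂ) • binomSum p (T.iterTerm u v w (r - 1) s)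
        - (p : ℂ) • binomSum (p - 1) (T.iterTerm u v w r (s - 1)) := by
  have h : T.iterTerm (d.mode d.conformal 0 u) v w r s = fun i =>
      -(r : ℂ) • T.iterTerm u v w (r - 1) s i
        + (-1 : ℂ) • ((i : ℂ) • T.iterTerm u v w (r - 1) s i) := by
    funext i
    unfold iterTerm
    rw [d.Lneg1_deriv, show r + (i : ℤ) - 1 = r - 1 + i by ring, LinearMap.smul_apply,
      T.act_smul, LinearMap.smul_apply]
    push_cast
    module
  have hX := T.evZero_iterTerm u v w (r - 1) s
  rw [h, binomSum_add p (hX.smul _) ((hX.smul _).smul _), binomSum_smul, binomSum_smul,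
    binomSum_index_mul p hX]
  simp only [iterTerm_succ, sub_add_cancel]
  module

theorem binomSum_prodTerm_deriv_left
    (hD : ∀ (u : V) (n : ℤ) (w : M),
      T.act (d.mode d.conformal 0 u) n w = (-n : ℂ) • T.act u (n - 1) w)
    (p q r : ℤ) (u v : V) (w : M) :
    binomSum r (T.prodTerm (d.mode d.conformal 0 u) v w (p + r) q) =
      -(p : ℂ) • binomSum r (T.prodTerm u v w (p + r - 1) q)
        - (r : ℂ) • binomSum (r - 1) (T.prodTerm u v w (p + r - 1) q) := by
  have h : T.prodTerm (d.mode d.conformal 0 u) v w (p + r) q = fun i =>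
      -(p : ℂ) • T.prodTerm u v w (p + r - 1) q i
        + (-1 : ℂ) • (((r : ℂ) - i) • T.prodTerm u v w (p + r - 1) q i) := by
    funext i
    unfold prodTerm
    rw [hD, show p + r - (i : ℤ) - 1 = p + r - 1 - i by ring]
    push_cast
    module
  have hX := T.evZero_prodTerm u v w (p + r - 1) q
  rw [h, binomSum_add r (hX.smul _) ((hX.smul _).smul _), binomSum_smul, binomSum_smul,
    binomSum_index_compl_mul]
  module

theorem binomSum_prodTerm_deriv_right
    (hD : ∀ (u : V) (n : ℤ) (w : M),
      T.act (d.mode d.conformal 0 u) n w = (-n : ℂ) • T.act u (n - 1) w)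
    (p m r : ℤ) (u v : V) (w : M) :
    binomSum r (T.prodTerm v (d.mode d.conformal 0 u) w m p) =
      -(p : ℂ) • binomSum r (T.prodTerm v u w m (p - 1))
        + (r : ℂ) • binomSum (r - 1) (T.prodTerm v u w (m - 1) p) := by
  have h : T.prodTerm v (d.mode d.conformal 0 u) w m p = fun i =>
      -(p : ℂ) • T.prodTerm v u w m (p - 1) i
        + (-1 : ℂ) • ((i : ℂ) • T.prodTerm v u w m (p - 1) i) := by
    funext i
    unfold prodTerm
    rw [hD, show p + (i : ℤ) - 1 = p - 1 + i by ring, map_smul]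
    push_cast
    module
  have hX := T.evZero_prodTerm v u w m (p - 1)
  rw [h, binomSum_add r (hX.smul _) ((hX.smul _).smul _), binomSum_smul, binomSum_smul,
    binomSum_index_mul r hX]
  simp only [prodTerm_succ, sub_add_cancel, binomSum_neg]
  module

theorem defect_deriv
    (hD : ∀ (u : V) (n : ℤ) (w : M),
      T.act (d.mode d.conformal 0 u) n w = (-n : ℂ) • T.act u (n - 1) w)
    (p q r : ℤ) (u v : V) (w : M) :
    T.defect p q r (d.mode d.conformal 0 u) v w =
      -(p : ℂ) • T.defect (p - 1) q r u v w - (r : ℂ) • T.defect p q (r - 1) u v w := by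
  unfold defect
  rw [T.binomSum_iterTerm_deriv, T.binomSum_prodTerm_deriv_left hD,
    T.binomSum_prodTerm_deriv_right hD, zpow_sub_one₀ (by norm_num : (-1 : ℂ) ≠ 0),
    show p - 1 + q = p + q - 1 by ring, show p - 1 + r = p + r - 1 by ring,
    show p + (r - 1) = p + r - 1 by ring, show q + (r - 1) = q + r - 1 by ring,
    show ((-1 : ℂ))⁻¹ = -1 by norm_num]
  module

/-- The Borcherds identity follows from its commutator case `r = 0`, one instance with `r = -1` for
every total degree, and the derivative property. -/
theorem borcherdsAt_of_comm
    (hD : ∀ (u : V) (n : ℤ) (w : M),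
      T.act (d.mode d.conformal 0 u) n w = (-n : ℂ) • T.act u (n - 1) w)
    (hcomm : ∀ (p q : ℤ) (u v : V) (w : M), T.BorcherdsAt p q 0 u v w)
    (hprod : ∀ (s : ℤ) (u v : V) (w : M), ∃ p : ℤ, T.BorcherdsAt p (s - p) (-1) u v w)
    (p q r : ℤ) (u v : V) (w : M) : T.BorcherdsAt p q r u v w := by
  simp only [borcherdsAt_iff_defect] at hcomm hprod ⊢
  have hnonneg : ∀ n : ℕ, ∀ (p q : ℤ) (u v : V) (w : M), T.defect p q n u v w = 0 := by
    intro n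
    induction n with
    | zero => exact hcomm
    | succ n ih =>
      intro p q u v w
      push_cast
      rw [defect_succ, ih, ih, sub_zero]
  have hneg : ∀ n : ℕ, ∀ (p q : ℤ) (u v : V) (w : M), T.defect p q (-1 - n) u v w = 0 := by
    intro n
    induction n with
    | zero =>
      intro p q u v w
      simp only [Nat.cast_zero, sub_zero]
      have hstep : ∀ p q : ℤ, T.defect (p + 1) q (-1) u v w = T.defect p (q + 1) (-1) u v w := by
        intro p q
        have h := T.defect_succ p q (-1) u v w
        rw [show (-1 : ℤ) + 1 = 0 by ring, hcomm] at h
        exact (sub_eq_zero.1 h.symm)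
      obtain ⟨p₀, h₀⟩ := hprod (p + q) u v w
      have hall : ∀ k : ℤ, T.defect (p₀ + k) (p + q - p₀ - k) (-1) u v w = 0 := by
        intro k
        induction k using Int.induction_on with
        | zero => simpa using h₀
        | succ k ih =>
          rw [← add_assoc, hstep]
          rw [← ih]
          congr 1
          ring
        | pred k ih =>
          rw [← ih, show p₀ + -(k : ℤ) = p₀ + (-(k : ℤ) - 1) + 1 by ring, hstep]
          congr 1
          ring
      have := hall (p - p₀)
      rwa [show p₀ + (p - p₀) = p by ring, show p + q - p₀ - (p - p₀) = q by ring] at this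
    | succ n ih =>
      intro p q u v w
      have h := T.defect_deriv hD p q (-1 - n) u v w
      rw [ih, ih, smul_zero, zero_sub] at h
      have hne : ((-1 - n : ℤ) : ℂ) ≠ 0 := by
        exact_mod_cast (by omega : (-1 - (n : ℤ)) ≠ 0)
      have h' := (smul_eq_zero.1 (neg_eq_zero.1 h.symm)).resolve_left hne
      rw [← h']
      push_cast
      congr 1
      ring
  rcases le_or_gt 0 r with h | h
  · lift r to ℕ using h
    exact hnonneg r p q u v w
  · have := hneg (-1 - r).toNat p q u v w
    rwa [show -1 - ((-1 - r).toNat : ℤ) = r by omega] at this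

end ModeMap

section GradedProj

variable {gr : ℤ → Submodule ℂ M}

/-- The projection onto a homogeneous component of an internal direct sum. -/
noncomputable def gradedProj (h : Function.Bijective (DirectSum.coeLinearMap gr)) (n : ℤ) :
    M →ₗ[ℂ] M :=
  (gr n).subtype ∘ₗ (DirectSum.component ℂ ℤ (fun m => gr m) n) ∘ₗ
    (LinearEquiv.ofBijective (DirectSum.coeLinearMap gr) h).symm.toLinearMap

variable (h : Function.Bijective (DirectSum.coeLinearMap gr))

theorem gradedProj_mem (n : ℤ) (x : M) : gradedProj h n x ∈ gr n := by
  simp [gradedProj]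

theorem gradedProj_of_mem {m : ℤ} {x : M} (hx : x ∈ gr m) (n : ℤ) :
    gradedProj h n x = if n = m then x else 0 := by
  have key : (LinearEquiv.ofBijective (DirectSum.coeLinearMap gr) h).symm x
      = DirectSum.lof ℂ ℤ (fun m => gr m) m ⟨x, hx⟩ := by
    rw [LinearEquiv.symm_apply_eq]
    simp
  simp only [gradedProj, LinearMap.comp_apply, LinearEquiv.coe_coe, key, Submodule.subtype_apply]
  split_ifs with hn
  · subst hn
    rw [DirectSum.component.lof_self]
  · rw [DirectSum.component.of, dif_neg (Ne.symm hn)]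
    rfl

theorem gradedProj_self {m : ℤ} {x : M} (hx : x ∈ gr m) : gradedProj h m x = x := by
  rw [gradedProj_of_mem h hx, if_pos rfl]

include h in
theorem homogeneous_induction {p : M → Prop} (hmem : ∀ n, ∀ x ∈ gr n, p x)
    (h0 : p 0) (hadd : ∀ x y, p x → p y → p (x + y)) (x : M) : p x := by
  have : x ∈ ⨆ n, gr n := by
    rw [DirectSum.IsInternal.submodule_iSup_eq_top (A := gr) h]
    trivial
  exact Submodule.iSup_induction gr (motive := p) this hmem h0 hadd

theorem finite_gradedProj (x : M) : {n | gradedProj h n x ≠ 0}.Finite := by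
  refine homogeneous_induction h (p := fun x => {n | gradedProj h n x ≠ 0}.Finite) ?_ ?_ ?_ x
  · intro m x hx
    refine (Set.finite_singleton m).subset fun n hn => ?_
    rw [Set.mem_ofPred_eq, gradedProj_of_mem h hx] at hn
    by_contra hne
    exact hn (if_neg hne)
  · simp
  · intro x y hx hy
    refine (hx.union hy).subset fun n hn => ?_
    by_contra hc
    simp only [Set.mem_union, Set.mem_ofPred_eq, not_or, not_not] at hc
    exact hn (by rw [map_add, hc.1, hc.2, add_zero])

variable {N : Type*} [AddCommGroup N] [Module ℂ N]

/-- Glue linear maps given on the homogeneous components. -/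
noncomputable def gradedGlue (F : ℤ → M →ₗ[ℂ] N) : M →ₗ[ℂ] N where
  toFun x := ∑ᶠ n, F n (gradedProj h n x)
  map_add' x y := by
    have fin : ∀ z, (Function.support fun n => F n (gradedProj h n z)).Finite := fun z =>
      (finite_gradedProj h z).subset fun n hn => by
        intro hz
        exact hn (by simp [hz])
    simp only [map_add]
    exact finsum_add_distrib (fin x) (fin y)
  map_smul' c x := by
    simp only [map_smul, RingHom.id_apply]
    rw [smul_finsum]

theorem gradedGlue_apply (F : ℤ → M →ₗ[ℂ] N) (x : M) :
    gradedGlue h F x = ∑ᶠ n, F n (gradedProj h n x) := rfl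

theorem gradedGlue_of_mem (F : ℤ → M →ₗ[ℂ] N) {m : ℤ} {x : M} (hx : x ∈ gr m) :
    gradedGlue h F x = F m x := by
  rw [gradedGlue_apply, finsum_eq_single _ m, gradedProj_self h hx]
  intro n hn
  rw [gradedProj_of_mem h hx, if_neg hn, map_zero]

theorem finsum_gradedProj (x : M) : ∑ᶠ n, gradedProj h n x = x := by
  have := homogeneous_induction h (p := fun x => gradedGlue h (fun _ => LinearMap.id) x = x)
    (fun n x hx => gradedGlue_of_mem h _ hx) (map_zero _)
    (fun x y hx hy => by rw [map_add, hx, hy]) x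
  simpa [gradedGlue_apply] using this

include h in
theorem mem_of_gradedProj_mem {P : Submodule ℂ M} {x : M} (hx : ∀ n, gradedProj h n x ∈ P) :
    x ∈ P := by
  rw [← finsum_gradedProj h x]
  exact finsum_induction (fun y => y ∈ P) P.zero_mem (fun _ _ => P.add_mem) hx

theorem eq_iSup_inf_iff (P : Submodule ℂ M) :
    P = ⨆ n : ℤ, P ⊓ gr n ↔ ∀ x ∈ P, ∀ n, gradedProj h n x ∈ P := by
  constructor
  · intro hP x hx n
    rw [hP] at hx
    refine Submodule.iSup_induction (fun n => P ⊓ gr n) (motive := fun x => gradedProj h n x ∈ P)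
      hx ?_ ?_ ?_
    · intro m y hy
      rw [gradedProj_of_mem h hy.2]
      split_ifs
      exacts [hy.1, P.zero_mem]
    · rw [map_zero]; exact P.zero_mem
    · intro y z hy hz
      rw [map_add]; exact P.add_mem hy hz
  · intro hP
    refine le_antisymm (fun x hx => ?_) (iSup_le fun n => inf_le_left)
    refine mem_of_gradedProj_mem h fun n => ?_
    exact Submodule.mem_iSup_of_mem n ⟨hP x hx n, gradedProj_mem h n x⟩

theorem gradedProj_mem_span {S : Set M} (hS : ∀ x ∈ S, ∃ n, x ∈ gr n) {x : M}
    (hx : x ∈ Submodule.span ℂ S) (n : ℤ) :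
    gradedProj h n x ∈ Submodule.span ℂ {y | y ∈ S ∧ y ∈ gr n} := by
  induction hx using Submodule.span_induction with
  | mem y hy =>
    obtain ⟨m, hm⟩ := hS y hy
    rw [gradedProj_of_mem h hm]
    split_ifs with hn
    · exact Submodule.subset_span ⟨hy, hn ▸ hm⟩
    · exact Submodule.zero_mem _
  | zero => rw [map_zero]; exact Submodule.zero_mem _
  | add y z _ _ hy hz => rw [map_add]; exact Submodule.add_mem _ hy hz
  | smul c y _ hy => rw [map_smul]; exact Submodule.smul_mem _ c hy

end GradedProj

namespace VOA

variable (d : VOA V)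

theorem hres_eq (N k : ℤ) (u v : V) :
    d.hres N k u v = binomSum N fun i : ℕ => d.mode u (-k + i) v := by
  unfold hres binomSum
  refine finsum_congr fun i => ?_
  rw [show (i : ℤ) - k = -k + i by ring]

/-- The residue `hres` as a linear map in its first vector. -/
noncomputable def hresL (N k : ℤ) (v : V) : V →ₗ[ℂ] V where
  toFun u := d.hres N k u v
  map_add' u u' := by
    simp only [hres_eq]
    rw [← binomSum_add N (d.exists_nat_truncation u v _) (d.exists_nat_truncation u' v _)]
    simp [mode_add]
  map_smul' c u := by
    simp only [hres_eq, RingHom.id_apply]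
    rw [← binomSum_smul]
    simp [mode_smul]

theorem hresL_apply (N k : ℤ) (u v : V) : d.hresL N k v u = d.hres N k u v := rfl

theorem hres_add_right (N k : ℤ) (u v v' : V) :
    d.hres N k u (v + v') = d.hres N k u v + d.hres N k u v' := by
  simp only [hres_eq]
  rw [← binomSum_add N (d.exists_nat_truncation u v _) (d.exists_nat_truncation u v' _)]
  simp

theorem bres_eq (m k : ℤ) (u v : V) :
    d.bres m k u v = gradedGlue d.internal (fun n => d.hresL (n + m) k v) u := rfl

theorem bres_of_mem (m k : ℤ) {r : ℤ} {u : V} (hu : u ∈ d.grading r) (v : V) :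
    d.bres m k u v = d.hres (r + m) k u v := by
  rw [bres_eq, gradedGlue_of_mem _ _ hu, hresL_apply]

theorem bres_add_left (m k : ℤ) (u u' v : V) :
    d.bres m k (u + u') v = d.bres m k u v + d.bres m k u' v := by
  simp only [bres_eq, map_add]

theorem bres_zero_left (m k : ℤ) (v : V) : d.bres m k 0 v = 0 := by
  simp only [bres_eq, map_zero]

theorem bres_add_right (m k : ℤ) (u v v' : V) :
    d.bres m k u (v + v') = d.bres m k u v + d.bres m k u v' := by
  refine homogeneous_induction d.internal
    (p := fun u => d.bres m k u (v + v') = d.bres m k u v + d.bres m k u v') ?_ ?_ ?_ u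
  · intro r u hu
    simp only [d.bres_of_mem m k hu, hres_add_right]
  · simp [bres_zero_left]
  · intro x y hx hy
    simp only [bres_add_left, hx, hy]
    abel

theorem bres_zero_right (m k : ℤ) (u : V) : d.bres m k u 0 = 0 := by
  have := d.bres_add_right m k u 0 0
  simpa using this

theorem star_of_mem {r : ℤ} {u : V} (hu : u ∈ d.grading r) (v : V) :
    d.star u v = d.hres r 1 u v := by
  rw [star, d.bres_of_mem 0 1 hu, add_zero]

theorem circ_of_mem {r : ℤ} {u : V} (hu : u ∈ d.grading r) (v : V) :
    d.circ u v = d.hres r 2 u v := by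
  rw [circ, d.bres_of_mem 0 2 hu, add_zero]

end VOA

namespace WeakMod

variable {d : VOA V} (W : WeakMod d M)

/-- The underlying truncated modes of a weak module. -/
def toModeMap : ModeMap d M := ⟨W.act, W.act_add, W.act_smul, W.truncation⟩

theorem borcherdsAt (p q r : ℤ) (u v : V) (w : M) : W.toModeMap.BorcherdsAt p q r u v w :=
  (W.toModeMap.borcherdsAt_iff p q r u v w).2 (W.borcherds p q r u v w)

theorem o_eq (v : V) (w : M) : W.o v w =
    gradedGlue d.internal (fun r => (LinearMap.applyₗ w) ∘ₗ W.toModeMap.actL (r - 1)) v := rfl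

theorem o_of_mem {r : ℤ} {v : V} (hv : v ∈ d.grading r) (w : M) :
    W.o v w = W.act v (r - 1) w := by
  rw [o_eq, gradedGlue_of_mem _ _ hv]
  rfl

theorem o_add_left (v v' : V) (w : M) : W.o (v + v') w = W.o v w + W.o v' w := by
  simp only [o_eq, map_add]

theorem o_smul_left (c : ℂ) (v : V) (w : M) : W.o (c • v) w = c • W.o v w := by
  simp only [o_eq, map_smul]

theorem o_zero_left (w : M) : W.o 0 w = 0 := by
  simp only [o_eq, map_zero]

theorem o_add_right (v : V) (w w' : M) : W.o v (w + w') = W.o v w + W.o v w' := by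
  refine homogeneous_induction d.internal
    (p := fun v => W.o v (w + w') = W.o v w + W.o v w') ?_ ?_ ?_ v
  · intro r v hv
    simp only [W.o_of_mem hv, map_add]
  · simp [o_zero_left]
  · intro x y hx hy
    simp only [o_add_left, hx, hy]
    abel

theorem o_smul_right (v : V) (c : ℂ) (w : M) : W.o v (c • w) = c • W.o v w := by
  refine homogeneous_induction d.internal
    (p := fun v => W.o v (c • w) = c • W.o v w) ?_ ?_ ?_ v
  · intro r v hv
    simp only [W.o_of_mem hv, map_smul]
  · simp [o_zero_left]
  · intro x y hx hy
    simp only [o_add_left, hx, hy, smul_add]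

end WeakMod

theorem binomSum_mem (p : ℤ) {X : ℕ → M} {P : Submodule ℂ M} (h : ∀ i, X i ∈ P) :
    binomSum p X ∈ P :=
  finsum_induction (fun y => y ∈ P) P.zero_mem (fun _ _ => P.add_mem)
    fun i => P.smul_mem _ (h i)

theorem binomSum_of_eq_zero (p : ℤ) {X : ℕ → M} (h : ∀ i, X i = 0) : binomSum p X = 0 := by
  simp [binomSum, h]

namespace ModeMap

variable {d : VOA V} (T : ModeMap d M)

/-- The span of all `uₙ x` with `x` in a given set. -/
def generated (X : Set M) : Submodule ℂ M :=
  Submodule.span ℂ {y | ∃ (u : V) (n : ℤ), ∃ x ∈ X, y = T.act u n x}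

variable {T}

theorem BorcherdsAt.of_right_eq_zero {p q r : ℤ} {u v : V} {w : M}
    (h : T.BorcherdsAt p q r u v w) (hu : ∀ i : ℕ, T.act u (p + i) w = 0) :
    binomSum p (T.iterTerm u v w r (p + q)) = binomSum r (T.prodTerm u v w (p + r) q) := by
  have h0 : binomSum r (T.prodTerm v u w (q + r) p) = 0 :=
    binomSum_of_eq_zero _ fun i => by simp [prodTerm, hu i]
  unfold BorcherdsAt at h
  rw [h, h0, smul_zero, sub_zero]

theorem act_act_mem_generated (hB : ∀ p q r u v w, T.BorcherdsAt p q r u v w)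
    {X : Set M} {x : M} (hx : x ∈ X) (a b : V) (m n : ℤ) :
    T.act a m (T.act b n x) ∈ T.generated X := by
  obtain ⟨p, hp⟩ := T.truncation a x
  obtain ⟨N, hN⟩ := T.truncation b x
  have key : ∀ k : ℕ, ∀ q : ℤ, N - k ≤ q → ∀ m, T.act a m (T.act b q x) ∈ T.generated X := by
    intro k
    induction k with
    | zero =>
      intro q hq m
      rw [hN q (by simpa using hq), map_zero]
      exact Submodule.zero_mem _
    | succ k ih =>
      intro q hq m
      have h1 := (hB p q (m - p) a b x).of_right_eq_zero fun i => hp _ (by omega)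
      have h2 : binomSum p (T.iterTerm a b x (m - p) (p + q)) ∈ T.generated X :=
        binomSum_mem _ fun i => Submodule.subset_span ⟨_, _, x, hx, rfl⟩
      rw [h1] at h2
      unfold binomSum at h2
      rw [((T.evZero_prodTerm a b x (p + (m - p)) q).smul _).finsum_succ] at h2
      have h3 : ∑ᶠ i : ℕ, cbinom (m - p) (i + 1) • T.prodTerm a b x (p + (m - p)) q (i + 1)
          ∈ T.generated X := by
        refine finsum_induction (fun y => y ∈ T.generated X) (Submodule.zero_mem _)
          (fun _ _ => Submodule.add_mem _) fun i => Submodule.smul_mem _ _ ?_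
        exact Submodule.smul_mem _ _ (ih _ (by push_cast at hq ⊢; omega) _)
      have h4 := (Submodule.add_mem_iff_left _ h3).1 h2
      simpa [prodTerm, cbinom_zero_right] using h4
  exact key (N - n).toNat n (by omega) m

theorem act_mem_generated (hB : ∀ p q r u v w, T.BorcherdsAt p q r u v w)
    {X : Set M} {w : M} (hw : w ∈ T.generated X) (u : V) (n : ℤ) :
    T.act u n w ∈ T.generated X := by
  have : T.generated X ≤ (T.generated X).comap (T.act u n) := by
    refine Submodule.span_le.2 ?_
    rintro _ ⟨v, m, x, hx, rfl⟩
    exact act_act_mem_generated hB hx u v n m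
  exact this hw

theorem generated_eq_span_homogeneous (X : Set M) :
    T.generated X = Submodule.span ℂ
      {y | ∃ (r : ℤ) (u : V), u ∈ d.grading r ∧ ∃ (n : ℤ), ∃ x ∈ X, y = T.act u n x} := by
  refine le_antisymm (Submodule.span_le.2 ?_) (Submodule.span_mono ?_)
  · rintro _ ⟨v, m, x, hx, rfl⟩
    refine homogeneous_induction d.internal (p := fun v => T.act v m x ∈ Submodule.span ℂ
      {y | ∃ (r : ℤ) (u : V), u ∈ d.grading r ∧ ∃ (n : ℤ), ∃ x ∈ X, y = T.act u n x}) ?_ ?_ ?_ v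
    · intro r u hu
      exact Submodule.subset_span ⟨r, u, hu, m, x, hx, rfl⟩
    · rw [T.act_zero]
      exact Submodule.zero_mem _
    · intro a b ha hb
      rw [T.act_add]
      exact Submodule.add_mem _ ha hb
  · rintro _ ⟨r, u, -, n, x, hx, rfl⟩
    exact ⟨u, n, x, hx, rfl⟩

end ModeMap

theorem eq_zero_of_mem_mem {gr : ℤ → Submodule ℂ M}
    (h : Function.Bijective (DirectSum.coeLinearMap gr)) {m n : ℤ} (hmn : m ≠ n) {x : M}
    (hm : x ∈ gr m) (hn : x ∈ gr n) : x = 0 := by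
  rw [← gradedProj_self h hm, gradedProj_of_mem h hn, if_neg hmn]

namespace WeakMod

variable {d : VOA V} (W : WeakMod d M)

theorem isStable_generated (X : Set M) : W.IsStable (W.toModeMap.generated X) :=
  fun u n _ hw => ModeMap.act_mem_generated W.borcherdsAt hw u n

theorem subset_generated {X : Set M} {x : M} (hx : x ∈ X) : x ∈ W.toModeMap.generated X :=
  Submodule.subset_span ⟨d.vacuum, -1, x, hx, by simp [toModeMap, W.vacuum_act]⟩

theorem o_hres {w : M} {r s : ℤ} {u v : V} (hu : u ∈ d.grading r) (hv : v ∈ d.grading s)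
    (k : ℤ) :
    W.o (d.hres r k u v) w =
      binomSum r (W.toModeMap.iterTerm u v w (-k) (r + (s + k - 2))) := by
  rw [d.hres_eq, W.o_eq, map_binomSum _ (d.exists_nat_truncation u v _)]
  congr 1
  funext i
  rw [gradedGlue_of_mem _ _ (d.grading_mode r s (-k + i) u v hu hv)]
  simp only [LinearMap.comp_apply, ModeMap.iterTerm, ModeMap.actL, LinearMap.coe_mk,
    AddHom.coe_mk, LinearMap.applyₗ_apply_apply]
  congr 2
  ring

section Omega

variable {W} {w : M} (hw : w ∈ W.OmegaSet 0)

include hw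

theorem act_eq_zero_of_mem_omega {r : ℤ} {u : V} (hu : u ∈ d.grading r) {m : ℤ} (hm : r ≤ m) :
    W.act u m w = 0 := hw r u hu m (by push_cast; omega)

theorem o_circ (u v : V) : W.o (d.circ u v) w = 0 := by
  refine homogeneous_induction d.internal (p := fun u => W.o (d.circ u v) w = 0) ?_ ?_ ?_ u
  · intro r u hu
    refine homogeneous_induction d.internal (p := fun v => W.o (d.circ u v) w = 0) ?_ ?_ ?_ v
    · intro s v hv
      rw [d.circ_of_mem hu, W.o_hres hu hv, (W.borcherdsAt r (s + 2 - 2) (-2) u v w).of_right_eq_zero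
        fun i => act_eq_zero_of_mem_omega hw hu (by omega)]
      refine binomSum_of_eq_zero _ fun i => ?_
      have : W.toModeMap.act v (s + 2 - 2 + i) w = 0 :=
        act_eq_zero_of_mem_omega hw hv (by omega)
      rw [ModeMap.prodTerm, this, map_zero, smul_zero]
    · rw [VOA.circ, d.bres_zero_right, o_zero_left]
    · intro x y hx hy
      rw [VOA.circ] at *
      rw [d.bres_add_right, o_add_left, hx, hy, add_zero]
  · rw [VOA.circ, d.bres_zero_left, o_zero_left]
  · intro x y hx hy
    rw [VOA.circ] at *
    rw [d.bres_add_left, o_add_left, hx, hy, add_zero]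

theorem o_star (u v : V) : W.o (d.star u v) w = W.o u (W.o v w) := by
  refine homogeneous_induction d.internal
    (p := fun u => W.o (d.star u v) w = W.o u (W.o v w)) ?_ ?_ ?_ u
  · intro r u hu
    refine homogeneous_induction d.internal
      (p := fun v => W.o (d.star u v) w = W.o u (W.o v w)) ?_ ?_ ?_ v
    · intro s v hv
      rw [d.star_of_mem hu, W.o_hres hu hv, (W.borcherdsAt r (s + 1 - 2) (-1) u v w).of_right_eq_zero
        fun i => act_eq_zero_of_mem_omega hw hu (by omega), binomSum_of_tail_eq_zero,
        W.o_of_mem hu, W.o_of_mem hv]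
      · simp only [ModeMap.prodTerm, pow_zero, one_smul, toModeMap]
        rw [show r + -1 - ((0 : ℕ) : ℤ) = r - 1 by push_cast; ring,
          show s + 1 - 2 + ((0 : ℕ) : ℤ) = s - 1 by push_cast; ring]
      · intro i
        have : W.toModeMap.act v (s + 1 - 2 + (i + 1 : ℕ)) w = 0 :=
          act_eq_zero_of_mem_omega hw hv (by push_cast; omega)
        simp only [ModeMap.prodTerm, this, map_zero, smul_zero]
    · rw [VOA.star, d.bres_zero_right, o_zero_left, W.o_of_mem hu, map_zero]
    · intro x y hx hy
      rw [VOA.star] at *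
      rw [d.bres_add_right, o_add_left, hx, hy, o_add_left, o_add_right]
  · rw [VOA.star, d.bres_zero_left, o_zero_left, o_zero_left]
  · intro x y hx hy
    rw [VOA.star] at *
    rw [d.bres_add_left, o_add_left, hx, hy, o_add_left]

theorem o_Ozhu {v : V} (hv : v ∈ d.Ozhu) : W.o v w = 0 := by
  unfold VOA.Ozhu at hv
  induction hv using Submodule.span_induction with
  | mem y hy => obtain ⟨u, v, rfl⟩ := hy; exact o_circ hw u v
  | zero => exact W.o_zero_left w
  | add y z _ _ hy hz => rw [o_add_left, hy, hz, add_zero]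
  | smul c y _ hy => rw [o_smul_left, hy, smul_zero]

end Omega

theorem o_vacuum (w : M) : W.o d.vacuum w = w := by
  rw [W.o_of_mem d.vacuum_mem, W.vacuum_act]
  simp

end WeakMod

namespace AdmMod

variable {d : VOA V} (A : AdmMod d M)

theorem isGraded_iff (P : Submodule ℂ M) :
    A.IsGraded P ↔ ∀ x ∈ P, ∀ n, gradedProj A.gr_internal n x ∈ P :=
  eq_iSup_inf_iff A.gr_internal P

variable {A} in
theorem mem_omega_of_mem_gr_zero {w : M} (hw : w ∈ A.gr 0) : w ∈ A.OmegaSet 0 := by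
  intro r u hu m hm
  have := A.gr_act r u hu m 0 w hw
  rw [A.gr_neg _ (by push_cast at hm; omega)] at this
  simpa using this

theorem o_mem_gr_zero (v : V) {w : M} (hw : w ∈ A.gr 0) : A.toWeakMod.o v w ∈ A.gr 0 := by
  refine homogeneous_induction d.internal (p := fun v => A.toWeakMod.o v w ∈ A.gr 0) ?_ ?_ ?_ v
  · intro r v hv
    rw [A.o_of_mem hv]
    have := A.gr_act r v hv (r - 1) 0 w hw
    simpa using this
  · rw [A.o_zero_left]; exact Submodule.zero_mem _
  · intro x y hx hy
    rw [A.o_add_left]; exact Submodule.add_mem _ hx hy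

/-- The representation of Zhu's algebra on the degree zero part. -/
noncomputable def zhuRep : RepOf d.Ozhu d.star d.vacuum (A.gr 0) where
  rep :=
    { toFun := fun v =>
        { toFun := fun w => ⟨A.toWeakMod.o v w, A.o_mem_gr_zero v w.2⟩
          map_add' := fun w w' => Subtype.ext (A.o_add_right v w w')
          map_smul' := fun c w => Subtype.ext (A.o_smul_right v c w) }
      map_add' := fun v v' => LinearMap.ext fun w => Subtype.ext (A.o_add_left v v' w)
      map_smul' := fun c v => LinearMap.ext fun w => Subtype.ext (A.o_smul_left c v w) }
  kills _ hv := LinearMap.ext fun w =>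
    Subtype.ext (WeakMod.o_Ozhu (mem_omega_of_mem_gr_zero w.2) hv)
  mul_compat u v := LinearMap.ext fun w =>
    Subtype.ext (WeakMod.o_star (mem_omega_of_mem_gr_zero w.2) u v)
  one_compat := LinearMap.ext fun w => Subtype.ext (A.o_vacuum w)

theorem zhuRep_apply (v : V) (w : A.gr 0) : ((A.zhuRep.rep v w : A.gr 0) : M) = A.toWeakMod.o v w :=
  rfl

theorem gradedProj_generated {X : Set M} {k : ℤ} (hX : X ⊆ A.gr k) {y : M}
    (hy : y ∈ A.toModeMap.generated X) (n : ℤ) :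
    gradedProj A.gr_internal n y ∈ Submodule.span ℂ
      {y | ∃ (r : ℤ) (u : V), u ∈ d.grading r ∧ ∃ x ∈ X, y = A.act u (r + k - n - 1) x} := by
  rw [ModeMap.generated_eq_span_homogeneous] at hy
  have hdeg : ∀ y ∈ {y | ∃ (r : ℤ) (u : V), u ∈ d.grading r ∧
      ∃ (n : ℤ), ∃ x ∈ X, y = A.toModeMap.act u n x}, ∃ n, y ∈ A.gr n := by
    rintro _ ⟨r, u, hu, m, x, hx, rfl⟩
    exact ⟨_, A.gr_act r u hu m k x (hX hx)⟩
  refine Submodule.span_le.2 ?_ (gradedProj_mem_span A.gr_internal hdeg hy n)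
  rintro _ ⟨⟨r, u, hu, m, x, hx, rfl⟩, hn⟩
  have hm := A.gr_act r u hu m k x (hX hx)
  by_cases hmn : r + k - m - 1 = n
  · refine Submodule.subset_span ⟨r, u, hu, x, hx, ?_⟩
    rw [show r + k - n - 1 = m by omega]
    rfl
  · have h0 : A.toModeMap.act u m x = 0 := eq_zero_of_mem_mem A.gr_internal hmn hm hn
    rw [h0]
    exact Submodule.zero_mem _

theorem isGraded_generated {X : Set M} {k : ℤ} (hX : X ⊆ A.gr k) :
    A.IsGraded (A.toModeMap.generated X) := by
  rw [isGraded_iff]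
  intro y hy n
  refine Submodule.span_mono ?_ (A.gradedProj_generated hX hy n)
  rintro _ ⟨r, u, -, x, hx, rfl⟩
  exact ⟨u, _, x, hx, rfl⟩

variable {A}

theorem IsIrreducible.generated_eq_top (hA : A.IsIrreducible) {X : Set M} {k : ℤ}
    (hX : X ⊆ A.gr k) {x : M} (hx : x ∈ X) (h0 : x ≠ 0) : A.toModeMap.generated X = ⊤ := by
  refine (hA.2 _ (A.isStable_generated X) (A.isGraded_generated hX)).resolve_left fun hbot => ?_
  have := A.subset_generated hx
  rw [hbot] at this
  exact h0 (by simpa using this)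

theorem IsIrreducible.isSimple_zhuRep (hA : A.IsIrreducible) (h0 : A.gr 0 ≠ ⊥) :
    A.zhuRep.IsSimple := by
  constructor
  · obtain ⟨w, hw, hne⟩ := (Submodule.ne_bot_iff _).1 h0
    exact ⟨⟨w, hw⟩, fun h => hne (congrArg Subtype.val h)⟩
  · intro P hP
    by_cases hbot : P = ⊥
    · exact Or.inl hbot
    · refine Or.inr (eq_top_iff.2 fun y _ => ?_)
      obtain ⟨x, hx, hne⟩ := (Submodule.ne_bot_iff _).1 hbot
      have hX : Subtype.val '' (P : Set (A.gr 0)) ⊆ A.gr 0 := by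
        rintro _ ⟨z, -, rfl⟩
        exact z.2
      have htop := hA.generated_eq_top hX ⟨x, hx, rfl⟩ fun h => hne (Subtype.ext h)
      have hy := A.gradedProj_generated hX (y := y) (htop ▸ Submodule.mem_top) 0
      rw [gradedProj_self _ y.2] at hy
      have hle : Submodule.span ℂ {y | ∃ (r : ℤ) (u : V), u ∈ d.grading r ∧
          ∃ x ∈ Subtype.val '' (P : Set (A.gr 0)), y = A.act u (r + 0 - 0 - 1) x} ≤
          P.map (A.gr 0).subtype := by
        refine Submodule.span_le.2 ?_
        rintro _ ⟨r, u, hu, _, ⟨z, hz, rfl⟩, rfl⟩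
        refine ⟨A.zhuRep.rep u z, hP u z hz, ?_⟩
        rw [Submodule.subtype_apply, zhuRep_apply, A.o_of_mem hu]
        congr 2
        ring
      obtain ⟨z, hz, hzy⟩ := hle hy
      rwa [← Subtype.ext hzy]

theorem gradedProj_act {r : ℤ} {u : V} (hu : u ∈ d.grading r) (m n : ℤ) (x : M) :
    gradedProj A.gr_internal (r + n - m - 1) (A.act u m x) =
      A.act u m (gradedProj A.gr_internal n x) := by
  refine homogeneous_induction A.gr_internal (p := fun x =>
    gradedProj A.gr_internal (r + n - m - 1) (A.act u m x) =
      A.act u m (gradedProj A.gr_internal n x)) ?_ ?_ ?_ x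
  · intro k x hx
    rw [gradedProj_of_mem _ (A.gr_act r u hu m k x hx), gradedProj_of_mem _ hx]
    by_cases hnk : n = k
    · simp [hnk]
    · rw [if_neg hnk, if_neg (by omega), map_zero]
  · simp
  · intro x y hx hy
    simp only [map_add, hx, hy]

theorem IsIrreducible.mem_gr_zero_iff (hA : A.IsIrreducible) (h0 : A.gr 0 ≠ ⊥) {w : M} :
    w ∈ A.gr 0 ↔ w ∈ A.OmegaSet 0 := by
  refine ⟨mem_omega_of_mem_gr_zero, fun hw => ?_⟩
  refine mem_of_gradedProj_mem A.gr_internal fun n => ?_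
  rcases lt_trichotomy n 0 with hn | rfl | hn
  · have := gradedProj_mem A.gr_internal n w
    rw [A.gr_neg n hn, Submodule.mem_bot] at this
    rw [this]
    exact Submodule.zero_mem _
  · exact gradedProj_mem _ _ _
  · by_cases hne : gradedProj A.gr_internal n w = 0
    · rw [hne]
      exact Submodule.zero_mem _
    · exfalso
      have hX : {gradedProj A.gr_internal n w} ⊆ (A.gr n : Set M) := by
        rw [Set.singleton_subset_iff]
        exact gradedProj_mem _ _ _
      have htop := hA.generated_eq_top hX rfl hne
      refine h0 ((Submodule.eq_bot_iff _).2 fun y hy => ?_)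
      have hy' := A.gradedProj_generated hX (y := y) (htop ▸ Submodule.mem_top) 0
      rw [gradedProj_self _ hy] at hy'
      refine (Submodule.mem_bot ℂ).1 (Submodule.span_le.2 ?_ hy')
      rintro _ ⟨r, u, hu, _, rfl, rfl⟩
      rw [← gradedProj_act hu, WeakMod.act_eq_zero_of_mem_omega hw hu (by omega), map_zero]
      exact Submodule.zero_mem _

end AdmMod

section Equivalence

variable {d : VOA V} {M₁ M₂ : Type} [AddCommGroup M₁] [Module ℂ M₁]
    [AddCommGroup M₂] [Module ℂ M₂]

/-- The direct sum of two truncated systems of modes. -/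
def ModeMap.prod (T₁ : ModeMap d M₁) (T₂ : ModeMap d M₂) : ModeMap d (M₁ × M₂) where
  act u n := (T₁.act u n).prodMap (T₂.act u n)
  act_add u v n := by rw [T₁.act_add, T₂.act_add]; rfl
  act_smul c u n := by rw [T₁.act_smul, T₂.act_smul]; rfl
  truncation u w := by
    obtain ⟨N₁, h₁⟩ := T₁.truncation u w.1
    obtain ⟨N₂, h₂⟩ := T₂.truncation u w.2
    refine ⟨max N₁ N₂, fun n hn => ?_⟩
    exact Prod.ext (h₁ n (le_trans (le_max_left _ _) hn)) (h₂ n (le_trans (le_max_right _ _) hn))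

theorem ModeMap.map_borcherds {T₁ : ModeMap d M₁} {T₂ : ModeMap d M₂} (f : M₁ →ₗ[ℂ] M₂)
    (hf : ∀ u n w, f (T₁.act u n w) = T₂.act u n (f w)) (p q r : ℤ) (u v : V) (w : M₁) :
    f (T₁.defect p q r u v w) = T₂.defect p q r u v (f w) := by
  unfold ModeMap.defect
  rw [map_sub, map_sub, map_smul, map_binomSum _ (T₁.evZero_iterTerm _ _ _ _ _),
    map_binomSum _ (T₁.evZero_prodTerm _ _ _ _ _), map_binomSum _ (T₁.evZero_prodTerm _ _ _ _ _)]
  simp only [ModeMap.iterTerm, ModeMap.prodTerm, hf, map_smul]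
  rfl

theorem ModeMap.borcherdsAt_prod {T₁ : ModeMap d M₁} {T₂ : ModeMap d M₂}
    (h₁ : ∀ p q r u v w, T₁.BorcherdsAt p q r u v w)
    (h₂ : ∀ p q r u v w, T₂.BorcherdsAt p q r u v w) (p q r : ℤ) (u v : V) (w : M₁ × M₂) :
    (T₁.prod T₂).BorcherdsAt p q r u v w := by
  rw [ModeMap.borcherdsAt_iff_defect]
  refine Prod.ext ?_ ?_
  · have := ModeMap.map_borcherds (T₁ := T₁.prod T₂) (T₂ := T₁) (LinearMap.fst ℂ M₁ M₂)
      (fun u n w => rfl) p q r u v w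
    exact this.trans ((T₁.borcherdsAt_iff_defect _ _ _ _ _ _).1 (h₁ _ _ _ _ _ _))
  · have := ModeMap.map_borcherds (T₁ := T₁.prod T₂) (T₂ := T₂) (LinearMap.snd ℂ M₁ M₂)
      (fun u n w => rfl) p q r u v w
    exact this.trans ((T₂.borcherdsAt_iff_defect _ _ _ _ _ _).1 (h₂ _ _ _ _ _ _))

theorem WeakMod.map_o {W₁ : WeakMod d M₁} {W₂ : WeakMod d M₂} (f : M₁ →ₗ[ℂ] M₂)
    (hf : ∀ u n w, f (W₁.act u n w) = W₂.act u n (f w)) (v : V) (w : M₁) :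
    f (W₁.o v w) = W₂.o v (f w) := by
  refine homogeneous_induction d.internal (p := fun v => f (W₁.o v w) = W₂.o v (f w)) ?_ ?_ ?_ v
  · intro r v hv
    rw [W₁.o_of_mem hv, W₂.o_of_mem hv, hf]
  · rw [W₁.o_zero_left, W₂.o_zero_left, map_zero]
  · intro x y hx hy
    rw [W₁.o_add_left, W₂.o_add_left, map_add, hx, hy]

variable {A₁ : AdmMod d M₁} {A₂ : AdmMod d M₂}

theorem map_mem_gr_zero (h₁ : A₁.IsIrreducible) (h₂ : A₂.IsIrreducible) (n₁ : A₁.gr 0 ≠ ⊥)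
    (n₂ : A₂.gr 0 ≠ ⊥) (e : M₁ →ₗ[ℂ] M₂) (he : ∀ u n w, e (A₁.act u n w) = A₂.act u n (e w))
    {w : M₁} (hw : w ∈ A₁.gr 0) : e w ∈ A₂.gr 0 := by
  rw [h₁.mem_gr_zero_iff n₁] at hw
  rw [h₂.mem_gr_zero_iff n₂]
  intro r u hu m hm
  rw [← he, hw r u hu m hm, map_zero]

theorem repEquiv_of_admEquiv (h₁ : A₁.IsIrreducible) (h₂ : A₂.IsIrreducible)
    (n₁ : A₁.gr 0 ≠ ⊥) (n₂ : A₂.gr 0 ≠ ⊥) (h : AdmEquiv A₁ A₂) :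
    RepEquiv A₁.zhuRep A₂.zhuRep := by
  obtain ⟨e, he⟩ := h
  have he' : ∀ u n w, e.symm (A₂.act u n w) = A₁.act u n (e.symm w) := fun u n w => by
    rw [LinearEquiv.symm_apply_eq, he, LinearEquiv.apply_symm_apply]
  have hmap : (A₁.gr 0).map (e : M₁ →ₗ[ℂ] M₂) = A₂.gr 0 := by
    refine le_antisymm ?_ fun y hy => ?_
    · rintro _ ⟨x, hx, rfl⟩
      exact map_mem_gr_zero h₁ h₂ n₁ n₂ (e : M₁ →ₗ[ℂ] M₂) he hx
    · exact ⟨e.symm y, map_mem_gr_zero h₂ h₁ n₂ n₁ (e.symm : M₂ →ₗ[ℂ] M₁) he' hy, by simp⟩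
  refine ⟨e.ofSubmodules _ _ hmap, fun v x => Subtype.ext ?_⟩
  exact WeakMod.map_o (W₁ := A₁.toWeakMod) (W₂ := A₂.toWeakMod) (e : M₁ →ₗ[ℂ] M₂) he v x

/-- The submodule of `M₁ × M₂` generated by the graph of a map between degree zero parts. -/
def graphSub (A₁ : AdmMod d M₁) (A₂ : AdmMod d M₂) (φ : A₁.gr 0 → A₂.gr 0) :
    Submodule ℂ (M₁ × M₂) :=
  (A₁.toModeMap.prod A₂.toModeMap).generated (Set.range fun x : A₁.gr 0 => ((x : M₁), (φ x : M₂)))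

section Graph

variable {φ : A₁.gr 0 ≃ₗ[ℂ] A₂.gr 0}

theorem act_mem_graphSub {z : M₁ × M₂} (hz : z ∈ graphSub A₁ A₂ φ) (u : V) (n : ℤ) :
    (A₁.act u n z.1, A₂.act u n z.2) ∈ graphSub A₁ A₂ φ :=
  ModeMap.act_mem_generated
    (ModeMap.borcherdsAt_prod A₁.toWeakMod.borcherdsAt A₂.toWeakMod.borcherdsAt) hz u n

theorem mem_graphSub (x : A₁.gr 0) : ((x : M₁), (φ x : M₂)) ∈ graphSub A₁ A₂ φ := by
  refine Submodule.subset_span ⟨d.vacuum, -1, _, ⟨x, rfl⟩, Prod.ext ?_ ?_⟩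
  · exact (by simp [A₁.vacuum_act] : (x : M₁) = A₁.act d.vacuum (-1) x)
  · exact (by simp [A₂.vacuum_act] : (φ x : M₂) = A₂.act d.vacuum (-1) (φ x))

theorem graphSub_induction {p : M₁ × M₂ → Prop}
    (hmem : ∀ (r : ℤ) (u : V), u ∈ d.grading r → ∀ (n : ℤ) (x : A₁.gr 0),
      p (A₁.act u n x, A₂.act u n (φ x)))
    (h0 : p 0) (hadd : ∀ x y, p x → p y → p (x + y)) (hsmul : ∀ (c : ℂ) x, p x → p (c • x))
    {z : M₁ × M₂} (hz : z ∈ graphSub A₁ A₂ φ) : p z := by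
  rw [graphSub, ModeMap.generated_eq_span_homogeneous] at hz
  induction hz using Submodule.span_induction with
  | mem y hy =>
    obtain ⟨r, u, hu, n, _, ⟨x, rfl⟩, rfl⟩ := hy
    exact hmem r u hu n x
  | zero => exact h0
  | add x y _ _ hx hy => exact hadd x y hx hy
  | smul c x _ hx => exact hsmul c x hx

theorem gradedProj_mem_graphSub {z : M₁ × M₂} (hz : z ∈ graphSub A₁ A₂ φ) (k : ℤ) :
    (gradedProj A₁.gr_internal k z.1, gradedProj A₂.gr_internal k z.2) ∈ graphSub A₁ A₂ φ := by
  refine graphSub_induction (p := fun z =>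
    (gradedProj A₁.gr_internal k z.1, gradedProj A₂.gr_internal k z.2) ∈ graphSub A₁ A₂ φ)
    ?_ ?_ ?_ ?_ hz
  · intro r u hu n x
    simp only
    rw [gradedProj_of_mem _ (A₁.gr_act r u hu n 0 x x.2),
      gradedProj_of_mem _ (A₂.gr_act r u hu n 0 (φ x) (φ x).2)]
    split_ifs
    · exact act_mem_graphSub (mem_graphSub x) u n
    · exact Submodule.zero_mem _
  · simp only [Prod.fst_zero, Prod.snd_zero, map_zero]
    exact Submodule.zero_mem _
  · intro x y hx hy
    simp only [Prod.fst_add, Prod.snd_add, map_add]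
    exact Submodule.add_mem _ hx hy
  · intro c x hx
    simp only [Prod.smul_fst, Prod.smul_snd, map_smul]
    exact Submodule.smul_mem _ c hx

theorem gradedProj_zero_of_mem_graphSub
    (hφ : ∀ (v : V) (x : A₁.gr 0), φ (A₁.zhuRep.rep v x) = A₂.zhuRep.rep v (φ x))
    {z : M₁ × M₂} (hz : z ∈ graphSub A₁ A₂ φ) :
    ∃ x : A₁.gr 0, gradedProj A₁.gr_internal 0 z.1 = x ∧
      gradedProj A₂.gr_internal 0 z.2 = φ x := by
  refine graphSub_induction (p := fun z => ∃ x : A₁.gr 0, gradedProj A₁.gr_internal 0 z.1 = x ∧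
      gradedProj A₂.gr_internal 0 z.2 = φ x) ?_ ?_ ?_ ?_ hz
  · intro r u hu n x
    simp only
    rw [gradedProj_of_mem _ (A₁.gr_act r u hu n 0 x x.2),
      gradedProj_of_mem _ (A₂.gr_act r u hu n 0 (φ x) (φ x).2)]
    split_ifs with hn
    · refine ⟨A₁.zhuRep.rep u x, ?_, ?_⟩
      · rw [AdmMod.zhuRep_apply, A₁.o_of_mem hu, show n = r - 1 by omega]
      · rw [hφ, AdmMod.zhuRep_apply, A₂.o_of_mem hu, show n = r - 1 by omega]
    · exact ⟨0, rfl, by simp⟩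
  · exact ⟨0, by simp, by simp⟩
  · rintro a b ⟨x, hx₁, hx₂⟩ ⟨y, hy₁, hy₂⟩
    exact ⟨x + y, by simp [hx₁, hy₁], by simp [hx₂, hy₂]⟩
  · rintro c a ⟨x, hx₁, hx₂⟩
    exact ⟨c • x, by simp [hx₁], by simp [hx₂]⟩

end Graph

theorem admEquiv_of_repEquiv (h₁ : A₁.IsIrreducible) (h₂ : A₂.IsIrreducible)
    (n₁ : A₁.gr 0 ≠ ⊥) (n₂ : A₂.gr 0 ≠ ⊥) (h : RepEquiv A₁.zhuRep A₂.zhuRep) :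
    AdmEquiv A₁ A₂ := by
  obtain ⟨φ, hφ⟩ := h
  set N := graphSub A₁ A₂ φ with hN
  have hl : N.comap (LinearMap.inl ℂ M₁ M₂) = ⊥ := by
    refine (h₁.2 _ ?_ ?_).resolve_right fun htop => ?_
    · intro u n w hw
      simpa using act_mem_graphSub (φ := φ) (z := (w, 0)) hw u n
    · rw [A₁.isGraded_iff]
      intro x hx n
      simpa using gradedProj_mem_graphSub (φ := φ) (z := (x, 0)) hx n
    · obtain ⟨x, hx, hne⟩ := (Submodule.ne_bot_iff _).1 n₁
      have hmem : x ∈ N.comap (LinearMap.inl ℂ M₁ M₂) := htop ▸ Submodule.mem_top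
      obtain ⟨x', hx₁, hx₂⟩ := gradedProj_zero_of_mem_graphSub hφ (z := (x, 0)) hmem
      simp only [map_zero] at hx₂
      rw [gradedProj_self _ hx] at hx₁
      have : φ x' = 0 := Subtype.ext hx₂.symm
      rw [map_eq_zero_iff _ φ.injective] at this
      exact hne (by rw [hx₁, this]; rfl)
  have hr : N.comap (LinearMap.inr ℂ M₁ M₂) = ⊥ := by
    refine (h₂.2 _ ?_ ?_).resolve_right fun htop => ?_
    · intro u n w hw
      simpa using act_mem_graphSub (φ := φ) (z := (0, w)) hw u n
    · rw [A₂.isGraded_iff]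
      intro x hx n
      simpa using gradedProj_mem_graphSub (φ := φ) (z := (0, x)) hx n
    · obtain ⟨x, hx, hne⟩ := (Submodule.ne_bot_iff _).1 n₂
      have hmem : x ∈ N.comap (LinearMap.inr ℂ M₁ M₂) := htop ▸ Submodule.mem_top
      obtain ⟨x', hx₁, hx₂⟩ := gradedProj_zero_of_mem_graphSub hφ (z := (0, x)) hmem
      simp only [map_zero] at hx₁
      rw [gradedProj_self _ hx] at hx₂
      have : x' = 0 := Subtype.ext hx₁.symm
      exact hne (by rw [hx₂, this, map_zero]; rfl)
  have hfst : N.map (LinearMap.fst ℂ M₁ M₂) = ⊤ := by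
    refine (h₁.2 _ ?_ ?_).resolve_left fun hbot => ?_
    · rintro u n _ ⟨z, hz, rfl⟩
      exact ⟨_, act_mem_graphSub hz u n, rfl⟩
    · rw [A₁.isGraded_iff]
      rintro _ ⟨z, hz, rfl⟩ n
      exact ⟨_, gradedProj_mem_graphSub hz n, rfl⟩
    · refine n₁ (eq_bot_iff.2 (hbot ▸ fun x hx => ?_))
      exact ⟨_, mem_graphSub (φ := φ) ⟨x, hx⟩, rfl⟩
  have hsnd : N.map (LinearMap.snd ℂ M₁ M₂) = ⊤ := by
    refine (h₂.2 _ ?_ ?_).resolve_left fun hbot => ?_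
    · rintro u n _ ⟨z, hz, rfl⟩
      exact ⟨_, act_mem_graphSub hz u n, rfl⟩
    · rw [A₂.isGraded_iff]
      rintro _ ⟨z, hz, rfl⟩ n
      exact ⟨_, gradedProj_mem_graphSub hz n, rfl⟩
    · refine n₂ (eq_bot_iff.2 (hbot ▸ fun x hx => ?_))
      exact ⟨_, mem_graphSub (φ := φ) (φ.symm ⟨x, hx⟩), by simp⟩
  have bfst : Function.Bijective ((LinearMap.fst ℂ M₁ M₂).domRestrict N) := by
    constructor
    · rw [injective_iff_map_eq_zero]
      rintro ⟨⟨x, y⟩, hz⟩ (rfl : x = 0)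
      have : y ∈ N.comap (LinearMap.inr ℂ M₁ M₂) := hz
      rw [hr, Submodule.mem_bot] at this
      subst this
      rfl
    · intro x
      obtain ⟨z, hz, rfl⟩ : x ∈ N.map (LinearMap.fst ℂ M₁ M₂) := hfst ▸ Submodule.mem_top
      exact ⟨⟨z, hz⟩, rfl⟩
  have bsnd : Function.Bijective ((LinearMap.snd ℂ M₁ M₂).domRestrict N) := by
    constructor
    · rw [injective_iff_map_eq_zero]
      rintro ⟨⟨x, y⟩, hz⟩ (rfl : y = 0)
      have : x ∈ N.comap (LinearMap.inl ℂ M₁ M₂) := hz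
      rw [hl, Submodule.mem_bot] at this
      subst this
      rfl
    · intro x
      obtain ⟨z, hz, rfl⟩ : x ∈ N.map (LinearMap.snd ℂ M₁ M₂) := hsnd ▸ Submodule.mem_top
      exact ⟨⟨z, hz⟩, rfl⟩
  refine ⟨(LinearEquiv.ofBijective _ bfst).symm.trans (LinearEquiv.ofBijective _ bsnd),
    fun u n w => ?_⟩
  obtain ⟨⟨z, hz⟩, rfl⟩ := (LinearEquiv.ofBijective _ bfst).surjective w
  have hact : A₁.act u n (LinearEquiv.ofBijective _ bfst ⟨z, hz⟩) =
      LinearEquiv.ofBijective _ bfst ⟨_, act_mem_graphSub hz u n⟩ := rfl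
  rw [hact]
  simp only [LinearEquiv.trans_apply, LinearEquiv.symm_apply_apply]
  rfl

theorem RepOf.eq_zhuRep (A : AdmMod d M) (Z : RepOf d.Ozhu d.star d.vacuum (A.gr 0))
    (hZ : ∀ (v : V) (w : A.gr 0), ((Z.rep v) w : M) = A.toWeakMod.o v (w : M)) :
    Z.rep = A.zhuRep.rep :=
  LinearMap.ext fun v => LinearMap.ext fun w => Subtype.ext (hZ v w)

end Equivalence

section LaurentOrder

/-- The scalar multiplication underlying the module structure on Laurent series. -/
noncomputable instance laurentSMul : SMul ℂ (LaurentSeries ℂ) :=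
  (HahnSeries.instModule : Module ℂ (LaurentSeries ℂ)).toSMul

/-- Laurent series whose coefficients below `N` vanish. -/
def ordGE (N : ℤ) : Submodule ℂ (LaurentSeries ℂ) where
  carrier := {f | ∀ j, j < N → f.coeff j = 0}
  add_mem' hf hg j hj := by simp [hf j hj, hg j hj]
  zero_mem' j _ := by simp
  smul_mem' c f hf j hj := by simp [hf j hj]

theorem ordGE_anti {m n : ℤ} (h : m ≤ n) : ordGE n ≤ ordGE m :=
  fun _ hf j hj => hf j (by omega)

theorem exists_mem_ordGE (f : LaurentSeries ℂ) : ∃ N, f ∈ ordGE N :=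
  ⟨f.order, fun _ hj => HahnSeries.coeff_eq_zero_of_lt_order hj⟩

theorem mul_mem_ordGE {m n : ℤ} {f g : LaurentSeries ℂ} (hf : f ∈ ordGE m) (hg : g ∈ ordGE n) :
    f * g ∈ ordGE (m + n) := by
  intro j hj
  rw [HahnSeries.coeff_mul]
  refine Finset.sum_eq_zero fun ij hij => ?_
  have hsum := (Finset.mem_antidiagonal.1 hij).2.2
  by_cases h : ij.1 < m
  · rw [hf _ h, zero_mul]
  · rw [hg _ (by omega), mul_zero]

theorem hasseDeriv_mem_ordGE {N : ℤ} {f : LaurentSeries ℂ} (hf : f ∈ ordGE N) (i : ℕ) :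
    LaurentSeries.hasseDeriv ℂ i f ∈ ordGE (N - i) := by
  intro j hj
  rw [LaurentSeries.hasseDeriv_coeff, hf _ (by omega), smul_zero]

theorem single_mem_ordGE (n : ℤ) (c : ℂ) : HahnSeries.single n c ∈ ordGE n := by
  intro j hj
  rw [HahnSeries.coeff_single_of_ne (by omega)]

theorem exists_sub_mem_ordGE (f : LaurentSeries ℂ) (N : ℤ) :
    ∃ s : Finset ℤ, f - ∑ n ∈ s, f.coeff n • HahnSeries.single n (1 : ℂ) ∈ ordGE N := by
  obtain ⟨m, hm⟩ := exists_mem_ordGE f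
  refine ⟨Finset.Ico m N, fun j hj => ?_⟩
  have hterm : ∀ n ∈ Finset.Ico m N, (f.coeff n • HahnSeries.single n (1 : ℂ)).coeff j =
      if n = j then f.coeff j else 0 := by
    intro n _
    by_cases h : n = j
    · subst h; simp
    · rw [HahnSeries.coeff_smul, HahnSeries.coeff_single_of_ne (Ne.symm h), if_neg h, smul_zero]
  rw [HahnSeries.coeff_sub, HahnSeries.coeff_sum, Finset.sum_congr rfl hterm,
    Finset.sum_ite_eq']
  split_ifs with h
  · simp
  · rw [sub_zero, hm j (by simp only [Finset.mem_Ico] at h; omega)]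

theorem linearMap_eq_zero_of_ordGE (F : LaurentSeries ℂ →ₗ[ℂ] M)
    (hN : ∃ N, ∀ f ∈ ordGE N, F f = 0) (h : ∀ n : ℤ, F (HahnSeries.single n 1) = 0) : F = 0 := by
  obtain ⟨N, hN⟩ := hN
  refine LinearMap.ext fun f => ?_
  obtain ⟨s, hs⟩ := exists_sub_mem_ordGE f N
  have := hN _ hs
  rw [map_sub, map_sum, Finset.sum_eq_zero, sub_zero] at this
  · rw [this, LinearMap.zero_apply]
  · intro n _
    rw [map_smul, h, smul_zero]

theorem bilinear_eq_zero_of_ordGE (B : LaurentSeries ℂ →ₗ[ℂ] LaurentSeries ℂ →ₗ[ℂ] M)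
    (hl : ∀ g, ∃ N, ∀ f ∈ ordGE N, B f g = 0) (hr : ∀ f, ∃ N, ∀ g ∈ ordGE N, B f g = 0)
    (h : ∀ m n : ℤ, B (HahnSeries.single m 1) (HahnSeries.single n 1) = 0) : B = 0 := by
  have h1 : ∀ m : ℤ, B (HahnSeries.single m 1) = 0 := fun m =>
    linearMap_eq_zero_of_ordGE _ (hr _) (h m)
  refine LinearMap.ext fun f => LinearMap.ext fun g => ?_
  have := linearMap_eq_zero_of_ordGE (B.flip g) (hl g) fun n => by
    rw [LinearMap.flip_apply, h1, LinearMap.zero_apply]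
  simpa using congrArg (fun F => F f) this

/-- The variable `x` of Laurent series. -/
noncomputable def lx : LaurentSeries ℂ := HahnSeries.single 1 1

/-- The series `y = 1 + x`. -/
noncomputable def ly : LaurentSeries ℂ := 1 + lx

theorem lx_ne_zero : lx ≠ 0 := by simp [lx]

theorem lx_zpow (n : ℤ) : lx ^ n = HahnSeries.single n (1 : ℂ) :=
  (RatFunc.single_zpow n).symm

theorem coeff_lx_zpow_mul (f : LaurentSeries ℂ) (t j : ℤ) :
    (lx ^ t * f).coeff j = f.coeff (j - t) := by
  rw [lx_zpow, HahnSeries.coeff_single_mul, one_mul]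

theorem lx_zpow_mul_mem_ordGE {N : ℤ} {f : LaurentSeries ℂ} (hf : f ∈ ordGE N) (t : ℤ) :
    lx ^ t * f ∈ ordGE (t + N) := by
  rw [lx_zpow]
  exact mul_mem_ordGE (single_mem_ordGE _ _) hf

theorem coeff_ofPowerSeries_of_neg (P : PowerSeries ℂ) {j : ℤ} (hj : j < 0) :
    (HahnSeries.ofPowerSeries ℤ ℂ P).coeff j = 0 := by
  rw [HahnSeries.ofPowerSeries_apply, HahnSeries.embDomain_of_notMem_range]
  rintro ⟨n, hn⟩
  change (n : ℤ) = j at hn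
  omega

theorem ly_eq : ly = HahnSeries.ofPowerSeries ℤ ℂ (1 + PowerSeries.X) := by
  simp [ly, lx]

theorem ly_ne_zero : ly ≠ 0 := by
  rw [ly_eq, Ne, map_eq_zero_iff _ HahnSeries.ofPowerSeries_injective]
  intro h
  have := congrArg (PowerSeries.coeff 0) h
  simp at this

theorem ofPowerSeries_cbinom_succ (s : ℤ) :
    HahnSeries.ofPowerSeries ℤ ℂ (PowerSeries.mk (cbinom (s + 1))) =
      HahnSeries.ofPowerSeries ℤ ℂ (PowerSeries.mk (cbinom s)) * ly := by
  rw [ly_eq, ← map_mul]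
  congr 1
  ext n
  cases n with
  | zero => simp [mul_add, cbinom_zero_right]
  | succ n =>
    rw [mul_add, mul_one, map_add, PowerSeries.coeff_succ_mul_X]
    simp only [PowerSeries.coeff_mk]
    rw [cbinom_succ_succ, add_comm]

theorem ly_zpow (s : ℤ) :
    ly ^ s = HahnSeries.ofPowerSeries ℤ ℂ (PowerSeries.mk (cbinom s)) := by
  induction s using Int.induction_on with
  | zero =>
    have : PowerSeries.mk (cbinom 0) = 1 := by
      ext n
      simp [cbinom_zero_left, PowerSeries.coeff_one]
    simp [this]
  | succ n ih =>
    rw [zpow_add_one₀ ly_ne_zero, ih, ← ofPowerSeries_cbinom_succ]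
  | pred n ih =>
    have h := ofPowerSeries_cbinom_succ (-(n : ℤ) - 1)
    rw [sub_add_cancel, ← ih] at h
    rw [zpow_sub_one₀ ly_ne_zero, h, mul_assoc, mul_inv_cancel₀ ly_ne_zero, mul_one]

theorem coeff_ly_zpow (s : ℤ) (n : ℕ) : (ly ^ s).coeff n = cbinom s n := by
  rw [ly_zpow, LaurentSeries.coeff_coe_powerSeries, PowerSeries.coeff_mk]

theorem coeff_ly_zpow_of_neg (s : ℤ) {j : ℤ} (hj : j < 0) : (ly ^ s).coeff j = 0 := by
  rw [ly_zpow, coeff_ofPowerSeries_of_neg _ hj]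

end LaurentOrder

namespace VOA

variable (d : VOA V)

theorem finite_smear (a w : V) (f : LaurentSeries ℂ) :
    (Function.support fun j : ℤ => f.coeff j • d.mode a j w).Finite := by
  obtain ⟨m, hm⟩ := exists_mem_ordGE f
  obtain ⟨N, hN⟩ := d.truncation a w
  refine (Finset.Ico m N).finite_toSet.subset fun j hj => ?_
  simp only [Finset.coe_Ico, Set.mem_Ico]
  by_contra hc
  rcases lt_or_ge j m with h | h
  · exact hj (by simp [hm j h])
  · exact hj (by simp [hN j (by omega)])

/-- The residue `Res f(x) Y(a, x)` of a vertex operator against a Laurent series. -/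
noncomputable def smear (a : V) : LaurentSeries ℂ →ₗ[ℂ] Module.End ℂ V where
  toFun f :=
    { toFun := fun w => ∑ᶠ j : ℤ, f.coeff j • d.mode a j w
      map_add' := fun w w' => by
        simp only [map_add, smul_add]
        exact finsum_add_distrib (d.finite_smear a w f) (d.finite_smear a w' f)
      map_smul' := fun c w => by
        simp only [map_smul, RingHom.id_apply, smul_comm _ c]
        rw [smul_finsum] }
  map_add' f g := LinearMap.ext fun w => by
    simp only [HahnSeries.coeff_add, add_smul]
    exact finsum_add_distrib (d.finite_smear a w f) (d.finite_smear a w g)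
  map_smul' c f := LinearMap.ext fun w => by
    simp only [HahnSeries.coeff_smul, smul_assoc]
    exact (smul_finsum c _).symm

theorem smear_apply (a : V) (f : LaurentSeries ℂ) (w : V) :
    d.smear a f w = ∑ᶠ j : ℤ, f.coeff j • d.mode a j w := rfl

theorem smear_add (a b : V) : d.smear (a + b) = d.smear a + d.smear b := by
  refine LinearMap.ext fun f => LinearMap.ext fun w => ?_
  simp only [smear_apply, mode_add, LinearMap.add_apply, smul_add]
  exact finsum_add_distrib (d.finite_smear a w f) (d.finite_smear b w f)

theorem smear_smul (c : ℂ) (a : V) : d.smear (c • a) = c • d.smear a := by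
  refine LinearMap.ext fun f => LinearMap.ext fun w => ?_
  simp only [smear_apply, mode_smul, LinearMap.smul_apply, smul_comm _ c]
  rw [smul_finsum]

theorem smear_zero : d.smear 0 = 0 := by
  simpa using d.smear_smul 0 0

theorem exists_smear_eq_zero (a w : V) : ∃ N, ∀ f ∈ ordGE N, d.smear a f w = 0 := by
  obtain ⟨N, hN⟩ := d.truncation a w
  refine ⟨N, fun f hf => ?_⟩
  rw [smear_apply]
  refine finsum_eq_zero_of_forall_eq_zero fun j => ?_
  rcases lt_or_ge j N with h | h
  · rw [hf j h, zero_smul]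
  · rw [hN j h, smul_zero]

theorem smear_single (a : V) (n : ℤ) (c : ℂ) :
    d.smear a (HahnSeries.single n c) = c • d.mode a n := by
  refine LinearMap.ext fun w => ?_
  rw [smear_apply, finsum_eq_single _ n, HahnSeries.coeff_single_same, LinearMap.smul_apply]
  intro j hj
  rw [HahnSeries.coeff_single_of_ne hj, zero_smul]

theorem smear_lx_zpow (a : V) (n : ℤ) : d.smear a (lx ^ n) = d.mode a n := by
  rw [lx_zpow, smear_single, one_smul]

theorem smear_lx_zpow_mul_ly_zpow (a w : V) (s t : ℤ) :
    d.smear a (lx ^ t * ly ^ s) w = d.hres s (-t) a w := by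
  rw [smear_apply, hres]
  have hinj : Function.Injective fun i : ℕ => t + (i : ℤ) := fun i j h => by
    simpa using h
  have hsupp : (Function.support fun j : ℤ => (lx ^ t * ly ^ s).coeff j • d.mode a j w) ⊆
      Set.range fun i : ℕ => t + (i : ℤ) := by
    intro j hj
    rcases lt_or_ge j t with h | h
    · refine absurd ?_ hj
      simp only
      rw [coeff_lx_zpow_mul, coeff_ly_zpow_of_neg _ (by omega), zero_smul]
    · exact ⟨(j - t).toNat, by simp only; omega⟩
  rw [← finsum_mem_univ, ← finsum_mem_inter_support, Set.univ_inter,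
    ← Set.inter_eq_right.2 hsupp, finsum_mem_inter_support, finsum_mem_range hinj]
  refine finsum_congr fun i => ?_
  rw [coeff_lx_zpow_mul, show t + (i : ℤ) - t = i by ring, coeff_ly_zpow,
    show (i : ℤ) - -t = t + i by ring]

theorem evZero_smear_lx (a w : V) (f : LaurentSeries ℂ) :
    EvZero fun i : ℕ => d.smear a (lx ^ (i : ℤ) * f) w := by
  obtain ⟨m, hm⟩ := exists_mem_ordGE f
  obtain ⟨N, hN⟩ := d.exists_smear_eq_zero a w
  exact ⟨(N - m).toNat, fun i hi => hN _ (ordGE_anti (by omega) (lx_zpow_mul_mem_ordGE hm i))⟩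

theorem exists_smear_sum_eq_zero (n : ℕ) (c : ℕ → V) (F : ℕ → LaurentSeries ℂ → LaurentSeries ℂ)
    (m : ℕ → ℤ) (hF : ∀ i N f, f ∈ ordGE N → F i f ∈ ordGE (N - m i)) (w : ℕ → V) :
    ∃ N, ∀ f ∈ ordGE N, ∀ i < n, d.smear (c i) (F i f) (w i) = 0 := by
  induction n with
  | zero => exact ⟨0, fun f _ i hi => absurd hi (by omega)⟩
  | succ n ih =>
    obtain ⟨N, hN⟩ := ih
    obtain ⟨N', hN'⟩ := d.exists_smear_eq_zero (c n) (w n)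
    refine ⟨max N (N' + m n), fun f hf i hi => ?_⟩
    rcases Nat.lt_succ_iff_lt_or_eq.1 hi with h | rfl
    · exact hN f (ordGE_anti (le_max_left _ _) hf) i h
    · refine hN' _ (ordGE_anti ?_ (hF _ _ f hf))
      have := le_max_right N (N' + m i)
      omega

end VOA

theorem laurent_zero_smul (f : LaurentSeries ℂ) : (0 : ℂ) • f = 0 := by
  ext j
  rw [HahnSeries.coeff_smul, zero_smul, HahnSeries.coeff_zero]

theorem laurent_smul_mul (c : ℂ) (f g : LaurentSeries ℂ) : (c • f) * g = c • (f * g) := by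
  rw [← HahnSeries.C_mul_eq_smul, ← HahnSeries.C_mul_eq_smul, mul_assoc]

theorem laurent_mul_smul (c : ℂ) (f g : LaurentSeries ℂ) : f * (c • g) = c • (f * g) := by
  rw [mul_comm, laurent_smul_mul, mul_comm]

theorem single_eq_smul_lx_zpow (n : ℤ) (c : ℂ) : HahnSeries.single n c = c • lx ^ n := by
  rw [lx_zpow, ← HahnSeries.C_mul_eq_smul, HahnSeries.C_apply, HahnSeries.single_mul_single]
  simp

theorem hasseDeriv_lx_zpow (i : ℕ) (p : ℤ) :
    LaurentSeries.hasseDeriv ℂ i (lx ^ p) = cbinom p i • lx ^ (p - i) := by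
  rw [lx_zpow, lx_zpow, LaurentSeries.hasseDeriv_single, cbinom_eq_choose, ← lx_zpow,
    ← single_eq_smul_lx_zpow]
  simp

namespace VOA

variable (d : VOA V)

/-- `f ↦ g ↦ ∑ᵢ a(x^{-1-i} f) b(xⁱ g) w`. -/
noncomputable def prodSmear (a b w : V) : LaurentSeries ℂ →ₗ[ℂ] LaurentSeries ℂ →ₗ[ℂ] V :=
  have hfin : ∀ f g : LaurentSeries ℂ, EvZero fun i : ℕ =>
      d.smear a (lx ^ (-1 - (i : ℤ)) * f) (d.smear b (lx ^ (i : ℤ) * g) w) := by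
    intro f g
    obtain ⟨N, hN⟩ := d.evZero_smear_lx b w g
    exact ⟨N, fun i hi => by simpa using congrArg (d.smear a (lx ^ (-1 - (i : ℤ)) * f)) (hN i hi)⟩
  LinearMap.mk₂ ℂ (fun f g => ∑ᶠ i : ℕ,
      d.smear a (lx ^ (-1 - (i : ℤ)) * f) (d.smear b (lx ^ (i : ℤ) * g) w))
    (fun f f' g => by
      simp only [mul_add, map_add, LinearMap.add_apply]
      exact finsum_add_distrib (hfin f g).finite (hfin f' g).finite)
    (fun c f g => by
      simp only [laurent_mul_smul, map_smul, LinearMap.smul_apply]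
      rw [smul_finsum])
    (fun f g g' => by
      simp only [mul_add, map_add, LinearMap.add_apply]
      exact finsum_add_distrib (hfin f g).finite (hfin f g').finite)
    (fun c f g => by
      simp only [laurent_mul_smul, map_smul, LinearMap.smul_apply]
      rw [smul_finsum])

theorem prodSmear_apply (a b w : V) (f g : LaurentSeries ℂ) :
    d.prodSmear a b w f g = ∑ᶠ i : ℕ,
      d.smear a (lx ^ (-1 - (i : ℤ)) * f) (d.smear b (lx ^ (i : ℤ) * g) w) := rfl

theorem exists_prodSmear_eq_zero_left (a b w : V) (g : LaurentSeries ℂ) :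
    ∃ N, ∀ f ∈ ordGE N, d.prodSmear a b w f g = 0 := by
  obtain ⟨I, hI⟩ := d.evZero_smear_lx b w g
  obtain ⟨N, hN⟩ := d.exists_smear_sum_eq_zero I (fun _ => a)
    (fun i f => lx ^ (-1 - (i : ℤ)) * f) (fun i => 1 + i)
    (fun i N f hf => ordGE_anti (by omega) (lx_zpow_mul_mem_ordGE hf (-1 - (i : ℤ))))
    (fun i => d.smear b (lx ^ (i : ℤ) * g) w)
  refine ⟨N, fun f hf => ?_⟩
  rw [prodSmear_apply]
  refine finsum_eq_zero_of_forall_eq_zero fun i => ?_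
  rcases lt_or_ge i I with h | h
  · exact hN f hf i h
  · simpa using congrArg (d.smear a (lx ^ (-1 - (i : ℤ)) * f)) (hI i h)

theorem exists_prodSmear_eq_zero_right (a b w : V) (f : LaurentSeries ℂ) :
    ∃ N, ∀ g ∈ ordGE N, d.prodSmear a b w f g = 0 := by
  obtain ⟨N, hN⟩ := d.exists_smear_eq_zero b w
  refine ⟨N, fun g hg => ?_⟩
  rw [prodSmear_apply]
  refine finsum_eq_zero_of_forall_eq_zero fun i => ?_
  rw [hN _ (ordGE_anti (by omega) (lx_zpow_mul_mem_ordGE hg i)), map_zero]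

theorem exists_smear_smear_left (a b w : V) (g : LaurentSeries ℂ) :
    ∃ N, ∀ f ∈ ordGE N, d.smear a f (d.smear b g w) = 0 := d.exists_smear_eq_zero a _

theorem exists_smear_smear_right (a b w : V) (f : LaurentSeries ℂ) :
    ∃ N, ∀ g ∈ ordGE N, d.smear a f (d.smear b g w) = 0 := by
  obtain ⟨N, hN⟩ := d.exists_smear_eq_zero b w
  exact ⟨N, fun g hg => by rw [hN g hg, map_zero]⟩

/-- `f ↦ g ↦ a(f) b(g) w`. -/
noncomputable def smearSmear (a b w : V) : LaurentSeries ℂ →ₗ[ℂ] LaurentSeries ℂ →ₗ[ℂ] V :=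
  LinearMap.mk₂ ℂ (fun f g => d.smear a f (d.smear b g w))
    (fun _ _ _ => by simp) (fun _ _ _ => by simp) (fun _ _ _ => by simp) (fun _ _ _ => by simp)

theorem smearSmear_apply (a b w : V) (f g : LaurentSeries ℂ) :
    d.smearSmear a b w f g = d.smear a f (d.smear b g w) := rfl

/-- `f ↦ g ↦ ∑_{i < n} (a_{r+i} b)(∂^{(i)} f g) w`. -/
noncomputable def iterSmear (n : ℕ) (c : ℕ → V) (w : V) :
    LaurentSeries ℂ →ₗ[ℂ] LaurentSeries ℂ →ₗ[ℂ] V :=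
  LinearMap.mk₂ ℂ (fun f g => ∑ i ∈ Finset.range n,
      d.smear (c i) (LaurentSeries.hasseDeriv ℂ i f * g) w)
    (fun _ _ _ => by simp [add_mul, Finset.sum_add_distrib])
    (fun _ _ _ => by simp [Finset.smul_sum, laurent_smul_mul])
    (fun _ _ _ => by simp [mul_add, Finset.sum_add_distrib])
    (fun _ _ _ => by simp [Finset.smul_sum, laurent_mul_smul])

theorem iterSmear_apply (n : ℕ) (c : ℕ → V) (w : V) (f g : LaurentSeries ℂ) :
    d.iterSmear n c w f g = ∑ i ∈ Finset.range n,
      d.smear (c i) (LaurentSeries.hasseDeriv ℂ i f * g) w := rfl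

theorem exists_iterSmear_left (n : ℕ) (c : ℕ → V) (w : V) (g : LaurentSeries ℂ) :
    ∃ N, ∀ f ∈ ordGE N, d.iterSmear n c w f g = 0 := by
  obtain ⟨m, hm⟩ := exists_mem_ordGE g
  obtain ⟨N, hN⟩ := d.exists_smear_sum_eq_zero n c
    (fun i f => LaurentSeries.hasseDeriv ℂ i f * g) (fun i => i - m)
    (fun i N f hf => ordGE_anti (by omega) (mul_mem_ordGE (hasseDeriv_mem_ordGE hf i) hm))
    (fun _ => w)
  exact ⟨N, fun f hf => Finset.sum_eq_zero fun i hi => hN f hf i (Finset.mem_range.1 hi)⟩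

theorem exists_iterSmear_right (n : ℕ) (c : ℕ → V) (w : V) (f : LaurentSeries ℂ) :
    ∃ N, ∀ g ∈ ordGE N, d.iterSmear n c w f g = 0 := by
  obtain ⟨m, hm⟩ := exists_mem_ordGE f
  obtain ⟨N, hN⟩ := d.exists_smear_sum_eq_zero n c
    (fun i g => LaurentSeries.hasseDeriv ℂ i f * g) (fun i => i - m)
    (fun i N g hg => ordGE_anti (by omega) (mul_mem_ordGE (hasseDeriv_mem_ordGE hm i) hg))
    (fun _ => w)
  exact ⟨N, fun f hf => Finset.sum_eq_zero fun i hi => hN f hf i (Finset.mem_range.1 hi)⟩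

theorem iterSmear_lx_zpow {n : ℕ} {c : ℕ → V} (hc : ∀ i, n ≤ i → c i = 0) (w : V) (p q : ℤ) :
    d.iterSmear n c w (lx ^ p) (lx ^ q) = ∑ᶠ i : ℕ, cbinom p i • d.mode (c i) (p + q - i) w := by
  rw [iterSmear_apply, finsum_eq_sum_range fun i hi => ?_]
  · refine Finset.sum_congr rfl fun i _ => ?_
    rw [hasseDeriv_lx_zpow, laurent_smul_mul, ← zpow_add₀ lx_ne_zero, map_smul, smear_lx_zpow,
      LinearMap.smul_apply, show p - i + q = p + q - i by ring]
  · rw [hc i hi, ← smear_lx_zpow, smear_zero]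
    simp

theorem smear_commutator (a b w : V) {n : ℕ} (hn : ∀ i : ℕ, n ≤ i → d.mode a i b = 0)
    (f g : LaurentSeries ℂ) :
    d.smear a f (d.smear b g w) - d.smear b g (d.smear a f w) =
      ∑ i ∈ Finset.range n, d.smear (d.mode a i b) (LaurentSeries.hasseDeriv ℂ i f * g) w := by
  have key : d.smearSmear a b w - (d.smearSmear b a w).flip -
      d.iterSmear n (fun i => d.mode a i b) w = 0 := by
    refine bilinear_eq_zero_of_ordGE _ (fun g => ?_) (fun f => ?_) fun p q => ?_
    · obtain ⟨N₁, h₁⟩ := d.exists_smear_smear_left a b w g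
      obtain ⟨N₂, h₂⟩ := d.exists_smear_smear_right b a w g
      obtain ⟨N₃, h₃⟩ := d.exists_iterSmear_left n (fun i => d.mode a i b) w g
      refine ⟨max N₁ (max N₂ N₃), fun f hf => ?_⟩
      simp only [LinearMap.sub_apply, LinearMap.flip_apply, smearSmear_apply]
      rw [h₁ f (ordGE_anti (by omega) hf), h₂ f (ordGE_anti (by omega) hf),
        h₃ f (ordGE_anti (by omega) hf)]
      simp
    · obtain ⟨N₁, h₁⟩ := d.exists_smear_smear_right a b w f
      obtain ⟨N₂, h₂⟩ := d.exists_smear_smear_left b a w f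
      obtain ⟨N₃, h₃⟩ := d.exists_iterSmear_right n (fun i => d.mode a i b) w f
      refine ⟨max N₁ (max N₂ N₃), fun g hg => ?_⟩
      simp only [LinearMap.sub_apply, LinearMap.flip_apply, smearSmear_apply]
      rw [h₁ g (ordGE_anti (by omega) hg), h₂ g (ordGE_anti (by omega) hg),
        h₃ g (ordGE_anti (by omega) hg)]
      simp
    · rw [← lx_zpow, ← lx_zpow]
      simp only [LinearMap.sub_apply, LinearMap.flip_apply, smearSmear_apply, smear_lx_zpow]
      rw [d.iterSmear_lx_zpow hn]
      have h := d.borcherds p q 0 a b w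
      simp only [zero_add] at h
      rw [h, finsum_eq_single _ 0]
      · simp [cbinom_zero_right]
      · intro i hi
        simp [cbinom_zero_left, hi]
  have := LinearMap.congr_fun (LinearMap.congr_fun key f) g
  simpa [sub_eq_zero, smearSmear_apply, iterSmear_apply] using this

theorem smear_iterate (a b w : V) {n : ℕ} (hn : ∀ i : ℕ, n ≤ i → d.mode a (-1 + i) b = 0)
    (f g : LaurentSeries ℂ) :
    ∑ i ∈ Finset.range n, d.smear (d.mode a (-1 + i) b) (LaurentSeries.hasseDeriv ℂ i f * g) w =
      d.prodSmear a b w f g + d.prodSmear b a w g f := by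
  have key : d.iterSmear n (fun i => d.mode a (-1 + i) b) w -
      (d.prodSmear a b w + (d.prodSmear b a w).flip) = 0 := by
    refine bilinear_eq_zero_of_ordGE _ (fun g => ?_) (fun f => ?_) fun p q => ?_
    · obtain ⟨N₁, h₁⟩ := d.exists_prodSmear_eq_zero_left a b w g
      obtain ⟨N₂, h₂⟩ := d.exists_prodSmear_eq_zero_right b a w g
      obtain ⟨N₃, h₃⟩ := d.exists_iterSmear_left n (fun i => d.mode a (-1 + i) b) w g
      refine ⟨max N₁ (max N₂ N₃), fun f hf => ?_⟩
      simp only [LinearMap.sub_apply, LinearMap.add_apply, LinearMap.flip_apply]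
      rw [h₁ f (ordGE_anti (by omega) hf), h₂ f (ordGE_anti (by omega) hf),
        h₃ f (ordGE_anti (by omega) hf)]
      simp
    · obtain ⟨N₁, h₁⟩ := d.exists_prodSmear_eq_zero_right a b w f
      obtain ⟨N₂, h₂⟩ := d.exists_prodSmear_eq_zero_left b a w f
      obtain ⟨N₃, h₃⟩ := d.exists_iterSmear_right n (fun i => d.mode a (-1 + i) b) w f
      refine ⟨max N₁ (max N₂ N₃), fun g hg => ?_⟩
      simp only [LinearMap.sub_apply, LinearMap.add_apply, LinearMap.flip_apply]
      rw [h₁ g (ordGE_anti (by omega) hg), h₂ g (ordGE_anti (by omega) hg),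
        h₃ g (ordGE_anti (by omega) hg)]
      simp
    · rw [← lx_zpow, ← lx_zpow]
      simp only [LinearMap.sub_apply, LinearMap.add_apply, LinearMap.flip_apply]
      rw [d.iterSmear_lx_zpow hn, d.borcherds p q (-1) a b w]
      have hs : ∀ (a b : V) (p q : ℤ), d.prodSmear a b w (lx ^ p) (lx ^ q) =
          ∑ᶠ i : ℕ, d.mode a (p + -1 - i) (d.mode b (q + i) w) := by
        intro a b p q
        rw [prodSmear_apply]
        refine finsum_congr fun i => ?_
        rw [← zpow_add₀ lx_ne_zero, ← zpow_add₀ lx_ne_zero, smear_lx_zpow, smear_lx_zpow,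
          show -1 - (i : ℤ) + p = p + -1 - i by ring, add_comm (i : ℤ) q]
      have hfin : ∀ (a b : V) (p q : ℤ), (Function.support fun i : ℕ =>
          d.mode a (p + -1 - i) (d.mode b (q + i) w)).Finite := by
        intro a b p q
        refine EvZero.finite ?_
        obtain ⟨N, hN⟩ := d.exists_nat_truncation b w q
        exact ⟨N, fun i hi => by simpa using congrArg (d.mode a (p + -1 - i)) (hN i hi)⟩
      rw [hs, hs, ← finsum_add_distrib (hfin _ _ _ _) (hfin _ _ _ _), sub_eq_zero]
      refine finsum_congr fun i => ?_
      rw [cbinom_neg_one, ← mul_pow]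
      simp
  have := LinearMap.congr_fun (LinearMap.congr_fun key f) g
  simp only [LinearMap.sub_apply, LinearMap.add_apply, LinearMap.flip_apply, LinearMap.zero_apply,
    iterSmear_apply] at this
  exact sub_eq_zero.1 this

theorem smear_conformal_zero (a : V) (f : LaurentSeries ℂ) :
    d.smear (d.mode d.conformal 0 a) f = -d.smear a (LaurentSeries.hasseDeriv ℂ 1 f) := by
  refine LinearMap.ext fun w => ?_
  have key : (d.smear (d.mode d.conformal 0 a) + d.smear a ∘ₗ LaurentSeries.hasseDeriv ℂ 1).flip w
      = 0 := by
    refine linearMap_eq_zero_of_ordGE _ ?_ fun n => ?_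
    · obtain ⟨N₁, h₁⟩ := d.exists_smear_eq_zero (d.mode d.conformal 0 a) w
      obtain ⟨N₂, h₂⟩ := d.exists_smear_eq_zero a w
      refine ⟨max N₁ (N₂ + 1), fun f hf => ?_⟩
      simp only [LinearMap.flip_apply, LinearMap.add_apply, LinearMap.comp_apply]
      rw [h₁ f (ordGE_anti (by omega) hf),
        h₂ _ (ordGE_anti (by push_cast; omega) (hasseDeriv_mem_ordGE hf 1)), add_zero]
    · rw [← lx_zpow]
      simp only [LinearMap.flip_apply, LinearMap.add_apply, LinearMap.comp_apply]
      rw [hasseDeriv_lx_zpow, map_smul, smear_lx_zpow, smear_lx_zpow, d.Lneg1_deriv]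
      simp [cbinom]
  have := LinearMap.congr_fun key f
  simp only [LinearMap.flip_apply, LinearMap.add_apply, LinearMap.comp_apply,
    LinearMap.zero_apply] at this
  simpa using eq_neg_of_add_eq_zero_left this

end VOA

section Rational

theorem hasseDeriv_one_mul (f g : LaurentSeries ℂ) :
    LaurentSeries.hasseDeriv ℂ 1 (f * g) =
      LaurentSeries.hasseDeriv ℂ 1 f * g + f * LaurentSeries.hasseDeriv ℂ 1 g := by
  let D : LaurentSeries ℂ →ₗ[ℂ] LaurentSeries ℂ := LaurentSeries.hasseDeriv ℂ 1
  have key (j : ℤ) : LinearMap.mk₂ ℂ (fun f g : LaurentSeries ℂ =>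
      (D (f * g) - (D f * g + f * D g)).coeff j)
      (fun _ _ _ => by simp only [map_add, add_mul, HahnSeries.coeff_sub, HahnSeries.coeff_add]; ring)
      (fun _ _ _ => by
        simp only [map_smul, laurent_smul_mul, HahnSeries.coeff_sub, HahnSeries.coeff_add,
          HahnSeries.coeff_smul, smul_eq_mul]; ring)
      (fun _ _ _ => by simp only [map_add, mul_add, HahnSeries.coeff_sub, HahnSeries.coeff_add]; ring)
      (fun _ _ _ => by
        simp only [map_smul, laurent_mul_smul, HahnSeries.coeff_sub, HahnSeries.coeff_add,
          HahnSeries.coeff_smul, smul_eq_mul]; ring) = 0 := by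
    have van : ∀ {m n : ℤ} {f g : LaurentSeries ℂ}, f ∈ ordGE m → g ∈ ordGE n → j < m + n - 1 →
        (D (f * g) - (D f * g + f * D g)).coeff j = 0 := by
      intro m n f g hf hg hj
      have h1 : D (f * g) ∈ ordGE (m + n - 1) := hasseDeriv_mem_ordGE (mul_mem_ordGE hf hg) 1
      have h2 : D f * g ∈ ordGE (m + n - 1) :=
        ordGE_anti (by push_cast; omega) (mul_mem_ordGE (hasseDeriv_mem_ordGE hf 1) hg)
      have h3 : f * D g ∈ ordGE (m + n - 1) :=
        ordGE_anti (by push_cast; omega) (mul_mem_ordGE hf (hasseDeriv_mem_ordGE hg 1))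
      exact sub_mem h1 (add_mem h2 h3) j hj
    refine bilinear_eq_zero_of_ordGE _ (fun g => ?_) (fun f => ?_) fun p q => ?_
    · obtain ⟨n, hn⟩ := exists_mem_ordGE g
      exact ⟨j + 2 - n, fun f hf => van hf hn (by omega)⟩
    · obtain ⟨n, hn⟩ := exists_mem_ordGE f
      exact ⟨j + 2 - n, fun g hg => van hn hg (by omega)⟩
    · rw [← lx_zpow, ← lx_zpow, LinearMap.mk₂_apply]
      have hD : ∀ p : ℤ, D (lx ^ p) = (p : ℂ) • lx ^ (p - 1) := fun p => by
        simp only [D, hasseDeriv_lx_zpow]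
        simp [cbinom]
      rw [← zpow_add₀ lx_ne_zero, hD, hD, hD, laurent_smul_mul, laurent_mul_smul,
        ← zpow_add₀ lx_ne_zero, ← zpow_add₀ lx_ne_zero, show p - 1 + q = p + q - 1 by ring,
        show p + (q - 1) = p + q - 1 by ring]
      simp only [HahnSeries.coeff_sub, HahnSeries.coeff_add, HahnSeries.coeff_smul, smul_eq_mul]
      push_cast
      ring
  ext j
  have := LinearMap.congr_fun (LinearMap.congr_fun (key j) f) g
  simp only [LinearMap.mk₂_apply, LinearMap.zero_apply, HahnSeries.coeff_sub,
    sub_eq_zero] at this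
  exact this

theorem hasseDeriv_one_ly_zpow (s : ℤ) :
    LaurentSeries.hasseDeriv ℂ 1 (ly ^ s) = (s : ℂ) • ly ^ (s - 1) := by
  ext j
  rw [LaurentSeries.hasseDeriv_coeff, HahnSeries.coeff_smul]
  rcases lt_trichotomy j (-1) with h | rfl | h
  · rw [coeff_ly_zpow_of_neg _ (by omega), coeff_ly_zpow_of_neg _ (by omega)]
    simp
  · rw [coeff_ly_zpow_of_neg (s - 1) (by omega)]
    simp
  · obtain ⟨n, rfl⟩ : ∃ n : ℕ, j = n := ⟨j.toNat, by omega⟩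
    rw [show (n : ℤ) + (1 : ℕ) = (n + 1 : ℕ) by push_cast; ring, coeff_ly_zpow, coeff_ly_zpow]
    have := mul_cbinom_pred s n
    simp only [Ring.choose_one_right, smul_eq_mul, zsmul_eq_mul]
    push_cast at this ⊢
    linear_combination -this

theorem hasseDeriv_one_ly_mul_lx (s t : ℤ) :
    LaurentSeries.hasseDeriv ℂ 1 (ly ^ s * lx ^ t) =
      (s : ℂ) • (ly ^ (s - 1) * lx ^ t) + (t : ℂ) • (ly ^ s * lx ^ (t - 1)) := by
  rw [hasseDeriv_one_mul, hasseDeriv_one_ly_zpow, hasseDeriv_lx_zpow, laurent_smul_mul,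
    laurent_mul_smul]
  simp [cbinom]

theorem succ_smul_hasseDeriv_succ (i : ℕ) (f : LaurentSeries ℂ) :
    ((i : ℂ) + 1) • LaurentSeries.hasseDeriv ℂ (i + 1) f =
      LaurentSeries.hasseDeriv ℂ 1 (LaurentSeries.hasseDeriv ℂ i f) := by
  rw [LaurentSeries.hasseDeriv_comp, Nat.choose_one_right, ← Nat.cast_smul_eq_nsmul ℂ, add_comm 1 i]
  push_cast
  rfl

theorem hasseDeriv_ly_zpow (i : ℕ) (s : ℤ) :
    LaurentSeries.hasseDeriv ℂ i (ly ^ s) = cbinom s i • ly ^ (s - i) := by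
  induction i with
  | zero => simp [cbinom_zero_right]
  | succ i ih =>
    have hi : ((i : ℂ) + 1) ≠ 0 := Nat.cast_add_one_ne_zero i
    have h := succ_smul_hasseDeriv_succ i (ly ^ s)
    rw [ih, map_smul, hasseDeriv_one_ly_zpow, smul_smul] at h
    apply smul_right_injective _ hi
    simp only
    rw [h, smul_smul, show s - ((i + 1 : ℕ) : ℤ) = s - i - 1 by push_cast; ring]
    congr 1
    have := cbinom_succ_mul s i
    push_cast at this ⊢
    linear_combination -this

/-- The span of the `yˢ xᵗ` with `K ≤ s`. -/
noncomputable def ordY (K : ℤ) : Submodule ℂ (LaurentSeries ℂ) :=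
  Submodule.span ℂ {f | ∃ s t : ℤ, K ≤ s ∧ f = ly ^ s * lx ^ t}

/-- The span of the `yˢ xᵗ` with `s + t ≤ L`. -/
noncomputable def degLE (L : ℤ) : Submodule ℂ (LaurentSeries ℂ) :=
  Submodule.span ℂ {f | ∃ s t : ℤ, s + t ≤ L ∧ f = ly ^ s * lx ^ t}

theorem ly_mul_lx_mem_ordY {K s : ℤ} (t : ℤ) (h : K ≤ s) : ly ^ s * lx ^ t ∈ ordY K :=
  Submodule.subset_span ⟨s, t, h, rfl⟩

theorem ly_mul_lx_mem_degLE {L s t : ℤ} (h : s + t ≤ L) : ly ^ s * lx ^ t ∈ degLE L :=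
  Submodule.subset_span ⟨s, t, h, rfl⟩

theorem ly_zpow_mem_ordY {K s : ℤ} (h : K ≤ s) : ly ^ s ∈ ordY K := by
  simpa using ly_mul_lx_mem_ordY 0 h

theorem ly_zpow_mem_degLE {K s : ℤ} (h : s ≤ K) : ly ^ s ∈ degLE K := by
  simpa using ly_mul_lx_mem_degLE (s := s) (t := 0) (by simpa using h)

theorem lx_zpow_mem_ordY {K : ℤ} (t : ℤ) (h : K ≤ 0) : lx ^ t ∈ ordY K := by
  simpa using ly_mul_lx_mem_ordY t h

theorem lx_zpow_mem_degLE {L t : ℤ} (h : t ≤ L) : lx ^ t ∈ degLE L := by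
  simpa using ly_mul_lx_mem_degLE (s := 0) (t := t) (by simpa using h)

theorem ordY_anti {m n : ℤ} (h : m ≤ n) : ordY n ≤ ordY m :=
  Submodule.span_mono fun _ ⟨s, t, hs, hf⟩ => ⟨s, t, by omega, hf⟩

theorem degLE_mono {m n : ℤ} (h : m ≤ n) : degLE m ≤ degLE n :=
  Submodule.span_mono fun _ ⟨s, t, hs, hf⟩ => ⟨s, t, by omega, hf⟩

theorem mul_mem_of_mem_span {S T U : Set (LaurentSeries ℂ)}
    (h : ∀ f ∈ S, ∀ g ∈ T, f * g ∈ U) {f g : LaurentSeries ℂ} (hf : f ∈ Submodule.span ℂ S)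
    (hg : g ∈ Submodule.span ℂ T) : f * g ∈ Submodule.span ℂ U := by
  induction hf using Submodule.span_induction with
  | zero => simp
  | add f f' _ _ h1 h2 => rw [add_mul]; exact add_mem h1 h2
  | smul c f _ h1 => rw [laurent_smul_mul]; exact Submodule.smul_mem _ _ h1
  | mem f hf =>
    induction hg using Submodule.span_induction with
    | zero => simp
    | add f f' _ _ h1 h2 => rw [mul_add]; exact add_mem h1 h2
    | smul c f _ h1 => rw [laurent_mul_smul]; exact Submodule.smul_mem _ _ h1
    | mem g hg => exact Submodule.subset_span (h f hf g hg)

theorem ly_mul_lx_mul (s t s' t' : ℤ) :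
    ly ^ s * lx ^ t * (ly ^ s' * lx ^ t') = ly ^ (s + s') * lx ^ (t + t') := by
  rw [zpow_add₀ ly_ne_zero, zpow_add₀ lx_ne_zero]
  ring

theorem mul_mem_ordY {m n : ℤ} {f g : LaurentSeries ℂ} (hf : f ∈ ordY m) (hg : g ∈ ordY n) :
    f * g ∈ ordY (m + n) := by
  refine mul_mem_of_mem_span ?_ hf hg
  rintro _ ⟨s, t, h, rfl⟩ _ ⟨s', t', h', rfl⟩
  exact ⟨s + s', t + t', by omega, ly_mul_lx_mul _ _ _ _⟩

theorem mul_mem_degLE {m n : ℤ} {f g : LaurentSeries ℂ} (hf : f ∈ degLE m) (hg : g ∈ degLE n) :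
    f * g ∈ degLE (m + n) := by
  refine mul_mem_of_mem_span ?_ hf hg
  rintro _ ⟨s, t, h, rfl⟩ _ ⟨s', t', h', rfl⟩
  exact ⟨s + s', t + t', by omega, ly_mul_lx_mul _ _ _ _⟩

theorem hasseDeriv_one_mem_ordY {K : ℤ} {f : LaurentSeries ℂ} (hf : f ∈ ordY K) :
    LaurentSeries.hasseDeriv ℂ 1 f ∈ ordY (K - 1) := by
  refine (Submodule.span_le (p := (ordY (K - 1)).comap (LaurentSeries.hasseDeriv ℂ 1))).2 ?_ hf
  rintro _ ⟨s, t, h, rfl⟩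
  simp only [Submodule.comap_coe, Set.mem_preimage, SetLike.mem_coe, hasseDeriv_one_ly_mul_lx]
  exact add_mem (Submodule.smul_mem _ _ (ly_mul_lx_mem_ordY _ (by omega)))
    (Submodule.smul_mem _ _ (ly_mul_lx_mem_ordY _ (by omega)))

theorem hasseDeriv_one_mem_degLE {L : ℤ} {f : LaurentSeries ℂ} (hf : f ∈ degLE L) :
    LaurentSeries.hasseDeriv ℂ 1 f ∈ degLE (L - 1) := by
  refine (Submodule.span_le (p := (degLE (L - 1)).comap (LaurentSeries.hasseDeriv ℂ 1))).2 ?_ hf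
  rintro _ ⟨s, t, h, rfl⟩
  simp only [Submodule.comap_coe, Set.mem_preimage, SetLike.mem_coe, hasseDeriv_one_ly_mul_lx]
  exact add_mem (Submodule.smul_mem _ _ (ly_mul_lx_mem_degLE (by omega)))
    (Submodule.smul_mem _ _ (ly_mul_lx_mem_degLE (by omega)))

theorem hasseDeriv_mem_of_one {J : ℤ → Submodule ℂ (LaurentSeries ℂ)}
    (hJ : ∀ {K : ℤ} {f : LaurentSeries ℂ}, f ∈ J K → LaurentSeries.hasseDeriv ℂ 1 f ∈ J (K - 1))
    {K : ℤ} {f : LaurentSeries ℂ} (hf : f ∈ J K) (i : ℕ) :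
    LaurentSeries.hasseDeriv ℂ i f ∈ J (K - i) := by
  induction i with
  | zero => simpa using hf
  | succ i ih =>
    have hi : ((i : ℂ) + 1) ≠ 0 := Nat.cast_add_one_ne_zero i
    have h := hJ ih
    rw [← succ_smul_hasseDeriv_succ, Submodule.smul_mem_iff _ hi] at h
    rwa [show K - ((i + 1 : ℕ) : ℤ) = K - i - 1 by push_cast; ring]

theorem hasseDeriv_mem_ordY {K : ℤ} {f : LaurentSeries ℂ} (hf : f ∈ ordY K) (i : ℕ) :
    LaurentSeries.hasseDeriv ℂ i f ∈ ordY (K - i) :=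
  hasseDeriv_mem_of_one (J := ordY) hasseDeriv_one_mem_ordY hf i

theorem hasseDeriv_mem_degLE {L : ℤ} {f : LaurentSeries ℂ} (hf : f ∈ degLE L) (i : ℕ) :
    LaurentSeries.hasseDeriv ℂ i f ∈ degLE (L - i) :=
  hasseDeriv_mem_of_one (J := degLE) hasseDeriv_one_mem_degLE hf i

theorem ly_mul_lx_sub_mem_ordY (k t : ℤ) :
    ly ^ k * lx ^ t - (-1 : ℂ) ^ t • ly ^ k ∈ ordY (k + 1) := by
  have step : ∀ t : ℤ, ly ^ k * lx ^ (t + 1) - (-1 : ℂ) ^ (t + 1) • ly ^ k =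
      ly ^ (k + 1) * lx ^ t - (ly ^ k * lx ^ t - (-1 : ℂ) ^ t • ly ^ k) := by
    intro t
    rw [zpow_add_one₀ ly_ne_zero, zpow_add_one₀ lx_ne_zero,
      zpow_add_one₀ (by norm_num : (-1 : ℂ) ≠ 0), mul_neg_one, neg_smul]
    have : ly = 1 + lx := rfl
    linear_combination (-(ly ^ k * lx ^ t)) * this
  induction t using Int.induction_on with
  | zero => simp
  | succ n ih =>
    rw [step]
    exact sub_mem (ly_mul_lx_mem_ordY _ le_rfl) ih
  | pred n ih =>
    have := step (-(n : ℤ) - 1)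
    rw [sub_add_cancel] at this
    rw [this] at ih
    simpa using sub_mem (ly_mul_lx_mem_ordY (K := k + 1) (-(n : ℤ) - 1) le_rfl) ih

theorem exists_sub_smul_mem_ordY {k : ℤ} {f : LaurentSeries ℂ} (hf : f ∈ ordY k) :
    ∃ c : ℂ, f - c • ly ^ k ∈ ordY (k + 1) := by
  induction hf using Submodule.span_induction with
  | zero => exact ⟨0, by rw [laurent_zero_smul]; simp⟩
  | add f g _ _ h1 h2 =>
    obtain ⟨c, hc⟩ := h1
    obtain ⟨c', hc'⟩ := h2
    refine ⟨c + c', ?_⟩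
    convert add_mem hc hc' using 1
    module
  | smul a f _ h =>
    obtain ⟨c, hc⟩ := h
    refine ⟨a * c, ?_⟩
    convert Submodule.smul_mem _ a hc using 1
    module
  | mem f hf =>
    obtain ⟨s, t, hs, rfl⟩ := hf
    rcases hs.eq_or_lt with rfl | hs
    · exact ⟨_, ly_mul_lx_sub_mem_ordY _ _⟩
    · refine ⟨0, ?_⟩
      rw [laurent_zero_smul, sub_zero]
      exact ly_mul_lx_mem_ordY t (by omega)

theorem exists_mem_degLE_sub_mem_ordY (m K L : ℤ) :
    ∃ f ∈ degLE L, f - ly ^ m ∈ ordY K := by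
  have key : ∀ k : ℕ, ∃ f ∈ degLE L, f - ly ^ m ∈ ordY (m + k) := by
    intro k
    induction k with
    | zero => exact ⟨0, zero_mem _, by simpa using neg_mem (ly_zpow_mem_ordY (le_refl m))⟩
    | succ k ih =>
      obtain ⟨f, hf, h⟩ := ih
      obtain ⟨c, hc⟩ := exists_sub_smul_mem_ordY h
      set t : ℤ := L - (m + k)
      have ht := ly_mul_lx_sub_mem_ordY (m + k) t
      have h1 : (-1 : ℂ) ^ t * (-1 : ℂ) ^ t = 1 := by
        rw [← mul_zpow]; simp
      refine ⟨f - (c * (-1 : ℂ) ^ t) • (ly ^ (m + (k : ℤ)) * lx ^ t),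
        sub_mem hf (Submodule.smul_mem _ _ (ly_mul_lx_mem_degLE (by omega))), ?_⟩
      convert sub_mem hc (Submodule.smul_mem _ (c * (-1 : ℂ) ^ t) ht) using 1
      · push_cast
        rw [add_assoc]
      · rw [smul_sub, smul_smul, mul_assoc, h1]
        module
  obtain ⟨f, hf, h⟩ := key (K - m).toNat
  exact ⟨f, hf, ordY_anti (by omega) h⟩

end Rational

section RationalInter

open Polynomial

/-- Polynomials as Laurent series in `x`. -/
noncomputable def polyLaurent : ℂ[X] →+* LaurentSeries ℂ :=
  (HahnSeries.ofPowerSeries ℤ ℂ).comp Polynomial.coeToPowerSeries.ringHom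

theorem polyLaurent_injective : Function.Injective polyLaurent :=
  HahnSeries.ofPowerSeries_injective.comp (Polynomial.coe_injective ℂ)

theorem polyLaurent_X : polyLaurent X = lx := by
  simp [polyLaurent, lx]

theorem polyLaurent_smul (c : ℂ) (P : ℂ[X]) : polyLaurent (c • P) = c • polyLaurent P := by
  rw [Polynomial.smul_eq_C_mul, map_mul, ← HahnSeries.C_mul_eq_smul]
  simp [polyLaurent]

theorem polyLaurent_one_add_X : polyLaurent (1 + X) = ly := by
  rw [map_add, map_one, polyLaurent_X, ly]

theorem polyLaurent_eq_sum (P : ℂ[X]) :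
    polyLaurent P = ∑ j ∈ Finset.range (P.natDegree + 1), P.coeff j • lx ^ (j : ℤ) := by
  conv_lhs => rw [P.as_sum_range]
  rw [map_sum]
  refine Finset.sum_congr rfl fun j _ => ?_
  rw [← Polynomial.smul_X_eq_monomial, polyLaurent_smul, map_pow, polyLaurent_X, zpow_natCast]

theorem exists_polyLaurent_of_mem_ordY {K : ℤ} {f : LaurentSeries ℂ} (hf : f ∈ ordY K) :
    ∃ (T : ℕ) (P : ℂ[X]), f * lx ^ T = ly ^ K * polyLaurent P := by
  induction hf using Submodule.span_induction with
  | zero => exact ⟨0, 0, by simp⟩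
  | add f g _ _ h1 h2 =>
    obtain ⟨T, P, h⟩ := h1
    obtain ⟨T', P', h'⟩ := h2
    refine ⟨T + T', P * X ^ T' + P' * X ^ T, ?_⟩
    simp only [map_add, map_mul, map_pow, polyLaurent_X]
    rw [pow_add]
    linear_combination lx ^ T' * h + lx ^ T * h'
  | smul c f _ h =>
    obtain ⟨T, P, h⟩ := h
    refine ⟨T, c • P, ?_⟩
    rw [laurent_smul_mul, h, polyLaurent_smul, laurent_mul_smul]
  | mem f hf =>
    obtain ⟨s, t, hs, rfl⟩ := hf
    refine ⟨t.natAbs, (1 + X) ^ (s - K).toNat * X ^ (t + t.natAbs).toNat, ?_⟩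
    rw [map_mul, map_pow, map_pow, polyLaurent_X, polyLaurent_one_add_X, ← zpow_natCast,
      ← zpow_natCast, ← zpow_natCast, ← mul_assoc, ← zpow_add₀ ly_ne_zero, mul_assoc,
      ← zpow_add₀ lx_ne_zero]
    congr 2 <;> omega

theorem exists_polyLaurent_of_mem_degLE {L : ℤ} {f : LaurentSeries ℂ} (hf : f ∈ degLE L) :
    ∃ (S T : ℕ) (Q : ℂ[X]), f * lx ^ T * ly ^ S = polyLaurent Q ∧
      (Q ≠ 0 → (Q.natDegree : ℤ) ≤ L + S + T) := by
  have hdeg : ∀ S : ℕ, ((1 + X : ℂ[X]) ^ S).natDegree = S := by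
    intro S
    rw [add_comm, ← map_one Polynomial.C, Polynomial.natDegree_pow,
      Polynomial.natDegree_X_add_C, mul_one]
  have hmul : ∀ (P : ℂ[X]) (S T : ℕ), (P * X ^ T * (1 + X) ^ S) ≠ 0 → P ≠ 0 ∧
      (P * X ^ T * (1 + X) ^ S).natDegree = P.natDegree + T + S := by
    intro P S T h
    have h1 := left_ne_zero_of_mul h
    rw [Polynomial.natDegree_mul h1 (right_ne_zero_of_mul h),
      Polynomial.natDegree_mul (left_ne_zero_of_mul h1) (right_ne_zero_of_mul h1), hdeg,
      Polynomial.natDegree_X_pow]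
    exact ⟨left_ne_zero_of_mul h1, rfl⟩
  have hle : ∀ (P : ℂ[X]) (N : ℤ), (P ≠ 0 → (P.natDegree : ℤ) ≤ N) ↔
      ∀ j : ℕ, N < j → P.coeff j = 0 := by
    intro P N
    constructor
    · intro h j hj
      by_cases hP : P = 0
      · simp [hP]
      · exact Polynomial.coeff_eq_zero_of_natDegree_lt (by have := h hP; omega)
    · intro h hP
      by_contra hc
      exact hP (Polynomial.leadingCoeff_eq_zero.1 (h _ (not_le.1 hc)))
  induction hf using Submodule.span_induction with
  | zero => exact ⟨0, 0, 0, by simp⟩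
  | add f g _ _ h1 h2 =>
    obtain ⟨S, T, P, h, hP⟩ := h1
    obtain ⟨S', T', P', h', hP'⟩ := h2
    refine ⟨S + S', T + T', P * X ^ T' * (1 + X) ^ S' + P' * X ^ T * (1 + X) ^ S, ?_, ?_⟩
    · simp only [map_add, map_mul, map_pow, polyLaurent_X, map_one]
      rw [pow_add, pow_add]
      have : (1 + lx) = ly := rfl
      rw [this]
      linear_combination lx ^ T' * ly ^ S' * h + lx ^ T * ly ^ S * h'
    · rw [hle]
      intro j hj
      rw [Polynomial.coeff_add, (hle _ (L + (S + S' : ℕ) + (T + T' : ℕ))).1 _ j hj,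
        (hle _ (L + (S + S' : ℕ) + (T + T' : ℕ))).1 _ j hj, add_zero]
      · intro h0
        obtain ⟨h1, h2⟩ := hmul _ _ _ h0
        have := hP' h1
        rw [h2]; push_cast; omega
      · intro h0
        obtain ⟨h1, h2⟩ := hmul _ _ _ h0
        have := hP h1
        rw [h2]; push_cast; omega
  | smul c f _ h =>
    obtain ⟨S, T, Q, h, hQ⟩ := h
    refine ⟨S, T, c • Q, ?_, ?_⟩
    · rw [laurent_smul_mul, laurent_smul_mul, h, polyLaurent_smul]
    · rw [hle] at hQ ⊢
      intro j hj
      rw [Polynomial.coeff_smul, hQ j hj, smul_zero]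
  | mem f hf =>
    obtain ⟨s, t, hs, rfl⟩ := hf
    refine ⟨s.natAbs, t.natAbs, 1 * X ^ (t + t.natAbs).toNat * (1 + X) ^ (s + s.natAbs).toNat,
      ?_, ?_⟩
    · rw [map_mul, map_mul, map_one, one_mul, map_pow, map_pow, polyLaurent_X,
        polyLaurent_one_add_X, ← zpow_natCast, ← zpow_natCast, ← zpow_natCast, ← zpow_natCast,
        mul_comm (lx ^ _), mul_assoc (ly ^ s), ← zpow_add₀ lx_ne_zero, mul_right_comm,
        ← zpow_add₀ ly_ne_zero]
      congr 2 <;> omega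
    · intro h0
      rw [(hmul _ _ _ h0).2, Polynomial.natDegree_one]
      omega

theorem mem_span_of_mem_ordY_of_mem_degLE {K L : ℤ} {f : LaurentSeries ℂ} (hK : f ∈ ordY K)
    (hL : f ∈ degLE L) :
    f ∈ Submodule.span ℂ {g | ∃ t : ℤ, K + t ≤ L ∧ g = ly ^ K * lx ^ t} := by
  obtain ⟨T, P, hP⟩ := exists_polyLaurent_of_mem_ordY hK
  obtain ⟨S, T', Q, hQ, hdQ⟩ := exists_polyLaurent_of_mem_degLE hL
  have hlx : lx ^ T ≠ 0 := pow_ne_zero _ lx_ne_zero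
  have hf : f = ly ^ K * lx ^ (-T : ℤ) * polyLaurent P := by
    rw [mul_right_comm, ← hP, zpow_neg, zpow_natCast, mul_assoc, mul_inv_cancel₀ hlx, mul_one]
  have hpoly : (1 + X) ^ (K + S + K.natAbs).toNat * X ^ T' * P =
      Q * X ^ T * (1 + X) ^ K.natAbs := by
    apply polyLaurent_injective
    simp only [map_mul, map_pow, polyLaurent_X, polyLaurent_one_add_X]
    rw [← hQ, ← zpow_natCast ly, show (((K + S + K.natAbs).toNat : ℕ) : ℤ) = K + S + K.natAbs by
      omega, zpow_add₀ ly_ne_zero, zpow_add₀ ly_ne_zero, zpow_natCast, zpow_natCast]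
    linear_combination (-(ly ^ S * ly ^ K.natAbs * lx ^ T')) * hP
  have hdeg : ∀ S : ℕ, ((1 + X : ℂ[X]) ^ S).natDegree = S := by
    intro S
    rw [add_comm, ← map_one Polynomial.C, Polynomial.natDegree_pow,
      Polynomial.natDegree_X_add_C, mul_one]
  have hne : ∀ S : ℕ, ((1 + X : ℂ[X]) ^ S) ≠ 0 := by
    intro S
    refine pow_ne_zero _ fun h => ?_
    have := congrArg Polynomial.natDegree h
    rw [add_comm, ← map_one Polynomial.C, Polynomial.natDegree_X_add_C] at this
    simp at this
  have hX : ∀ T : ℕ, (X : ℂ[X]) ^ T ≠ 0 := fun T => pow_ne_zero _ Polynomial.X_ne_zero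
  by_cases hP0 : P = 0
  · rw [hf, hP0]; simp
  have hQ0 : Q ≠ 0 := by
    rintro rfl
    rw [zero_mul, zero_mul] at hpoly
    exact mul_ne_zero (mul_ne_zero (hne _) (hX _)) hP0 hpoly
  have hd := congrArg Polynomial.natDegree hpoly
  rw [Polynomial.natDegree_mul (mul_ne_zero (hne _) (hX _)) hP0,
    Polynomial.natDegree_mul (hne _) (hX _),
    Polynomial.natDegree_mul (mul_ne_zero hQ0 (hX _)) (hne _),
    Polynomial.natDegree_mul hQ0 (hX _), hdeg, hdeg, Polynomial.natDegree_X_pow,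
    Polynomial.natDegree_X_pow] at hd
  have hb := hdQ hQ0
  rw [hf, polyLaurent_eq_sum, Finset.mul_sum]
  refine sum_mem fun j hj => ?_
  rw [laurent_mul_smul, mul_assoc, ← zpow_add₀ lx_ne_zero]
  refine Submodule.smul_mem _ _ (Submodule.subset_span ⟨_, ?_, rfl⟩)
  have := Finset.mem_range.1 hj
  omega

theorem coeff_neg_one_eq_zero {f : LaurentSeries ℂ} (h0 : f ∈ ordY 0) (h2 : f ∈ degLE (-2)) :
    f.coeff (-1) = 0 := by
  have := mem_span_of_mem_ordY_of_mem_degLE h0 h2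
  clear h0 h2
  induction this using Submodule.span_induction with
  | zero => simp
  | add f g _ _ h1 h2 => rw [HahnSeries.coeff_add, h1, h2, add_zero]
  | smul c f _ h => rw [HahnSeries.coeff_smul, h, smul_zero]
  | mem f hf =>
    obtain ⟨t, ht, rfl⟩ := hf
    rw [zpow_zero, one_mul, lx_zpow, HahnSeries.coeff_single_of_ne (by omega)]

end RationalInter

/-- `f` agrees with `κ y^m` to order `K` along `y` and has degree at most `L`. -/
structure Approx (κ : ℂ) (m K L : ℤ) (f : LaurentSeries ℂ) : Prop where
  deg : f ∈ degLE L
  ord : f - κ • ly ^ m ∈ ordY K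

namespace Approx

variable {κ κ' : ℂ} {m m' K K' L L' : ℤ} {f g : LaurentSeries ℂ}

theorem mono (h : Approx κ m K L f) (hK : K' ≤ K) (hL : L ≤ L') : Approx κ m K' L' f :=
  ⟨degLE_mono hL h.deg, ordY_anti hK h.ord⟩

theorem mem_ordY (h : Approx κ m K L f) (hK : K' ≤ K) (hm : K' ≤ m) : f ∈ ordY K' := by
  have := add_mem (ordY_anti hK h.ord) (Submodule.smul_mem _ κ (ly_zpow_mem_ordY hm))
  rwa [sub_add_cancel] at this

theorem exists_approx (m K L : ℤ) : ∃ f, Approx 1 m K L f := by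
  obtain ⟨f, hf, h⟩ := exists_mem_degLE_sub_mem_ordY m K L
  exact ⟨f, hf, by rwa [one_smul]⟩

theorem hasseDeriv (h : Approx κ m K L f) (i : ℕ) :
    Approx (κ * cbinom m i) (m - i) (K - i) (L - i) (LaurentSeries.hasseDeriv ℂ i f) := by
  refine ⟨hasseDeriv_mem_degLE h.deg i, ?_⟩
  have := hasseDeriv_mem_ordY h.ord i
  rwa [map_sub, map_smul, hasseDeriv_ly_zpow, smul_smul] at this

theorem mul (h : Approx κ m K L f) (h' : Approx κ' m' K L' g) (hm' : m' ≤ K) (hK : K' ≤ K + m')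
    (hK' : K' ≤ m + K) : Approx (κ * κ') (m + m') K' (L + L') (f * g) := by
  refine ⟨mul_mem_degLE h.deg h'.deg, ?_⟩
  have h1 := mul_mem_ordY h.ord (h'.mem_ordY hm' le_rfl)
  have h2 := Submodule.smul_mem _ κ (mul_mem_ordY (ly_zpow_mem_ordY (le_refl m)) h'.ord)
  have h3 := add_mem (ordY_anti hK h1) (ordY_anti hK' h2)
  convert h3 using 1
  rw [sub_mul, mul_sub, laurent_smul_mul, laurent_mul_smul, zpow_add₀ ly_ne_zero, mul_smul, smul_sub]
  abel

theorem ly_mul (h : Approx κ m K L f) (s : ℤ) : Approx κ (m + s) (K + s) (L + s) (ly ^ s * f) := by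
  refine ⟨?_, ?_⟩
  · rw [add_comm]
    exact mul_mem_degLE (ly_zpow_mem_degLE le_rfl) h.deg
  · have := mul_mem_ordY (ly_zpow_mem_ordY (le_refl s)) h.ord
    rw [mul_sub, laurent_mul_smul, ← zpow_add₀ ly_ne_zero] at this
    rwa [add_comm m, add_comm K]

end Approx

namespace VOA

variable (d : VOA V) {U : Type} [AddCommGroup U] [Module ℂ U]

/-- The functional `α` annihilates `a(f)` for `f` of high order along `y` and low degree. -/
def Kills (a : V) (K L : ℤ) (α : V →ₗ[ℂ] U) : Prop :=
  ∀ f ∈ ordY K, f ∈ degLE L → ∀ w, α (d.smear a f w) = 0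

variable {d} {a b : V} {K K' L L' m : ℤ} {α β : V →ₗ[ℂ] U}

theorem Kills.mono (h : d.Kills a K L α) (hK : K ≤ K') (hL : L' ≤ L) : d.Kills a K' L' α :=
  fun f hf hf' => h f (ordY_anti hK hf) (degLE_mono hL hf')

theorem Kills.add (h : d.Kills a K L α) (h' : d.Kills a K L β) : d.Kills a K L (α + β) :=
  fun f hf hf' w => by rw [LinearMap.add_apply, h f hf hf', h' f hf hf', add_zero]

theorem Kills.smul (c : ℂ) (h : d.Kills a K L α) : d.Kills a K L (c • α) :=
  fun f hf hf' w => by rw [LinearMap.smul_apply, h f hf hf', smul_zero]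

theorem Kills.vec_add (h : d.Kills a K L α) (h' : d.Kills b K L α) : d.Kills (a + b) K L α :=
  fun f hf hf' w => by
    rw [smear_add, LinearMap.add_apply, LinearMap.add_apply, map_add, h f hf hf', h' f hf hf',
      add_zero]

theorem Kills.vec_smul (c : ℂ) (h : d.Kills a K L α) : d.Kills (c • a) K L α :=
  fun f hf hf' w => by
    rw [smear_smul, LinearMap.smul_apply, LinearMap.smul_apply, map_smul, h f hf hf', smul_zero]

variable (d U) in
/-- The functionals on `V` that are annihilated to finite order by every vertex operator. -/
def coModule : Submodule ℂ (V →ₗ[ℂ] U) where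
  carrier := {α | ∀ a, ∃ K L, d.Kills a K L α}
  add_mem' := fun hα hβ a => by
    obtain ⟨K, L, h⟩ := hα a
    obtain ⟨K', L', h'⟩ := hβ a
    exact ⟨max K K', min L L', (h.mono (le_max_left _ _) (min_le_left _ _)).add
      (h'.mono (le_max_right _ _) (min_le_right _ _))⟩
  zero_mem' := fun _ => ⟨0, 0, fun _ _ _ _ => rfl⟩
  smul_mem' := fun c _ hα a => by
    obtain ⟨K, L, h⟩ := hα a
    exact ⟨K, L, h.smul c⟩

theorem exists_kills (n : ℕ) (c : ℕ → V) (β : ℕ → V →ₗ[ℂ] U) (hβ : ∀ i, β i ∈ d.coModule U) :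
    ∃ K L, ∀ i < n, d.Kills (c i) K L (β i) := by
  induction n with
  | zero => exact ⟨0, 0, fun i hi => absurd hi (by omega)⟩
  | succ n ih =>
    obtain ⟨K, L, h⟩ := ih
    obtain ⟨K', L', h'⟩ := hβ n (c n)
    refine ⟨max K K', min L L', fun i hi => ?_⟩
    rcases Nat.lt_succ_iff_lt_or_eq.1 hi with hi | rfl
    · exact (h i hi).mono (le_max_left _ _) (min_le_left _ _)
    · exact h'.mono (le_max_right _ _) (min_le_right _ _)

variable (d) in
open Classical in
/-- The mode `a_m α`, the pairing of `α` with `-a(f)` for any `f` approximating `y^m`. -/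
noncomputable def coMode (a : V) (m : ℤ) (α : V →ₗ[ℂ] U) : V →ₗ[ℂ] U :=
  if h : ∃ K L, d.Kills a K L α then
    -(α ∘ₗ d.smear a (Approx.exists_approx m h.choose h.choose_spec.choose).choose) else 0

theorem Kills.coMode_spec (h : d.Kills a K L α) {κ : ℂ} {f : LaurentSeries ℂ}
    (hf : Approx κ m K L f) (w : V) : α (d.smear a f w) = -(κ • d.coMode a m α w) := by
  have hex : ∃ K L, d.Kills a K L α := ⟨K, L, h⟩
  have hk := hex.choose_spec.choose_spec
  set K₀ := hex.choose
  set L₀ := hex.choose_spec.choose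
  set g := (Approx.exists_approx m K₀ L₀).choose with hg_def
  have hg : Approx 1 m K₀ L₀ g := (Approx.exists_approx m K₀ L₀).choose_spec
  have hval : d.coMode a m α = -(α ∘ₗ d.smear a g) := by
    rw [coMode, dif_pos hex]
  obtain ⟨f₀, hf₀⟩ := Approx.exists_approx m (max K K₀) (min L L₀)
  have h1 : α (d.smear a (f - κ • f₀) w) = 0 := by
    have hf₁ := hf₀.mono (le_max_left K K₀) (min_le_left L L₀)
    refine h _ ?_ (sub_mem hf.deg (Submodule.smul_mem _ _ hf₁.deg)) w
    have := sub_mem hf.ord (Submodule.smul_mem _ κ hf₁.ord)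
    convert this using 1
    module
  have h2 : α (d.smear a (g - f₀) w) = 0 := by
    have hf₁ := hf₀.mono (le_max_right K K₀) (min_le_right L L₀)
    refine hk _ ?_ (sub_mem hg.deg hf₁.deg) w
    simpa using sub_mem hg.ord hf₁.ord
  rw [map_sub, map_smul, LinearMap.sub_apply, LinearMap.smul_apply, map_sub, map_smul,
    sub_eq_zero] at h1
  rw [map_sub, LinearMap.sub_apply, map_sub, sub_eq_zero] at h2
  rw [h1, hval, ← h2]
  simp

theorem Kills.coMode_apply (h : d.Kills a K L α) {f : LaurentSeries ℂ}
    (hf : Approx 1 m K L f) (w : V) : d.coMode a m α w = -α (d.smear a f w) := by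
  rw [h.coMode_spec hf, one_smul, neg_neg]

theorem Kills.coMode_eq_zero (h : d.Kills a K L α) (hm : K ≤ m) : d.coMode a m α = 0 := by
  refine LinearMap.ext fun w => ?_
  rw [h.coMode_apply (f := 0) ⟨zero_mem _, ?_⟩]
  · simp
  · rw [one_smul, zero_sub]
    exact neg_mem (ly_zpow_mem_ordY hm)

theorem Kills.coMode_add (h : d.Kills a K L α) (h' : d.Kills a K L β) :
    d.coMode a m (α + β) = d.coMode a m α + d.coMode a m β := by
  obtain ⟨f, hf⟩ := Approx.exists_approx m K L
  refine LinearMap.ext fun w => ?_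
  rw [LinearMap.add_apply, h.coMode_apply hf, h'.coMode_apply hf, (h.add h').coMode_apply hf,
    LinearMap.add_apply, neg_add]

theorem Kills.coMode_smul (c : ℂ) (h : d.Kills a K L α) :
    d.coMode a m (c • α) = c • d.coMode a m α := by
  obtain ⟨f, hf⟩ := Approx.exists_approx m K L
  refine LinearMap.ext fun w => ?_
  rw [LinearMap.smul_apply, h.coMode_apply hf, (h.smul c).coMode_apply hf,
    LinearMap.smul_apply, smul_neg]

theorem Kills.coMode_vec_add (h : d.Kills a K L α) (h' : d.Kills b K L α) :
    d.coMode (a + b) m α = d.coMode a m α + d.coMode b m α := by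
  obtain ⟨f, hf⟩ := Approx.exists_approx m K L
  refine LinearMap.ext fun w => ?_
  rw [LinearMap.add_apply, h.coMode_apply hf, h'.coMode_apply hf, (h.vec_add h').coMode_apply hf,
    smear_add, LinearMap.add_apply, LinearMap.add_apply, map_add, neg_add]

theorem Kills.coMode_vec_smul (c : ℂ) (h : d.Kills a K L α) :
    d.coMode (c • a) m α = c • d.coMode a m α := by
  obtain ⟨f, hf⟩ := Approx.exists_approx m K L
  refine LinearMap.ext fun w => ?_
  rw [LinearMap.smul_apply, h.coMode_apply hf, (h.vec_smul c).coMode_apply hf,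
    smear_smul, LinearMap.smul_apply, LinearMap.smul_apply, map_smul, smul_neg]

theorem coMode_mem (a : V) (m : ℤ) (hα : α ∈ d.coModule U) : d.coMode a m α ∈ d.coModule U := by
  intro b
  obtain ⟨K, L, h⟩ := hα a
  obtain ⟨K', L', h'⟩ := hα b
  obtain ⟨f, hf⟩ := Approx.exists_approx m K L
  obtain ⟨n, hn⟩ := d.exists_nat_truncation a b 0
  simp only [zero_add] at hn
  obtain ⟨K'', L'', h''⟩ := exists_kills n (fun i => d.mode a i b) (fun _ => α) fun _ => hα
  have hf0 : f ∈ ordY (min K m) := hf.mem_ordY (min_le_left _ _) (min_le_right _ _)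
  refine ⟨max K' (K'' - min K m + n), min L' (L'' - L), fun g hg hg' w => ?_⟩
  have hcomm := d.smear_commutator a b w hn f g
  rw [h.coMode_apply hf, sub_eq_iff_eq_add.1 hcomm, map_add, map_sum,
    h' g (ordY_anti (le_max_left _ _) hg) (degLE_mono (min_le_left _ _) hg'), add_zero,
    Finset.sum_eq_zero, neg_zero]
  intro i hi
  have hi := Finset.mem_range.1 hi
  exact h'' i hi _ (ordY_anti (by omega) (mul_mem_ordY (hasseDeriv_mem_ordY hf0 i) hg))
    (degLE_mono (by omega) (mul_mem_degLE (hasseDeriv_mem_degLE hf.deg i) hg')) w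

theorem exists_kills_pair {a b : V} {α β : V →ₗ[ℂ] U} (hα : α ∈ d.coModule U)
    (hβ : β ∈ d.coModule U) : ∃ K L, d.Kills a K L α ∧ d.Kills b K L β := by
  obtain ⟨K, L, h⟩ := hα a
  obtain ⟨K', L', h'⟩ := hβ b
  exact ⟨max K K', min L L', h.mono (le_max_left _ _) (min_le_left _ _),
    h'.mono (le_max_right _ _) (min_le_right _ _)⟩

variable (d U) in
/-- The modes on `coModule`. -/
noncomputable def coModeMap : ModeMap d (d.coModule U) where
  act a m :=
    { toFun := fun α => ⟨d.coMode a m α, coMode_mem a m α.2⟩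
      map_add' := fun α β => Subtype.ext (by
        obtain ⟨K, L, h, h'⟩ := exists_kills_pair (a := a) (b := a) α.2 β.2
        exact h.coMode_add h')
      map_smul' := fun c α => Subtype.ext (by
        obtain ⟨K, L, h⟩ := α.2 a
        exact h.coMode_smul c) }
  act_add a b m := LinearMap.ext fun α => Subtype.ext (by
    obtain ⟨K, L, h, h'⟩ := exists_kills_pair (a := a) (b := b) α.2 α.2
    exact h.coMode_vec_add h')
  act_smul c a m := LinearMap.ext fun α => Subtype.ext (by
    obtain ⟨K, L, h⟩ := α.2 a
    exact h.coMode_vec_smul c)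
  truncation a α := by
    obtain ⟨K, L, h⟩ := α.2 a
    exact ⟨K, fun n hn => Subtype.ext (h.coMode_eq_zero hn)⟩

theorem coModeMap_act (a : V) (m : ℤ) (α : d.coModule U) :
    (((d.coModeMap U).act a m α : d.coModule U) : V →ₗ[ℂ] U) = d.coMode a m α := rfl

theorem coModeMap_conformal_zero (a : V) (n : ℤ) (α : d.coModule U) :
    (d.coModeMap U).act (d.mode d.conformal 0 a) n α =
      (-n : ℂ) • (d.coModeMap U).act a (n - 1) α := by
  refine Subtype.ext (LinearMap.ext fun w => ?_)
  obtain ⟨K, L, h, h'⟩ := exists_kills_pair (a := a) (b := d.mode d.conformal 0 a) α.2 α.2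
  obtain ⟨f, hf⟩ := Approx.exists_approx n (K + 1) L
  have hf' := (hf.hasseDeriv 1).mono (K' := K) (L' := L) (by push_cast; omega)
    (by push_cast; omega)
  rw [coModeMap_act, h'.coMode_apply (hf.mono (by omega) le_rfl), smear_conformal_zero,
    LinearMap.neg_apply, map_neg, neg_neg, h.coMode_spec (m := n - 1) (by exact_mod_cast hf')]
  simp [cbinom, coModeMap_act]

end VOA

theorem lx_eq_ly_sub_one : lx = ly - 1 := by
  unfold ly
  ring

theorem binomSum_zero (X : ℕ → M) : binomSum 0 X = X 0 := by
  unfold binomSum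
  rw [finsum_eq_single _ 0]
  · simp [cbinom_zero_right]
  · intro i hi
    simp [cbinom_zero_left, hi]

/-- Telescoping along `y - x = 1` for a bilinear map of Laurent series. -/
theorem sum_bilinear_telescope (Φ : LaurentSeries ℂ →ₗ[ℂ] LaurentSeries ℂ →ₗ[ℂ] M)
    (f g : LaurentSeries ℂ) (I J : ℕ)
    (h1 : ∀ j : ℕ, Φ (ly ^ (-(I : ℤ)) * (lx ^ (j : ℤ) * f))
      (ly ^ (I : ℤ) * (lx ^ (-1 - (j : ℤ)) * g)) = 0)
    (h2 : ∀ i < I, Φ (lx ^ (J : ℤ) * (ly ^ (-1 - (i : ℤ)) * f))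
      (lx ^ (-(J : ℤ)) * (ly ^ (i : ℤ) * g)) = 0) :
    ∑ i ∈ Finset.range I, Φ (ly ^ (-1 - (i : ℤ)) * f) (ly ^ (i : ℤ) * g) =
      -∑ j ∈ Finset.range J, Φ (lx ^ (j : ℤ) * f) (lx ^ (-1 - (j : ℤ)) * g) := by
  let A : ℕ → M := fun j => ∑ i ∈ Finset.range I,
    Φ (lx ^ (j : ℤ) * (ly ^ (-1 - (i : ℤ)) * f)) (lx ^ (-(j : ℤ)) * (ly ^ (i : ℤ) * g))
  have hstep : ∀ j, A (j + 1) - A j = Φ (lx ^ (j : ℤ) * f) (lx ^ (-1 - (j : ℤ)) * g) := by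
    intro j
    set F := lx ^ (j : ℤ) * f with hF
    set G := lx ^ (-1 - (j : ℤ)) * g with hG
    have e : ∀ i : ℕ, Φ (lx ^ ((j + 1 : ℕ) : ℤ) * (ly ^ (-1 - (i : ℤ)) * f))
        (lx ^ (-((j + 1 : ℕ) : ℤ)) * (ly ^ (i : ℤ) * g)) -
        Φ (lx ^ (j : ℤ) * (ly ^ (-1 - (i : ℤ)) * f)) (lx ^ (-(j : ℤ)) * (ly ^ (i : ℤ) * g)) =
        Φ (ly ^ (-(i : ℤ)) * F) (ly ^ (i : ℤ) * G) -
        Φ (ly ^ (-((i + 1 : ℕ) : ℤ)) * F) (ly ^ ((i + 1 : ℕ) : ℤ) * G) := by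
      intro i
      have e1 : lx ^ ((j + 1 : ℕ) : ℤ) * (ly ^ (-1 - (i : ℤ)) * f) =
          ly ^ (-(i : ℤ)) * F - ly ^ (-((i + 1 : ℕ) : ℤ)) * F := by
        have a1 : (-(i : ℤ)) = -1 - i + 1 := by ring
        have a2 : (-((i + 1 : ℕ) : ℤ)) = -1 - i := by push_cast; ring
        rw [hF, a1, a2, Nat.cast_succ, zpow_add_one₀ lx_ne_zero, zpow_add_one₀ ly_ne_zero,
          lx_eq_ly_sub_one]
        ring
      have e2 : lx ^ (-((j + 1 : ℕ) : ℤ)) * (ly ^ (i : ℤ) * g) = ly ^ (i : ℤ) * G := by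
        have a2 : (-((j + 1 : ℕ) : ℤ)) = -1 - j := by push_cast; ring
        rw [hG, a2]
        ring
      have e3 : lx ^ (j : ℤ) * (ly ^ (-1 - (i : ℤ)) * f) = ly ^ (-((i + 1 : ℕ) : ℤ)) * F := by
        have a2 : (-((i + 1 : ℕ) : ℤ)) = -1 - i := by push_cast; ring
        rw [hF, a2]
        ring
      have e4 : lx ^ (-(j : ℤ)) * (ly ^ (i : ℤ) * g) =
          ly ^ ((i + 1 : ℕ) : ℤ) * G - ly ^ (i : ℤ) * G := by
        have a1 : (-(j : ℤ)) = -1 - j + 1 := by ring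
        rw [hG, a1, Nat.cast_succ, zpow_add_one₀ lx_ne_zero, zpow_add_one₀ ly_ne_zero]
        conv_lhs => rw [lx_eq_ly_sub_one]
        rw [lx_eq_ly_sub_one]
        ring
      rw [e1, e2, e3, e4]
      simp only [map_sub, LinearMap.sub_apply]
      abel
    simp only [A]
    rw [← Finset.sum_sub_distrib, Finset.sum_congr rfl fun i _ => e i,
      Finset.sum_range_sub' (fun i : ℕ => Φ (ly ^ (-(i : ℤ)) * F) (ly ^ (i : ℤ) * G)) I, h1 j,
      sub_zero]
    simp
  have hJ : A J = 0 := Finset.sum_eq_zero fun i hi => h2 i (Finset.mem_range.1 hi)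
  have h0 : A 0 = ∑ i ∈ Finset.range I, Φ (ly ^ (-1 - (i : ℤ)) * f) (ly ^ (i : ℤ) * g) := by
    simp [A]
  have := Finset.sum_range_sub A J
  rw [hJ, h0, Finset.sum_congr rfl fun j _ => hstep j] at this
  rw [this]
  abel

namespace VOA

variable {d : VOA V} {U : Type} [AddCommGroup U] [Module ℂ U]

variable (d) in
theorem coModeMap_act_mem (a : V) (m : ℤ) (α : d.coModule U) :
    d.coMode a m (α : V →ₗ[ℂ] U) ∈ d.coModule U := coMode_mem a m α.2

theorem coModeMap_comm (p q : ℤ) (u v : V) (α : d.coModule U) :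
    (d.coModeMap U).BorcherdsAt p q 0 u v α := by
  obtain ⟨n, hn⟩ := d.exists_nat_truncation u v 0
  have hn' := hn
  simp only [zero_add] at hn'
  obtain ⟨K1, L1, h1, h2⟩ := exists_kills_pair (a := u) (b := v)
    (d.coModeMap_act_mem v q α) α.2
  obtain ⟨K2, L2, h3, h4⟩ := exists_kills_pair (a := v) (b := u)
    (d.coModeMap_act_mem u p α) α.2
  obtain ⟨K3, L3, h5⟩ := exists_kills n (fun i => d.mode u i v) (fun _ => α.1) fun _ => α.2
  obtain ⟨K, hK⟩ : ∃ K, K = |p| + |q| + |K1| + |K2| + |K3| + 2 * (n : ℤ) := ⟨_, rfl⟩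
  obtain ⟨L, hL⟩ : ∃ L, L = -|L1| - |L2| - |L3| := ⟨_, rfl⟩
  obtain ⟨f, hf⟩ := Approx.exists_approx p K L
  obtain ⟨g, hg⟩ := Approx.exists_approx q K L
  have := neg_abs_le p
  have := neg_abs_le q
  have := le_abs_self p
  have := le_abs_self q
  have := le_abs_self K1
  have := le_abs_self K2
  have := le_abs_self K3
  have := neg_abs_le L1
  have := neg_abs_le L2
  have := neg_abs_le L3
  have := abs_nonneg K1
  have := abs_nonneg K2
  have := abs_nonneg K3
  have := abs_nonneg L1
  have := abs_nonneg L2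
  have := abs_nonneg L3
  have hmul : ∀ i < n, Approx (cbinom p i) (p + q - i) K3 L3
      (LaurentSeries.hasseDeriv ℂ i f * g) := by
    intro i hi
    have h6 := (hf.hasseDeriv i).mono (K' := K - n) (L' := L) (by omega) (by omega)
    have h7 := hg.mono (K' := K - n) (L' := L) (by omega) le_rfl
    have h8 := (h6.mul h7 (K' := K3) (by omega) (by omega) (by omega)).mono le_rfl
      (L' := L3) (by omega)
    rw [one_mul, mul_one] at h8
    rwa [show p + q - i = p - i + q by ring]
  refine Subtype.ext (LinearMap.ext fun w => ?_)
  rw [binomSum_eq_sum_range p (n := n) (fun i hi => by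
    simp [ModeMap.iterTerm, hn' i hi, ModeMap.act_zero]), binomSum_zero, binomSum_zero]
  simp only [ModeMap.prodTerm, ModeMap.iterTerm, zpow_zero, pow_zero, one_smul, add_zero,
    Nat.cast_zero, sub_zero, zero_add]
  rw [Submodule.coe_sub, Submodule.coe_sum, LinearMap.sub_apply, LinearMap.sum_apply]
  simp only [Submodule.coe_smul, LinearMap.smul_apply, coModeMap_act]
  have e1 : d.coMode u p (d.coMode v q α) w = α.1 (d.smear v g (d.smear u f w)) := by
    rw [h1.coMode_apply (hf.mono (by omega) (by omega)),
      h2.coMode_apply (hg.mono (by omega) (by omega)), neg_neg]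
  have e2 : d.coMode v q (d.coMode u p α) w = α.1 (d.smear u f (d.smear v g w)) := by
    rw [h3.coMode_apply (hg.mono (by omega) (by omega)),
      h4.coMode_apply (hf.mono (by omega) (by omega)), neg_neg]
  have hcomm := congrArg α.1 (d.smear_commutator u v w hn' f g)
  rw [map_sub, map_sum] at hcomm
  rw [e1, e2, ← neg_sub, hcomm, ← Finset.sum_neg_distrib]
  refine Finset.sum_congr rfl fun i hi => ?_
  rw [(h5 i (Finset.mem_range.1 hi)).coMode_spec (hmul i (Finset.mem_range.1 hi)), neg_neg]

theorem coModeMap_prod (s : ℤ) (u v : V) (α : d.coModule U) :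
    ∃ p : ℤ, (d.coModeMap U).BorcherdsAt p (s - p) (-1) u v α := by
  obtain ⟨n, hn⟩ := d.exists_nat_truncation u v (-1)
  obtain ⟨p, L1, hu, hv⟩ := exists_kills_pair (a := u) (b := v) α.2 α.2
  refine ⟨p, ?_⟩
  obtain ⟨q, hq⟩ : ∃ q, q = s - p := ⟨_, rfl⟩
  rw [← hq]
  obtain ⟨I, hI⟩ : ∃ I, I = (p - q).toNat := ⟨_, rfl⟩
  obtain ⟨K2, L2, h2⟩ := exists_kills I (fun _ => u) (fun i => d.coMode v (q + i) α.1)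
    fun i => d.coModeMap_act_mem v (q + i) α
  obtain ⟨K3, L3, h3⟩ := exists_kills n (fun i => d.mode u (-1 + i) v) (fun _ => α.1) fun _ => α.2
  obtain ⟨K, hK⟩ : ∃ K, K = |p| + |q| + |K2| + |K3| + 2 * (n : ℤ) + I + 2 := ⟨_, rfl⟩
  obtain ⟨L, hL⟩ : ∃ L, L = -|L1| - |L2| - |L3| - I := ⟨_, rfl⟩
  obtain ⟨f, hf⟩ := Approx.exists_approx p K L
  obtain ⟨g, hg⟩ := Approx.exists_approx q K L
  have := neg_abs_le p
  have := neg_abs_le q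
  have := le_abs_self p
  have := le_abs_self q
  have := le_abs_self K2
  have := le_abs_self K3
  have := neg_abs_le L1
  have := neg_abs_le L2
  have := neg_abs_le L3
  have := abs_nonneg K2
  have := abs_nonneg K3
  have := abs_nonneg L1
  have := abs_nonneg L2
  have := abs_nonneg L3
  have hmul : ∀ i < n, Approx (cbinom p i) (p + q - i) K3 L3
      (LaurentSeries.hasseDeriv ℂ i f * g) := by
    intro i hi
    have h6 := (hf.hasseDeriv i).mono (K' := K - n) (L' := L) (by omega) (by omega)
    have h7 := hg.mono (K' := K - n) (L' := L) (by omega) le_rfl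
    have h8 := (h6.mul h7 (K' := K3) (by omega) (by omega) (by omega)).mono le_rfl
      (L' := L3) (by omega)
    rw [one_mul, mul_one] at h8
    rwa [show p + q - i = p - i + q by ring]
  have hfp : f ∈ ordY p := hf.mem_ordY (by omega) le_rfl
  have hgq : g ∈ ordY q := hg.mem_ordY (by omega) le_rfl
  have hlx : ∀ {t : ℤ} {h : LaurentSeries ℂ} {k m l : ℤ}, h ∈ ordY k → h ∈ degLE m → t + m ≤ l →
      lx ^ t * h ∈ ordY k ∧ lx ^ t * h ∈ degLE l := fun {t h k m l} h1 h2 h3 =>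
    ⟨by simpa using mul_mem_ordY (lx_zpow_mem_ordY t (le_refl (0 : ℤ))) h1,
      degLE_mono h3 (mul_mem_degLE (lx_zpow_mem_degLE le_rfl) h2)⟩
  refine Subtype.ext (LinearMap.ext fun w => ?_)
  let Φ : LaurentSeries ℂ →ₗ[ℂ] LaurentSeries ℂ →ₗ[ℂ] U := LinearMap.mk₂ ℂ
    (fun F G => α.1 (d.smear v G (d.smear u F w)))
    (fun F F' G => by simp) (fun c F G => by simp) (fun F G G' => by simp) (fun c F G => by simp)
  have hΦ : ∀ F G, Φ F G = α.1 (d.smear v G (d.smear u F w)) := fun _ _ => rfl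
  obtain ⟨N, hN⟩ := d.exists_smear_eq_zero u w
  choose Nf hNf using fun i : ℕ => exists_mem_ordGE (ly ^ (-1 - (i : ℤ)) * f)
  obtain ⟨N0, hN0⟩ := exists_mem_ordGE f
  obtain ⟨J, hJ⟩ : ∃ J, J = ∑ i ∈ Finset.range I, (N - Nf i).toNat + (N - N0).toNat := ⟨_, rfl⟩
  have htel := sum_bilinear_telescope Φ f g I J (fun j => by
    rw [hΦ, mul_left_comm]
    obtain ⟨h4, h5⟩ := hlx (t := -1 - (j : ℤ)) (l := L1) (mul_mem_ordY
      (ly_zpow_mem_ordY (le_refl (I : ℤ))) hgq) (mul_mem_degLE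
        (ly_zpow_mem_degLE (le_refl (I : ℤ))) hg.deg) (by omega)
    exact hv _ (ordY_anti (by omega) h4) h5 _) (fun i hi => by
    rw [hΦ, hN, map_zero, map_zero]
    have := Finset.single_le_sum (f := fun i => (N - Nf i).toNat) (fun _ _ => Nat.zero_le _)
      (Finset.mem_range.2 hi)
    exact ordGE_anti (by omega) (lx_zpow_mul_mem_ordGE (hNf i) J))
  have hfirst : α.1 (d.prodSmear u v w f g) = 0 := by
    rw [prodSmear_apply, EvZero.map_finsum]
    · refine finsum_eq_zero_of_forall_eq_zero fun i => ?_
      obtain ⟨h4, h5⟩ := hlx (t := -1 - (i : ℤ)) (l := L1) hfp hf.deg (by omega)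
      exact hu _ h4 h5 _
    · obtain ⟨A, hA⟩ := d.evZero_smear_lx v w g
      exact ⟨A, fun i hi => (congrArg _ (hA i hi)).trans (map_zero _)⟩
  have hsecond : α.1 (d.prodSmear v u w g f) =
      ∑ j ∈ Finset.range J, Φ (lx ^ (j : ℤ) * f) (lx ^ (-1 - (j : ℤ)) * g) := by
    rw [prodSmear_apply, finsum_eq_sum_range (n := J), map_sum]
    · rfl
    · intro j hj
      rw [hN, map_zero]
      exact ordGE_anti (by omega) (lx_zpow_mul_mem_ordGE hN0 j)
  have hit := congrArg α.1 (d.smear_iterate u v w hn f g)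
  rw [map_sum, map_add, hfirst, hsecond, zero_add] at hit
  rw [binomSum_eq_sum_range p (n := n) (fun i hi => by
    simp [ModeMap.iterTerm, hn i hi, ModeMap.act_zero]),
    binomSum_eq_sum_range (-1) (n := I) (fun i hi => ?_),
    binomSum_eq_sum_range (-1) (n := 0) (fun i _ => ?_)]
  · rw [Finset.sum_range_zero, smul_zero, sub_zero, Submodule.coe_sum, Submodule.coe_sum,
      LinearMap.sum_apply, LinearMap.sum_apply]
    have e1 : ∀ i ∈ Finset.range I, ((cbinom (-1) i •
        (d.coModeMap U).prodTerm u v α (p + -1) q i : d.coModule U) : V →ₗ[ℂ] U) w =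
        Φ (ly ^ (-1 - (i : ℤ)) * f) (ly ^ (i : ℤ) * g) := by
      intro i hi
      have hi := Finset.mem_range.1 hi
      rw [ModeMap.prodTerm, smul_smul, cbinom_neg_one, ← mul_pow, neg_one_mul, neg_neg, one_pow,
        one_smul, coModeMap_act, coModeMap_act,
        (h2 i hi).coMode_apply (f := ly ^ (-1 - (i : ℤ)) * f), hv.coMode_apply (f := ly ^ (i : ℤ) * g), neg_neg, hΦ]
      · exact (hg.ly_mul i).mono (by omega) (by omega)
      · have := (hf.ly_mul (-1 - (i : ℤ))).mono (K' := K2) (L' := L2) (by omega) (by omega)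
        rwa [show p + (-1 - (i : ℤ)) = p + -1 - i by ring] at this
    rw [Finset.sum_congr rfl e1, htel, ← hit, ← Finset.sum_neg_distrib]
    refine Finset.sum_congr rfl fun i hi => ?_
    rw [(h3 i (Finset.mem_range.1 hi)).coMode_spec (hmul i (Finset.mem_range.1 hi)), neg_neg]
    rfl
  · rw [ModeMap.prodTerm, show (d.coModeMap U).act u (p + i) α = 0 from
      Subtype.ext (hu.coMode_eq_zero (by omega)), map_zero, smul_zero]
  · rw [ModeMap.prodTerm, show (d.coModeMap U).act v (q + i) α = 0 from
      Subtype.ext (hv.coMode_eq_zero (by omega)), map_zero, smul_zero]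

theorem coModeMap_borcherdsAt (p q r : ℤ) (u v : V) (α : d.coModule U) :
    (d.coModeMap U).BorcherdsAt p q r u v α :=
  (d.coModeMap U).borcherdsAt_of_comm coModeMap_conformal_zero
    coModeMap_comm coModeMap_prod p q r u v α

end VOA

namespace VOA

variable {d : VOA V} {U : Type} [AddCommGroup U] [Module ℂ U]

theorem smear_vacuum (f : LaurentSeries ℂ) (w : V) :
    d.smear d.vacuum f w = f.coeff (-1) • w := by
  rw [smear_apply, finsum_eq_single _ (-1)]
  · rw [d.vacuum_mode, if_pos rfl]
  · intro j hj
    rw [d.vacuum_mode, if_neg hj, smul_zero]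

theorem kills_vacuum (α : V →ₗ[ℂ] U) : d.Kills d.vacuum 0 (-2) α := fun f hf hf' w => by
  rw [smear_vacuum, coeff_neg_one_eq_zero hf hf', zero_smul, map_zero]

theorem coMode_vacuum (n : ℤ) (α : V →ₗ[ℂ] U) :
    d.coMode d.vacuum n α = if n = -1 then α else 0 := by
  rcases lt_trichotomy n (-1) with h | rfl | h
  · rw [if_neg h.ne]
    refine LinearMap.ext fun w => ?_
    rw [(kills_vacuum α).coMode_apply (f := ly ^ n), smear_vacuum,
      coeff_ly_zpow_of_neg n (by norm_num), zero_smul, map_zero, neg_zero, LinearMap.zero_apply]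
    exact ⟨ly_zpow_mem_degLE (by omega), by simp⟩
  · rw [if_pos rfl]
    refine LinearMap.ext fun w => ?_
    rw [(kills_vacuum α).coMode_apply (f := -(ly ^ (-1 : ℤ) * lx ^ (-1 : ℤ))), smear_vacuum]
    · have h0 := coeff_ly_zpow (-1) 0
      rw [cbinom_zero_right, Nat.cast_zero] at h0
      rw [HahnSeries.coeff_neg, mul_comm, coeff_lx_zpow_mul, sub_self, h0, neg_one_smul, map_neg,
        neg_neg]
    · refine ⟨neg_mem (ly_mul_lx_mem_degLE (by norm_num)), ?_⟩
      have h1 : -(ly ^ (-1 : ℤ) * lx ^ (-1 : ℤ)) - (1 : ℂ) • ly ^ (-1 : ℤ) = -lx ^ (-1 : ℤ) := by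
        have hx := lx_ne_zero
        have hy := ly_ne_zero
        rw [one_smul, zpow_neg_one, zpow_neg_one]
        field_simp
        rw [lx_eq_ly_sub_one]
        ring
      rw [h1]
      exact neg_mem (lx_zpow_mem_ordY _ le_rfl)
  · rw [if_neg h.ne', (kills_vacuum α).coMode_eq_zero (by omega)]

variable (d U) in
/-- The weak module structure on `coModule`. -/
noncomputable def coWeakMod : WeakMod d (d.coModule U) where
  act := (d.coModeMap U).act
  act_add := (d.coModeMap U).act_add
  act_smul := (d.coModeMap U).act_smul
  truncation := (d.coModeMap U).truncation
  vacuum_act α n := Subtype.ext (by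
    rw [coModeMap_act, coMode_vacuum]
    split_ifs <;> rfl)
  borcherds p q r u v α :=
    ((d.coModeMap U).borcherdsAt_iff p q r u v α).1 (coModeMap_borcherdsAt p q r u v α)

end VOA

theorem sum_cbinom_mul_cbinom (s N : ℤ) (k : ℕ) :
    ∑ j ∈ Finset.range (k + 1), (-1) ^ j * cbinom s j * cbinom (N - j) (k - j) =
      cbinom (N - s) k := by
  rw [show N - s = -(s - N) by ring, cbinom_neg, show s - N + k - 1 = s + (k - N - 1) by ring,
    cbinom_add, Finset.mul_sum,
    Finset.Nat.sum_antidiagonal_eq_sum_range_succ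
      (fun i j => (-1) ^ k * (cbinom s i * cbinom (k - N - 1) j))]
  refine Finset.sum_congr rfl fun j hj => ?_
  have hj : j ≤ k := Nat.lt_succ_iff.1 (Finset.mem_range.1 hj)
  have e : (-1 : ℂ) ^ k = (-1) ^ j * (-1) ^ (k - j) := by rw [← pow_add, Nat.add_sub_cancel' hj]
  rw [show N - j = -(j - N) by ring, cbinom_neg, e, Nat.cast_sub hj,
    show (j : ℤ) - N + (k - j) - 1 = k - N - 1 by ring]
  ring

namespace VOA

variable {d : VOA V} {U : Type} [AddCommGroup U] [Module ℂ U]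

theorem mode_conformal_zero_mem {r : ℤ} {a : V} (ha : a ∈ d.grading r) :
    d.mode d.conformal 0 a ∈ d.grading (r + 1) := by
  have := d.grading_mode 2 r 0 _ _ d.conformal_mem ha
  rwa [show 2 + r - 0 - 1 = r + 1 by ring] at this

theorem hres_mem_Ozhu (b : V) (t : ℕ) : ∀ {r : ℤ} {a : V}, a ∈ d.grading r →
    d.hres r (t + 2) a b ∈ d.Ozhu := by
  induction t with
  | zero =>
    intro r a ha
    rw [Nat.cast_zero, zero_add, ← d.circ_of_mem ha]
    exact Submodule.subset_span ⟨a, b, rfl⟩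
  | succ t ih =>
    intro r a ha
    have h1 := ih (mode_conformal_zero_mem ha)
    have h2 := ih ha
    rw [← neg_neg ((t : ℤ) + 2), ← smear_lx_zpow_mul_ly_zpow] at h1 h2
    rw [← neg_neg (((t + 1 : ℕ) : ℤ) + 2), ← smear_lx_zpow_mul_ly_zpow]
    have e : ly ^ (r + 1) * lx ^ (-((t : ℤ) + 2) - 1) =
        lx ^ (-((t : ℤ) + 2)) * ly ^ r + lx ^ (-(((t + 1 : ℕ) : ℤ) + 2)) * ly ^ r := by
      have a1 : -(((t + 1 : ℕ) : ℤ) + 2) = -((t : ℤ) + 2) - 1 := by push_cast; ring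
      have a2 : lx ^ (-((t : ℤ) + 2)) = lx ^ (-((t : ℤ) + 2) - 1) * lx := by
        rw [← zpow_add_one₀ lx_ne_zero, sub_add_cancel]
      rw [a1, a2, zpow_add_one₀ ly_ne_zero, lx_eq_ly_sub_one]
      ring
    rw [smear_conformal_zero, mul_comm, hasseDeriv_one_ly_mul_lx, e, add_sub_cancel_right, map_add,
      map_smul, map_smul, map_add, LinearMap.neg_apply, LinearMap.add_apply,
      LinearMap.smul_apply, LinearMap.smul_apply, LinearMap.add_apply, mul_comm (ly ^ r)] at h1
    have h3 := Submodule.smul_mem _ (((t : ℂ) + 2)⁻¹)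
      (add_mem h1 (Submodule.smul_mem _ ((r + 1 : ℂ) - (t + 2)) h2))
    convert h3 using 1
    have ht : (t : ℂ) + 2 ≠ 0 := by exact_mod_cast (by omega : t + 2 ≠ 0)
    rw [eq_inv_smul_iff₀ ht]
    push_cast
    module

theorem smear_mem_Ozhu {r : ℤ} {a : V} (ha : a ∈ d.grading r) (b : V) {f : LaurentSeries ℂ}
    (hf : f ∈ ordY r) (hf' : f ∈ degLE (r - 2)) : d.smear a f b ∈ d.Ozhu := by
  have h := mem_span_of_mem_ordY_of_mem_degLE hf hf'
  clear hf hf'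
  induction h using Submodule.span_induction with
  | mem g hg =>
    obtain ⟨t, ht, rfl⟩ := hg
    obtain ⟨k, hk⟩ := Int.eq_ofNat_of_zero_le (show 0 ≤ -t - 2 by omega)
    rw [mul_comm, smear_lx_zpow_mul_ly_zpow, show -t = (k : ℤ) + 2 by omega]
    exact hres_mem_Ozhu b k ha
  | zero => simp
  | add f g _ _ hf hg => simpa using add_mem hf hg
  | smul c f _ hf => simpa using Submodule.smul_mem _ c hf

theorem mode_neg_two_vacuum (w : V) : d.mode w (-2) d.vacuum = d.mode d.conformal 0 w := by
  have h1 := d.creation_neg_one (d.mode d.conformal 0 w)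
  rw [Lneg1_deriv] at h1
  simpa using h1

theorem conformal_add_mem_Ozhu (w : V) :
    d.mode d.conformal 0 w + d.mode d.conformal 1 w ∈ d.Ozhu := by
  refine homogeneous_induction d.internal
    (p := fun w => d.mode d.conformal 0 w + d.mode d.conformal 1 w ∈ d.Ozhu) ?_ ?_ ?_ w
  · intro r w hw
    have h := hres_mem_Ozhu d.vacuum 0 hw
    rw [hres_eq, binomSum_eq_sum_range (n := 2), Finset.sum_range_succ, Finset.sum_range_one] at h
    · rw [d.L0_eigen r w hw, ← mode_neg_two_vacuum]
      have e : d.mode w (-1) d.vacuum = w := d.creation_neg_one w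
      simpa [cbinom, e] using h
    · intro i hi
      exact d.creation _ _ (by push_cast; omega)
  · simp
  · intro x y hx hy
    rw [map_add, map_add, add_add_add_comm]
    exact add_mem hx hy

variable {χ : V →ₗ[ℂ] U}

theorem map_mode_vacuum_of_eigen {n : ℤ} (hχ : ∀ w, χ (d.mode d.conformal 0 w +
    d.mode d.conformal 1 w) = (-n : ℂ) • χ w) (i : ℕ) : ∀ {h : ℤ} {x : V},
    x ∈ d.grading h → χ (d.mode x (-1 - i) d.vacuum) = cbinom (-(h + n)) i • χ x := by
  induction i with
  | zero =>
    intro h x _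
    rw [Nat.cast_zero, sub_zero, d.creation_neg_one, cbinom_zero_right, one_smul]
  | succ i ih =>
    intro h x hx
    have h1 := ih (mode_conformal_zero_mem hx)
    rw [Lneg1_deriv, LinearMap.smul_apply, map_smul] at h1
    have h2 := hχ x
    rw [d.L0_eigen h x hx, map_add, map_smul, ← eq_sub_iff_add_eq] at h2
    have hi : (i : ℂ) + 1 ≠ 0 := Nat.cast_add_one_ne_zero i
    have h3 := mul_cbinom_pred (-(h + n)) i
    have e1 : (-1 - ((i + 1 : ℕ) : ℤ)) = -1 - i - 1 := by push_cast; ring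
    rw [e1, ← sub_eq_zero]
    refine (smul_eq_zero.1 ?_).resolve_left hi
    rw [h2, show -(h + 1 + n) = -(h + n) - 1 by ring] at h1
    rw [smul_sub, smul_smul, mul_comm, ← h3, sub_eq_zero]
    push_cast at h1 ⊢
    linear_combination (norm := module) h1

theorem map_mode_vacuum (hχ : ∀ w ∈ d.Ozhu, χ w = 0) (i : ℕ) {h : ℤ} {x : V}
    (hx : x ∈ d.grading h) : χ (d.mode x (-1 - i) d.vacuum) = cbinom (-h) i • χ x := by
  have := map_mode_vacuum_of_eigen (n := 0) (χ := χ)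
    (fun w => by simp [hχ _ (conformal_add_mem_Ozhu w)]) i hx
  rwa [add_zero] at this

theorem map_mode_swap (hχ : ∀ w ∈ d.Ozhu, χ w = 0) {r s : ℤ} {a b : V} (ha : a ∈ d.grading r)
    (hb : b ∈ d.grading s) (j : ℕ) {m : ℕ} (hm : ∀ i : ℕ, m ≤ i → d.mode a (-1 + j + i) b = 0) :
    χ (d.mode b (-1 + j) a) = (-1 : ℂ) ^ j • ∑ i ∈ Finset.range m,
      cbinom (r + s - 1 - j) i • χ (d.mode a (-1 + j + i) b) := by
  have h := d.borcherds (-1) 0 (-1 + j) a b d.vacuum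
  rw [finsum_eq_sum_range (n := m) fun i hi => by rw [hm i hi, ← smear_lx_zpow, smear_zero]; simp,
    finsum_eq_sum_range (n := 1) fun i hi => ?_, Finset.sum_range_one] at h
  · rw [d.creation b _ (by simp)] at h
    simp only [Nat.cast_zero, add_zero, zero_add, sub_zero, d.creation_neg_one, cbinom_zero_right,
      map_zero, zero_sub, pow_zero, one_smul, mul_one] at h
    have h' := congrArg χ h
    have e : (-1 : ℂ) ^ (-1 + (j : ℤ)) = -(-1) ^ j := by
      rw [zpow_add₀ (by norm_num), zpow_natCast]
      simp
    rw [e, map_neg, map_smul, neg_smul, neg_neg, map_sum] at h'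
    have hs : χ (d.mode b (-1 + j) a) = (-1 : ℂ) ^ j • (-1 : ℂ) ^ j • χ (d.mode b (-1 + j) a) := by
      rw [smul_smul, ← mul_pow]
      simp
    rw [hs, ← h']
    congr 1
    refine Finset.sum_congr rfl fun i _ => ?_
    rw [map_smul, map_mode_vacuum hχ i (d.grading_mode r s (-1 + j + i) a b ha hb), smul_smul,
      cbinom_neg_one, cbinom_neg, ← mul_assoc, ← mul_pow]
    norm_num
    ring_nf
  · rw [d.creation b _ (by simp), d.creation a _ (by omega)]
    simp

theorem map_hres_eq_map_star (hχ : ∀ w ∈ d.Ozhu, χ w = 0) {r s : ℤ} {a b : V}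
    (ha : a ∈ d.grading r) (hb : b ∈ d.grading s) :
    χ (d.hres (r - 1) 1 a b) = χ (d.star b a) := by
  obtain ⟨n, hn⟩ := d.exists_nat_truncation a b (-1)
  obtain ⟨n', hn'⟩ := d.exists_nat_truncation b a (-1)
  obtain ⟨m, hm, hm'⟩ : ∃ m, n ≤ m ∧ n' ≤ m := ⟨max n n', le_max_left _ _, le_max_right _ _⟩
  rw [d.star_of_mem hb, hres_eq, hres_eq,
    binomSum_eq_sum_range (n := m) _ fun i hi => hn i (hm.trans hi),
    binomSum_eq_sum_range (n := m) _ fun i hi => hn' i (hm'.trans hi), map_sum, map_sum]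
  set X : ℕ → U := fun k => χ (d.mode a (-1 + k) b) with hX
  have hX0 : ∀ k, m ≤ k → X k = 0 := fun k hk => by
    have := hn k (hm.trans hk)
    simp only at this
    rw [hX]
    simp only [this, map_zero]
  have e : ∀ j ∈ Finset.range m, χ (cbinom s j • d.mode b (-1 + j) a) =
      ∑ i ∈ Finset.range (m - j),
        ((-1) ^ j * cbinom s j * cbinom (r + s - 1 - j) i) • X (j + i) := by
    intro j _
    rw [map_smul, map_mode_swap hχ ha hb j (m := m - j), smul_smul, Finset.smul_sum]
    · refine Finset.sum_congr rfl fun i _ => ?_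
      rw [hX, smul_smul]
      push_cast
      rw [add_assoc, mul_comm (cbinom s j)]
    · intro i hi
      have := hn (j + i) (by omega)
      push_cast at this
      rwa [add_assoc]
  rw [Finset.sum_congr rfl e, ← Finset.sum_range_diag_flip m fun j i =>
    ((-1) ^ j * cbinom s j * cbinom (r + s - 1 - j) i) • X (j + i)]
  refine Finset.sum_congr rfl fun k _ => ?_
  rw [map_smul, show r - 1 = r + s - 1 - s by ring, ← sum_cbinom_mul_cbinom, Finset.sum_smul]
  refine Finset.sum_congr rfl fun j hj => ?_
  rw [Nat.add_sub_cancel' (Nat.lt_succ_iff.1 (Finset.mem_range.1 hj))]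

end VOA

namespace VOA

variable {d : VOA V} {U : Type} [AddCommGroup U] [Module ℂ U] {α : V →ₗ[ℂ] U}

/-- The operator `L(-1) + L(0)`. -/
noncomputable def euler (d : VOA V) : Module.End ℂ V :=
  d.mode d.conformal 0 + d.mode d.conformal 1

theorem smear_conformal_ly : d.smear d.conformal ly = d.euler := by
  rw [show ly = lx ^ (0 : ℤ) + lx ^ (1 : ℤ) by simp [ly], map_add, smear_lx_zpow, smear_lx_zpow,
    euler]

theorem euler_smear {r : ℤ} {a : V} (ha : a ∈ d.grading r) (g : LaurentSeries ℂ) (w : V) :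
    d.euler (d.smear a g w) = d.smear a g (d.euler w) + ((r : ℂ) - 1) • d.smear a g w -
      d.smear a (ly ^ (1 : ℤ) * LaurentSeries.hasseDeriv ℂ 1 g) w := by
  obtain ⟨n, hn⟩ := d.exists_nat_truncation d.conformal a 0
  simp only [zero_add] at hn
  have h := d.smear_commutator d.conformal a w (n := n + 2) (fun i hi => hn i (by omega)) ly g
  have hD (i : ℕ) : LaurentSeries.hasseDeriv ℂ i ly = cbinom 1 i • ly ^ ((1 : ℤ) - i) := by
    rw [← hasseDeriv_ly_zpow, zpow_one]
  have hD0 : LaurentSeries.hasseDeriv ℂ 0 ly = ly := by simp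
  have hD1 : LaurentSeries.hasseDeriv ℂ 1 ly = 1 := by simp [hD, cbinom]
  rw [smear_conformal_ly, Finset.sum_range_succ', Finset.sum_range_succ', Finset.sum_eq_zero,
    zero_add, hD0] at h
  · simp only [zero_add, hD1, one_mul, Nat.cast_one, Nat.cast_zero] at h
    rw [d.L0_eigen r a ha, smear_conformal_zero, smear_smul, hasseDeriv_one_mul, hD1, one_mul,
      map_add, sub_eq_iff_eq_add] at h
    rw [h, zpow_one]
    simp only [LinearMap.add_apply, LinearMap.neg_apply, LinearMap.smul_apply]
    module
  · intro i _
    rw [hD, cbinom_eq_zero_of_lt (by norm_num) (by push_cast; omega), laurent_zero_smul, zero_mul,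
      map_zero, LinearMap.zero_apply]

variable (d U) in
/-- The functionals of degree `n` for the grading dual to `L(-1) + L(0)`. -/
noncomputable def coGr (n : ℤ) : Submodule ℂ (V →ₗ[ℂ] U) :=
  Module.End.eigenspace (LinearMap.lcomp ℂ U d.euler) (-n : ℂ)

theorem mem_coGr_iff {n : ℤ} : α ∈ d.coGr U n ↔ ∀ w, α (d.euler w) = (-n : ℂ) • α w := by
  rw [coGr, Module.End.mem_eigenspace_iff, LinearMap.ext_iff]
  rfl

theorem iSupIndep_coGr : iSupIndep (d.coGr U) :=
  (Module.End.eigenspaces_iSupIndep (LinearMap.lcomp ℂ U d.euler)).comp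
    (f := fun n : ℤ => (-n : ℂ)) fun m n h => by simpa using h

theorem coMode_mem_coGr {r m n : ℤ} {a : V} (ha : a ∈ d.grading r) (hα : α ∈ d.coModule U)
    (hn : α ∈ d.coGr U n) : d.coMode a m α ∈ d.coGr U (r + n - m - 1) := by
  rw [mem_coGr_iff] at hn ⊢
  intro w
  obtain ⟨K, L, h⟩ := hα a
  obtain ⟨f, hf⟩ := Approx.exists_approx m K L
  have hf' := ((hf.hasseDeriv 1).ly_mul 1).mono (K' := K) (L' := L) (by push_cast; omega)
    (by push_cast; omega)
  rw [show m - (1 : ℕ) + 1 = m by push_cast; ring] at hf'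
  have h1 := congrArg α (euler_smear ha f w)
  rw [hn, map_sub, map_add, map_smul, h.coMode_spec hf', h.coMode_spec hf, h.coMode_spec hf] at h1
  have hc : cbinom m 1 = m := by simp [cbinom]
  rw [hc] at h1
  push_cast
  linear_combination (norm := module) h1

theorem Kills.descend {a : V} {K L m : ℤ} (h : d.Kills a K L α)
    (h0 : ∀ j, m ≤ j → d.coMode a j α = 0) : d.Kills a m L α := by
  have key : ∀ k : ℕ, d.Kills a (m + k) L α → d.Kills a m L α := by
    intro k
    induction k with
    | zero => simp
    | succ k ih =>
      refine fun h => ih fun f hf hf' w => ?_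
      obtain ⟨c, hc⟩ := exists_sub_smul_mem_ordY hf
      rw [Kills.coMode_spec h ⟨hf', by rwa [Nat.cast_succ, ← add_assoc]⟩, h0 _ (by omega)]
      simp
  exact key (K - m).toNat (h.mono (by omega) le_rfl)

theorem eq_zero_of_coMode_eq_zero {n : ℤ} (hα : α ∈ d.coModule U) (hn : α ∈ d.coGr U n)
    (h : ∀ r, ∀ a ∈ d.grading r, ∀ m, r - 1 + n ≤ m → d.coMode a m α = 0) : α = 0 := by
  refine LinearMap.ext fun a => ?_
  refine homogeneous_induction d.internal (p := fun a => α a = 0) ?_ (map_zero _)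
    (fun x y hx hy => by rw [map_add, hx, hy, add_zero]) a
  intro r a ha
  obtain ⟨K, L, hk⟩ := hα a
  replace hk := hk.descend (h r a ha)
  obtain ⟨t, ht⟩ : ∃ t : ℕ, r - 1 + n - (t + 1) ≤ L := ⟨(r - 1 + n - L).toNat, by omega⟩
  have h0 := hk _ (ly_mul_lx_mem_ordY (-(t + 1)) le_rfl)
    (ly_mul_lx_mem_degLE (by omega)) d.vacuum
  rw [mul_comm, smear_lx_zpow_mul_ly_zpow, neg_neg, hres_eq,
    binomSum_eq_sum_range (n := t + 1) _ fun i hi => d.creation a _ (by omega), map_sum] at h0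
  have h1 : ∀ i ∈ Finset.range (t + 1),
      α (cbinom (r - 1 + n) i • d.mode a (-(t + 1) + i) d.vacuum) =
        (cbinom (r - 1 + n) i * cbinom (-(r + n)) (t - i)) • α a := by
    intro i hi
    have hi := Finset.mem_range.1 hi
    rw [map_smul, mul_smul, ← map_mode_vacuum_of_eigen (mem_coGr_iff.1 hn) (t - i) ha]
    congr 3
    congr 1
    omega
  rw [Finset.sum_congr rfl h1, ← Finset.sum_smul, ← Finset.Nat.sum_antidiagonal_eq_sum_range_succ
    (fun i j => cbinom (r - 1 + n) i * cbinom (-(r + n)) j), ← cbinom_add,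
    show r - 1 + n + -(r + n) = -1 by ring, cbinom_neg_one] at h0
  exact (smul_eq_zero.1 h0).resolve_left (pow_ne_zero _ (by norm_num))

end VOA

namespace RepOf

variable {d : VOA V} {U : Type} [AddCommGroup U] [Module ℂ U]
  (Z : RepOf d.Ozhu d.star d.vacuum U)

theorem kills_flip {r : ℤ} {a : V} (ha : a ∈ d.grading r) (u : U) :
    d.Kills a r (r - 2) (Z.rep.flip u) := fun f hf hf' w => by
  rw [LinearMap.flip_apply, Z.kills _ (VOA.smear_mem_Ozhu ha w hf hf'), LinearMap.zero_apply]

theorem flip_mem_coModule (u : U) : Z.rep.flip u ∈ d.coModule U := fun a => by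
  refine homogeneous_induction d.internal (p := fun a => ∃ K L, d.Kills a K L (Z.rep.flip u))
    (fun r a ha => ⟨_, _, Z.kills_flip ha u⟩) ⟨0, 0, fun f _ _ w => by simp [VOA.smear_zero]⟩ ?_ a
  rintro x y ⟨K, L, h⟩ ⟨K', L', h'⟩
  exact ⟨max K K', min L L', (h.mono (le_max_left _ _) (min_le_left _ _)).vec_add
      (h'.mono (le_max_right _ _) (min_le_right _ _))⟩

theorem flip_mem_coGr (u : U) : Z.rep.flip u ∈ d.coGr U 0 := by
  rw [VOA.mem_coGr_iff]
  intro w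
  rw [LinearMap.flip_apply, VOA.euler, LinearMap.add_apply,
    Z.kills _ (VOA.conformal_add_mem_Ozhu w)]
  simp

theorem coMode_flip {r : ℤ} {a : V} (ha : a ∈ d.grading r) (u : U) :
    d.coMode a (r - 1) (Z.rep.flip u) = Z.rep.flip (Z.rep a u) := by
  refine LinearMap.ext fun w => ?_
  have hf : Approx ((-1) ^ (-1 : ℤ)) (r - 1) r (r - 2) (ly ^ (r - 1) * lx ^ (-1 : ℤ)) :=
    ⟨ly_mul_lx_mem_degLE (by omega), by simpa using ly_mul_lx_sub_mem_ordY (r - 1) (-1)⟩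
  have h := (Z.kills_flip ha u).coMode_spec hf w
  rw [mul_comm, VOA.smear_lx_zpow_mul_ly_zpow] at h
  have h' : Z.rep.flip u (d.hres (r - 1) 1 a w) = Z.rep.flip u (d.star w a) := by
    refine homogeneous_induction d.internal
      (p := fun w => Z.rep.flip u (d.hres (r - 1) 1 a w) = Z.rep.flip u (d.star w a))
      (fun s w hw => ?_) ?_ (fun x y hx hy => ?_) w
    · refine VOA.map_hres_eq_map_star (fun x hx => ?_) ha hw
      rw [LinearMap.flip_apply, Z.kills x hx, LinearMap.zero_apply]
    · rw [VOA.star, d.bres_zero_left]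
      congr 1
      rw [VOA.hres_eq]
      exact binomSum_of_eq_zero _ fun i => map_zero _
    · rw [VOA.star] at *
      rw [d.bres_add_left, d.hres_add_right, map_add, map_add, hx, hy]
  rw [show -(-1 : ℤ) = 1 by ring, h', LinearMap.flip_apply, Z.mul_compat] at h
  rw [LinearMap.flip_apply]
  simp at h
  exact h.symm

theorem flip_vacuum (u : U) : Z.rep.flip u d.vacuum = u := by
  rw [LinearMap.flip_apply, Z.one_compat, Module.End.one_apply]

end RepOf

namespace WeakMod

variable {d : VOA V} (W : WeakMod d M)

/-- The restriction of a weak module to a stable subspace. -/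
def restrict (P : Submodule ℂ M) (hP : W.IsStable P) : WeakMod d P where
  act u n := (W.act u n).restrict (hP u n)
  act_add u v n := LinearMap.ext fun w => Subtype.ext (by simp [W.act_add])
  act_smul c u n := LinearMap.ext fun w => Subtype.ext (by simp [W.act_smul])
  truncation u w := by
    obtain ⟨N, hN⟩ := W.truncation u w
    exact ⟨N, fun n hn => Subtype.ext (hN n hn)⟩
  vacuum_act w n := Subtype.ext (by
    have := W.vacuum_act w n
    split_ifs at this ⊢ <;> exact this)
  borcherds p q r u v w := by
    have hinj : Function.Injective P.subtype.toAddMonoidHom := P.injective_subtype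
    refine hinj ?_
    rw [AddMonoidHom.map_finsum_of_injective _ hinj, AddMonoidHom.map_finsum_of_injective _ hinj]
    exact W.borcherds p q r u v w

variable {W} {G : ℤ → Submodule ℂ M} {X : Set M}

theorem iSupIndep_comap_subtype (hG : iSupIndep G) (P : Submodule ℂ M) :
    iSupIndep fun n => (G n).comap P.subtype := by
  intro n
  rw [Submodule.disjoint_def]
  intro x hx hx'
  refine Subtype.ext (Submodule.disjoint_def.1 (hG n) x hx ?_)
  have := Submodule.mem_map_of_mem (f := P.subtype) hx'
  simp only [Submodule.map_iSup] at this
  exact iSup₂_mono (fun _ _ => Submodule.map_comap_le _ _) this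

theorem iSup_comap_subtype_span {S : Set M} (hS : ∀ x ∈ S, ∃ n, x ∈ G n) :
    ⨆ n, (G n).comap (Submodule.span ℂ S).subtype = ⊤ := by
  refine Submodule.map_injective_of_injective (Submodule.span ℂ S).injective_subtype ?_
  rw [Submodule.map_iSup, Submodule.map_top, Submodule.range_subtype]
  simp only [Submodule.map_comap_subtype]
  refine le_antisymm (iSup_le fun n => inf_le_left) (Submodule.span_le.2 fun x hx => ?_)
  obtain ⟨n, hn⟩ := hS x hx
  exact Submodule.mem_iSup_of_mem n ⟨Submodule.subset_span hx, hn⟩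

section Generated

variable (hG : iSupIndep G) (hact : ∀ r, ∀ a ∈ d.grading r, ∀ m n, ∀ w ∈ G n,
    W.act a m w ∈ G (r + n - m - 1)) (hX : X ⊆ G 0) (hX' : X ⊆ W.OmegaSet 0)

include hact hX in
theorem iSup_comap_generated : ⨆ n, (G n).comap (W.toModeMap.generated X).subtype = ⊤ := by
  rw [ModeMap.generated_eq_span_homogeneous]
  refine iSup_comap_subtype_span ?_
  rintro _ ⟨r, u, hu, n, x, hx, rfl⟩
  exact ⟨_, hact r u hu n 0 x (hX hx)⟩

include hG hact hX hX' in
theorem eq_zero_of_mem_generated {n : ℤ} (hn : n < 0) {y : M} (hy : y ∈ W.toModeMap.generated X)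
    (hy' : y ∈ G n) : y = 0 := by
  refine Submodule.disjoint_def.1 (hG n) y hy' ?_
  rw [ModeMap.generated_eq_span_homogeneous] at hy
  refine Submodule.span_le.2 ?_ hy
  rintro _ ⟨r, u, hu, m, x, hx, rfl⟩
  by_cases h : r ≤ m
  · have h0 : W.toModeMap.act u m x = 0 := act_eq_zero_of_mem_omega (hX' hx) hu h
    rw [h0]
    exact zero_mem _
  · exact Submodule.mem_iSup_of_mem _ (Submodule.mem_iSup_of_mem (by omega)
      (hact r u hu m 0 x (hX hx)))

/-- The admissible module generated by vectors of degree zero. -/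
noncomputable def admGenerated : AdmMod d (W.toModeMap.generated X) where
  toWeakMod := W.restrict _ (W.isStable_generated X)
  gr n := (G n).comap (W.toModeMap.generated X).subtype
  gr_internal := DirectSum.isInternal_submodule_of_iSupIndep_of_iSup_eq_top
    (iSupIndep_comap_subtype hG _) (iSup_comap_generated hact hX)
  gr_neg _ hn := (Submodule.eq_bot_iff _).2 fun y hy =>
    Subtype.ext (eq_zero_of_mem_generated hG hact hX hX' hn y.2 hy)
  gr_act r u hu m n w hw := hact r u hu m n w hw

theorem admGenerated_generated_eq_top :
    (admGenerated hG hact hX hX').toModeMap.generated (Subtype.val ⁻¹' X) = ⊤ := by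
  refine Submodule.map_injective_of_injective (W.toModeMap.generated X).injective_subtype ?_
  rw [Submodule.map_top, Submodule.range_subtype]
  refine le_antisymm (Submodule.map_subtype_le _ _) (Submodule.span_le.2 ?_)
  rintro _ ⟨u, n, x, hx, rfl⟩
  exact ⟨_, Submodule.subset_span ⟨u, n, ⟨x, W.subset_generated hx⟩, hx, rfl⟩, rfl⟩

end Generated

end WeakMod

theorem AdmMod.isIrreducible_of_isSimple_zhuRep {d : VOA V} {A : AdmMod d M}
    (htop : A.toModeMap.generated (A.gr 0) = ⊤) (hs : A.zhuRep.IsSimple)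
    (hnd : ∀ n, ∀ w ∈ A.gr n, w ≠ 0 → ∃ r, ∃ a ∈ d.grading r, A.act a (r - 1 + n) w ≠ 0) :
    A.IsIrreducible := by
  obtain ⟨⟨u, hu⟩, hs⟩ := hs
  refine ⟨⟨u, fun h => hu (Subtype.ext h)⟩, fun P hP hgr => ?_⟩
  rw [A.isGraded_iff] at hgr
  refine (hs (P.comap (A.gr 0).subtype) fun v x hx => ?_).imp (fun h => ?_) fun h => ?_
  · change ((A.zhuRep.rep v x : A.gr 0) : M) ∈ P
    rw [A.zhuRep_apply]
    refine homogeneous_induction d.internal (p := fun v => A.toWeakMod.o v (x : M) ∈ P)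
      (fun r v hv => ?_) ?_ (fun v v' h h' => ?_) v
    · rw [A.o_of_mem hv]
      exact hP v _ _ hx
    · rw [A.o_zero_left]
      exact P.zero_mem
    · rw [A.o_add_left]
      exact P.add_mem h h'
  · refine (Submodule.eq_bot_iff _).2 fun x hx => ?_
    have hzero : ∀ n, gradedProj A.gr_internal n x = 0 := by
      intro n
      by_contra hne
      obtain ⟨r, a, ha, hne'⟩ := hnd n _ (gradedProj_mem _ n x) hne
      have h0 := A.gr_act r a ha (r - 1 + n) n _ (gradedProj_mem A.gr_internal n x)
      rw [show r + n - (r - 1 + n) - 1 = 0 by ring] at h0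
      have hmem : (⟨_, h0⟩ : A.gr 0) ∈ P.comap (A.gr 0).subtype := hP a _ _ (hgr x hx n)
      rw [h, Submodule.mem_bot] at hmem
      exact hne' (congrArg Subtype.val hmem)
    rw [← finsum_gradedProj A.gr_internal x]
    simp [hzero]
  · rw [eq_top_iff, ← htop]
    refine Submodule.span_le.2 ?_
    rintro _ ⟨v, n, x, hx, rfl⟩
    have hx' : (⟨x, hx⟩ : A.gr 0) ∈ P.comap (A.gr 0).subtype := h ▸ Submodule.mem_top
    exact hP v n x hx'

namespace RepOf

variable {d : VOA V} {U : Type} [AddCommGroup U] [Module ℂ U]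

theorem isSimple_of_repEquiv {Z : RepOf d.Ozhu d.star d.vacuum U}
    {Z' : RepOf d.Ozhu d.star d.vacuum M} (h : RepEquiv Z Z') (hZ : Z.IsSimple) : Z'.IsSimple := by
  obtain ⟨e, he⟩ := h
  obtain ⟨⟨u, hu⟩, hs⟩ := hZ
  refine ⟨⟨e u, by simpa using hu⟩, fun P hP => ?_⟩
  have hmap : (P.comap e.toLinearMap).map e.toLinearMap = P :=
    Submodule.map_comap_eq_of_surjective e.surjective P
  refine (hs (P.comap e.toLinearMap) fun v x hx => ?_).imp (fun h => ?_) fun h => ?_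
  · change e (Z.rep v x) ∈ P
    rw [he]
    exact hP v _ hx
  · rw [← hmap, h, Submodule.map_bot]
  · rw [← hmap, h, Submodule.map_top, LinearMap.range_eq_top.2 e.surjective]

section generators

variable {Z : RepOf d.Ozhu d.star d.vacuum U} {A : AdmMod d M} {φ : U →ₗ[ℂ] M}

theorem gr_zero_le_range (hmem : ∀ u, φ u ∈ A.gr 0)
    (hact : ∀ (r : ℤ) (a : V), a ∈ d.grading r → ∀ u, A.act a (r - 1) (φ u) = φ (Z.rep a u))
    (htop : A.toModeMap.generated (Set.range φ) = ⊤) : A.gr 0 ≤ LinearMap.range φ := by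
  intro y hy
  have hX : Set.range φ ⊆ (A.gr 0 : Set M) := by
    rintro _ ⟨u, rfl⟩
    exact hmem u
  have h := A.gradedProj_generated hX (y := y) (htop ▸ Submodule.mem_top) 0
  rw [gradedProj_self _ hy] at h
  refine Submodule.span_le.2 ?_ h
  rintro _ ⟨r, a, ha, _, ⟨u, rfl⟩, rfl⟩
  refine ⟨Z.rep a u, ?_⟩
  rw [← hact r a ha, add_zero, sub_zero]

theorem repEquiv_zhuRep (hinj : Function.Injective φ) (hmem : ∀ u, φ u ∈ A.gr 0)
    (hact : ∀ (r : ℤ) (a : V), a ∈ d.grading r → ∀ u, A.act a (r - 1) (φ u) = φ (Z.rep a u))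
    (htop : A.toModeMap.generated (Set.range φ) = ⊤) : RepEquiv Z A.zhuRep := by
  refine ⟨LinearEquiv.ofBijective (φ.codRestrict (A.gr 0) hmem)
    ⟨fun u u' h => hinj (congrArg Subtype.val h), fun y => ?_⟩, fun v x => ?_⟩
  · obtain ⟨u, hu⟩ := gr_zero_le_range hmem hact htop y.2
    exact ⟨u, Subtype.ext hu⟩
  · refine Subtype.ext ?_
    rw [AdmMod.zhuRep_apply]
    change φ (Z.rep v x) = A.toWeakMod.o v (φ x)
    refine homogeneous_induction d.internal
      (p := fun v => φ (Z.rep v x) = A.toWeakMod.o v (φ x))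
      (fun r v hv => ?_) ?_ (fun v v' h h' => ?_) v
    · rw [WeakMod.o_of_mem _ hv, hact r v hv]
    · simp [WeakMod.o_zero_left]
    · rw [A.o_add_left, map_add, LinearMap.add_apply, map_add, h, h']

end generators

variable (Z : RepOf d.Ozhu d.star d.vacuum U)

/-- The embedding of a representation of Zhu's algebra into `coModule`. -/
noncomputable def toCoModule : U →ₗ[ℂ] d.coModule U :=
  Z.rep.flip.codRestrict _ Z.flip_mem_coModule

theorem coe_toCoModule (u : U) : (Z.toCoModule u : V →ₗ[ℂ] U) = Z.rep.flip u := rfl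

theorem toCoModule_injective : Function.Injective Z.toCoModule := fun u u' h => by
  rw [← Z.flip_vacuum u, ← Z.flip_vacuum u', ← coe_toCoModule, h, coe_toCoModule]

theorem range_toCoModule_subset_omega :
    Set.range Z.toCoModule ⊆ (d.coWeakMod U).OmegaSet 0 := by
  rintro _ ⟨u, rfl⟩ r a ha m hm
  exact Subtype.ext ((Z.kills_flip ha u).coMode_eq_zero (by push_cast at hm; omega))

theorem act_toCoModule {r : ℤ} {a : V} (ha : a ∈ d.grading r) (u : U) :
    (d.coWeakMod U).act a (r - 1) (Z.toCoModule u) = Z.toCoModule (Z.rep a u) :=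
  Subtype.ext (Z.coMode_flip ha u)

/-- The subspace of `coModule` generated by a representation of Zhu's algebra. -/
def Carrier : Type := (d.coWeakMod U).toModeMap.generated (Set.range Z.toCoModule)

noncomputable instance : AddCommGroup Z.Carrier :=
  inferInstanceAs (AddCommGroup ((d.coWeakMod U).toModeMap.generated (Set.range Z.toCoModule)))

noncomputable instance : Module ℂ Z.Carrier :=
  inferInstanceAs (Module ℂ ((d.coWeakMod U).toModeMap.generated (Set.range Z.toCoModule)))

/-- The admissible module generated by a representation of Zhu's algebra in its `coModule`. -/
noncomputable def admMod : AdmMod d Z.Carrier :=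
  WeakMod.admGenerated (G := fun n => (d.coGr U n).comap (d.coModule U).subtype)
    (WeakMod.iSupIndep_comap_subtype VOA.iSupIndep_coGr _)
    (fun _ _ ha _ _ w hw => VOA.coMode_mem_coGr ha w.2 hw)
    (by rintro _ ⟨u, rfl⟩; exact Z.flip_mem_coGr u) Z.range_toCoModule_subset_omega

/-- The embedding of a representation of Zhu's algebra into `admMod`. -/
noncomputable def toAdmMod : U →ₗ[ℂ] Z.Carrier :=
  Z.toCoModule.codRestrict _ fun u => WeakMod.subset_generated _ ⟨u, rfl⟩

theorem toAdmMod_injective : Function.Injective Z.toAdmMod := fun _ _ h =>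
  Z.toCoModule_injective (congrArg Subtype.val h)

theorem toAdmMod_mem (u : U) : Z.toAdmMod u ∈ Z.admMod.gr 0 := Z.flip_mem_coGr u

theorem act_toAdmMod (r : ℤ) (a : V) (ha : a ∈ d.grading r) (u : U) :
    Z.admMod.act a (r - 1) (Z.toAdmMod u) = Z.toAdmMod (Z.rep a u) :=
  Subtype.ext (Z.act_toCoModule ha u)

theorem admMod_generated_eq_top : Z.admMod.toModeMap.generated (Set.range Z.toAdmMod) = ⊤ := by
  have h := WeakMod.admGenerated_generated_eq_top (W := d.coWeakMod U)
    (G := fun n => (d.coGr U n).comap (d.coModule U).subtype)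
    (WeakMod.iSupIndep_comap_subtype VOA.iSupIndep_coGr _)
    (fun _ _ ha _ _ w hw => VOA.coMode_mem_coGr ha w.2 hw)
    (by rintro _ ⟨u, rfl⟩; exact Z.flip_mem_coGr u) Z.range_toCoModule_subset_omega
  refine Eq.trans ?_ h
  unfold admMod
  congr 1
  ext y
  exact ⟨fun ⟨u, hu⟩ => ⟨u, congrArg Subtype.val hu⟩, fun ⟨u, hu⟩ => ⟨u, Subtype.ext hu⟩⟩

theorem repEquiv_zhuRep_admMod : RepEquiv Z Z.admMod.zhuRep :=
  repEquiv_zhuRep Z.toAdmMod_injective Z.toAdmMod_mem Z.act_toAdmMod Z.admMod_generated_eq_top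

theorem isIrreducible_admMod (hZ : Z.IsSimple) : Z.admMod.IsIrreducible := by
  refine AdmMod.isIrreducible_of_isSimple_zhuRep ?_
    (isSimple_of_repEquiv Z.repEquiv_zhuRep_admMod hZ) ?_
  · rw [eq_top_iff, ← Z.admMod_generated_eq_top]
    refine Submodule.span_mono ?_
    rintro _ ⟨v, n, _, ⟨u, rfl⟩, rfl⟩
    exact ⟨v, n, _, Z.toAdmMod_mem u, rfl⟩
  · intro n w hw hne
    by_contra! hzero
    refine hne (Subtype.ext (Subtype.ext (VOA.eq_zero_of_coMode_eq_zero (n := n) w.1.2 hw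
      fun r a ha m hm => ?_)))
    have h0 : Z.admMod.act a m w = 0 := by
      rcases hm.eq_or_lt with rfl | hm
      · exact hzero r a ha
      · have := Z.admMod.gr_act r a ha m n w hw
        rwa [Z.admMod.gr_neg _ (by omega), Submodule.mem_bot] at this
    exact congrArg (fun y => ((y : d.coModule U) : V →ₗ[ℂ] U)) (congrArg Subtype.val h0)

theorem gr_zero_admMod_ne_bot (hZ : Z.IsSimple) : Z.admMod.gr 0 ≠ ⊥ := by
  obtain ⟨⟨u, hu⟩, -⟩ := hZ
  refine (Submodule.ne_bot_iff _).2 ⟨_, Z.toAdmMod_mem u, fun h => hu ?_⟩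
  exact Z.toAdmMod_injective (by rw [h, map_zero])

end RepOf

/-- `M ↦ M(0)` induces a bijection between equivalence classes of
irreducible admissible `V`-modules (with `M(0) ≠ 0`) and equivalence classes of simple
`A(V)`-modules. -/
theorem stmt6 (d : VOA V) :
    (∀ (M : Type) [AddCommGroup M] [Module ℂ M] (A : AdmMod d M),
      A.IsIrreducible → A.gr 0 ≠ ⊥ →
      ∃ Z : RepOf d.Ozhu d.star d.vacuum (A.gr 0),
        (∀ (v : V) (w : A.gr 0), ((Z.rep v) w : M) = A.toWeakMod.o v (w : M)) ∧
        Z.IsSimple) ∧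
    (∀ (U : Type) [AddCommGroup U] [Module ℂ U] (Z : RepOf d.Ozhu d.star d.vacuum U),
      Z.IsSimple →
      ∃ (M : Type) (iM : AddCommGroup M),
        letI := iM;
        ∃ (mM : Module ℂ M),
          letI := mM;
          ∃ A : AdmMod d M, A.IsIrreducible ∧ A.gr 0 ≠ ⊥ ∧
            ∃ Z' : RepOf d.Ozhu d.star d.vacuum (A.gr 0),
              (∀ (v : V) (w : A.gr 0), ((Z'.rep v) w : M) = A.toWeakMod.o v (w : M)) ∧
              RepEquiv Z Z') ∧
    (∀ (M₁ M₂ : Type) [AddCommGroup M₁] [Module ℂ M₁] [AddCommGroup M₂] [Module ℂ M₂]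
      (A₁ : AdmMod d M₁) (A₂ : AdmMod d M₂),
      A₁.IsIrreducible → A₂.IsIrreducible → A₁.gr 0 ≠ ⊥ → A₂.gr 0 ≠ ⊥ →
      ∀ (Z₁ : RepOf d.Ozhu d.star d.vacuum (A₁.gr 0))
        (Z₂ : RepOf d.Ozhu d.star d.vacuum (A₂.gr 0)),
        (∀ (v : V) (w : A₁.gr 0), ((Z₁.rep v) w : M₁) = A₁.toWeakMod.o v (w : M₁)) →
        (∀ (v : V) (w : A₂.gr 0), ((Z₂.rep v) w : M₂) = A₂.toWeakMod.o v (w : M₂)) →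
        (AdmEquiv A₁ A₂ ↔ RepEquiv Z₁ Z₂)) := by
  refine ⟨fun M _ _ A hA h0 => ⟨A.zhuRep, A.zhuRep_apply, hA.isSimple_zhuRep h0⟩,
    fun U _ _ Z hZ => ⟨Z.Carrier, inferInstance, inferInstance, Z.admMod, Z.isIrreducible_admMod hZ,
      Z.gr_zero_admMod_ne_bot hZ, Z.admMod.zhuRep, Z.admMod.zhuRep_apply,
      Z.repEquiv_zhuRep_admMod⟩, fun M₁ M₂ _ _ _ _ A₁ A₂ h₁ h₂ n₁ n₂ Z₁ Z₂ hZ₁ hZ₂ => ?_⟩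
  unfold RepEquiv
  rw [RepOf.eq_zhuRep A₁ Z₁ hZ₁, RepOf.eq_zhuRep A₂ Z₂ hZ₂]
  exact ⟨repEquiv_of_admEquiv h₁ h₂ n₁ n₂, admEquiv_of_repEquiv h₁ h₂ n₁ n₂⟩
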